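/- Let f : ℝ^n → ℝ be analytic on an open neighborhood U of the origin with f(0) = 0. Fix a positive rational number ℓ and a real number a < 0, and set V^{ℓ,a} = {x ∈ ℝ^n : x ≠ 0 and f(x) ≤ a·|x|^ℓ}. Then there exists r₀ > 0 with the closed ball of radius r₀ contained in U such that for every r ∈ (0, r₀] there exists y₀ < 0 such that for every y ∈ [y₀, 0), the sets S_r^{ℓ,a} = {x : |x| = r} ∩ V^{ℓ,a} and F^{ℓ,a}(y) = {x : |x| ≤ r₀, f(x) = y} ∩ V^{ℓ,a} (as topological subspaces of ℝ^n) are homotopy equivalent. -/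

import Mathlib

section
open Filter Topology

namespace WP

section BaseChange
variable {κ : Type} [Fintype κ] [DecidableEq κ]
variable {A : Type} [NormedCommRing A] [NormedAlgebra ℝ A]

/-- base change of a formal multilinear series to a commutative Banach algebra -/
noncomputable def bc (A : Type) [NormedCommRing A] [NormedAlgebra ℝ A]
    (p : FormalMultilinearSeries ℝ (κ → ℝ) ℝ) :
    FormalMultilinearSeries ℝ (κ → A) A := fun k =>
  ∑ w : Fin k → κ, p k (fun i => Pi.single (w i) 1) •
    (ContinuousMultilinearMap.mkPiAlgebra ℝ (Fin k) A).compContinuousLinearMap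
      (fun i => ContinuousLinearMap.proj (w i))

theorem bc_apply (p : FormalMultilinearSeries ℝ (κ → ℝ) ℝ) (k : ℕ) (b : κ → A) :
    bc A p k (fun _ => b) = ∑ w : Fin k → κ, p k (fun i => Pi.single (w i) 1) • ∏ i, b (w i) := by
  simp [bc]

theorem bc_real (p : FormalMultilinearSeries ℝ (κ → ℝ) ℝ) (k : ℕ) (b : κ → ℝ) :
    bc ℝ p k (fun _ => b) = p k (fun _ => b) := by
  rw [bc_apply]
  have : b = ∑ j, b j • (Pi.single j (1:ℝ) : κ → ℝ) := by
    ext i; simp [Finset.sum_apply, Pi.single_apply]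
  conv_rhs => rw [this]
  rw [ContinuousMultilinearMap.map_sum]
  refine Finset.sum_congr rfl fun w _ => ?_
  rw [ContinuousMultilinearMap.map_smul_univ]
  simp [mul_comm]

theorem bc_norm (p : FormalMultilinearSeries ℝ (κ → ℝ) ℝ) (k : ℕ) :
    ‖bc A p k‖ ≤ (Fintype.card κ : ℝ) ^ k * (‖p k‖ * (max 1 ‖(1:A)‖)) := by
  unfold bc
  refine (norm_sum_le _ _).trans ?_
  have : ∀ w ∈ (Finset.univ : Finset (Fin k → κ)),
      ‖p k (fun i => Pi.single (w i) 1) •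
    (ContinuousMultilinearMap.mkPiAlgebra ℝ (Fin k) A).compContinuousLinearMap
      (fun i => ContinuousLinearMap.proj (R := ℝ) (φ := fun _ : κ => A) (w i))‖ ≤ ‖p k‖ * (max 1 ‖(1:A)‖) := by
    intro w _
    rw [norm_smul]
    refine mul_le_mul ?_ ?_ (norm_nonneg _) (norm_nonneg _)
    · refine ((p k).le_opNorm _).trans ?_
      have : ∏ i, ‖(Pi.single (w i) 1 : κ → ℝ)‖ ≤ 1 := by
        refine Finset.prod_le_one (fun _ _ => norm_nonneg _) fun i _ => ?_
        refine (pi_norm_le_iff_of_nonneg zero_le_one).2 fun j => ?_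
        by_cases h : j = w i
        · subst h; simp
        · simp [h]
      nlinarith [norm_nonneg (p k)]
    · refine (ContinuousMultilinearMap.norm_compContinuousLinearMap_le _ _).trans ?_
      have h1 : ∏ i : Fin k, ‖ContinuousLinearMap.proj (R := ℝ) (φ := fun _ : κ => A) (w i)‖ ≤ 1 := by
        refine Finset.prod_le_one (fun _ _ => norm_nonneg _) fun i _ => ?_
        refine ContinuousLinearMap.opNorm_le_bound _ zero_le_one fun x => ?_
        rw [one_mul]; exact norm_le_pi_norm x (w i)
      have h2 : ‖ContinuousMultilinearMap.mkPiAlgebra ℝ (Fin k) A‖ ≤ max 1 ‖(1:A)‖ := by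
        rcases Nat.eq_zero_or_pos k with h | h
        · subst h; rw [ContinuousMultilinearMap.norm_mkPiAlgebra_of_empty]; exact le_max_right _ _
        · have : Nonempty (Fin k) := ⟨⟨0, h⟩⟩
          exact (ContinuousMultilinearMap.norm_mkPiAlgebra_le).trans (le_max_left _ _)
      calc _ ≤ max 1 ‖(1:A)‖ * 1 := mul_le_mul h2 h1 (by positivity) (by positivity)
        _ = _ := mul_one _
  refine (Finset.sum_le_sum this).trans ?_
  simp

theorem bc_radius (p : FormalMultilinearSeries ℝ (κ → ℝ) ℝ) (hp : 0 < p.radius) :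
    ∃ ρ : NNReal, 0 < ρ ∧ ∀ (A : Type) [NormedCommRing A] [NormedAlgebra ℝ A], (ρ : ENNReal) ≤ (bc A p).radius := by
  obtain ⟨r, hr0, hr⟩ := ENNReal.lt_iff_exists_nnreal_btwn.1 hp
  obtain ⟨C, hC0, hC⟩ := p.norm_mul_pow_le_of_lt_radius hr
  have hr0' : 0 < r := by simpa using hr0
  refine ⟨r / (Fintype.card κ + 1), by positivity, fun A _ _ => ?_⟩
  refine FormalMultilinearSeries.le_radius_of_bound _ (C * max 1 ‖(1:A)‖) fun k => ?_
  have h1 := bc_norm (A := A) p k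
  have h2 := hC k
  push_cast
  rw [div_pow]
  have hc : ((Fintype.card κ : ℝ)) ^ k ≤ ((Fintype.card κ : ℝ) + 1) ^ k := by gcongr; linarith
  have hpos : 0 < ((Fintype.card κ : ℝ) + 1) ^ k := by positivity
  rw [mul_div_assoc', div_le_iff₀ hpos]
  calc ‖bc A p k‖ * (r:ℝ) ^ k ≤ ((Fintype.card κ : ℝ) ^ k * (‖p k‖ * (max 1 ‖(1:A)‖))) * (r:ℝ)^k := by gcongr
    _ = (‖p k‖ * (r:ℝ)^k) * max 1 ‖(1:A)‖ * (Fintype.card κ : ℝ) ^ k := by ring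
    _ ≤ C * max 1 ‖(1:A)‖ * ((Fintype.card κ : ℝ) + 1) ^ k := by gcongr

variable [CompleteSpace A]

theorem bc_map {A' : Type} [NormedCommRing A'] [NormedAlgebra ℝ A'] [CompleteSpace A']
    (p : FormalMultilinearSeries ℝ (κ → ℝ) ℝ) {ρ : NNReal} (h1 : (ρ : ENNReal) ≤ (bc A p).radius)
    (φ : A →ₐ[ℝ] A') (hφ : ∀ b, ‖φ b‖ ≤ ‖b‖) (b : κ → A) (hb : ‖b‖ < ρ) :
    φ ((bc A p).sum b) = (bc A' p).sum (fun j => φ (b j)) := by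
  have hc : Continuous φ := by
    have : Continuous (φ.toLinearMap.mkContinuous 1 (by simpa using hφ)) := ContinuousLinearMap.continuous _
    exact this
  have hs : HasSum (fun n => bc A p n (fun _ => b)) ((bc A p).sum b) := by
    refine (bc A p).hasSum ?_
    rw [Metric.mem_eball, edist_zero_right]
    refine lt_of_lt_of_le ?_ h1
    rw [← ofReal_norm]
    rw [ENNReal.ofReal_lt_coe_iff (norm_nonneg _)]
    exact hb
  have := hs.map φ.toLinearMap.toAddMonoidHom hc
  refine HasSum.unique this ?_ |>.symm ▸ rfl
  have e : (⇑φ.toLinearMap.toAddMonoidHom ∘ fun n => bc A p n (fun _ => b)) = fun n => bc A' p n (fun _ => fun j => φ (b j)) := by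
    ext n
    simp [bc_apply, map_sum, map_prod]
  rw [e]
  have h3 : Summable (fun n => bc A' p n (fun _ => fun j => φ (b j))) := by
    rw [← e]; exact this.summable
  exact h3.hasSum

theorem base_change (G : (κ → ℝ) → ℝ) (hG : AnalyticAt ℝ G 0) :
    ∃ ρ : ℝ, 0 < ρ ∧ ∃ Gh : (κ → A) → A, AnalyticOnNhd ℝ Gh (Metric.ball 0 ρ) ∧
      (∀ χ : A →ₐ[ℝ] ℝ, (∀ b, ‖χ b‖ ≤ ‖b‖) → ∀ b, ‖b‖ < ρ → χ (Gh b) = G (fun j => χ (b j))) ∧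
      (∀ η : A →ₐ[ℝ] A, (∀ b, ‖η b‖ ≤ ‖b‖) → ∀ b, ‖b‖ < ρ → η (Gh b) = Gh (fun j => η (b j))) := by
  obtain ⟨p, R, hp⟩ := hG
  obtain ⟨ρ0, hρ0, hr⟩ := bc_radius p (hp.r_pos.trans_le hp.r_le)
  obtain ⟨R', hR0, hR'⟩ := ENNReal.lt_iff_exists_nnreal_btwn.1 hp.r_pos
  have hR0' : 0 < R' := by simpa using hR0
  set ρ := min ρ0 R' with hρ
  have hρp : 0 < ρ := lt_min hρ0 hR0'
  refine ⟨ρ, hρp, (bc A p).sum, ?_, ?_, ?_⟩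
  · have h1 : 0 < (bc A p).radius := lt_of_lt_of_le (by exact_mod_cast hρ0) (hr A)
    have h2 := (bc A p).hasFPowerSeriesOnBall h1
    intro x hx
    refine h2.analyticOnNhd x ?_
    rw [Metric.mem_eball, edist_zero_right, ← ofReal_norm]
    refine lt_of_lt_of_le ?_ (hr A)
    rw [ENNReal.ofReal_lt_coe_iff (norm_nonneg _)]
    rw [mem_ball_zero_iff] at hx
    exact lt_of_lt_of_le hx (by exact_mod_cast min_le_left _ _)
  · intro χ hχ b hb
    rw [bc_map p (hr A) χ hχ b (lt_of_lt_of_le hb (by exact_mod_cast min_le_left _ _))]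
    have hlt : ‖(fun j => χ (b j))‖ < ρ := by
      refine lt_of_le_of_lt ?_ hb
      refine (pi_norm_le_iff_of_nonneg (norm_nonneg _)).2 fun j => (hχ _).trans (norm_le_pi_norm b j)
    have h4 := hp.hasSum (y := fun j => χ (b j)) (by
      rw [Metric.mem_eball, edist_zero_right, ← ofReal_norm]
      refine lt_of_lt_of_le ?_ hR'.le
      rw [ENNReal.ofReal_lt_coe_iff (norm_nonneg _)]
      exact lt_of_lt_of_le hlt (by exact_mod_cast min_le_right _ _))
    rw [zero_add] at h4
    rw [FormalMultilinearSeries.sum, ← h4.tsum_eq]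
    exact tsum_congr fun n => bc_real p n _
  · intro η hη b hb
    exact bc_map p (hr A) η hη b (lt_of_lt_of_le hb (by exact_mod_cast min_le_left _ _))

end BaseChange

/-- the algebra of polynomials with the l1 norm -/
def LP : Type := Polynomial ℝ
noncomputable instance : CommRing LP := inferInstanceAs (CommRing (Polynomial ℝ))
noncomputable instance : Algebra ℝ LP := inferInstanceAs (Algebra ℝ (Polynomial ℝ))

open Polynomial in
noncomputable def l1 (p : ℝ[X]) : ℝ := ∑ i ∈ p.support, |p.coeff i|

open Polynomial in
theorem l1_eq (p : ℝ[X]) (s : Finset ℕ) (h : p.support ⊆ s) : l1 p = ∑ i ∈ s, |p.coeff i| := by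
  refine Finset.sum_subset h fun i _ hi => ?_
  simp [Polynomial.notMem_support_iff.1 hi]

open Polynomial in
theorem l1_nonneg (p : ℝ[X]) : 0 ≤ l1 p := Finset.sum_nonneg fun _ _ => abs_nonneg _

open Polynomial in
theorem l1_add (p q : ℝ[X]) : l1 (p + q) ≤ l1 p + l1 q := by
  classical
  rw [l1_eq p (p.support ∪ q.support) Finset.subset_union_left,
    l1_eq q (p.support ∪ q.support) Finset.subset_union_right,
    l1_eq (p+q) (p.support ∪ q.support) Polynomial.support_add, ← Finset.sum_add_distrib]
  exact Finset.sum_le_sum fun i _ => by rw [coeff_add]; exact abs_add_le _ _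

open Polynomial in
theorem l1_sum {ι : Type*} (s : Finset ι) (f : ι → ℝ[X]) : l1 (∑ i ∈ s, f i) ≤ ∑ i ∈ s, l1 (f i) := by
  classical
  induction s using Finset.induction_on with
  | empty => simp [l1]
  | insert a s ha ih =>
    rw [Finset.sum_insert ha, Finset.sum_insert ha]
    exact (l1_add _ _).trans (by gcongr)

open Polynomial in
theorem l1_smul (c : ℝ) (p : ℝ[X]) : l1 (c • p) = |c| * l1 p := by
  rw [l1_eq (c • p) p.support (Polynomial.support_smul c p), l1, Finset.mul_sum]
  exact Finset.sum_congr rfl fun i _ => by simp [abs_mul]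

open Polynomial in
theorem l1_neg (p : ℝ[X]) : l1 (-p) = l1 p := by
  have := l1_smul (-1) p
  simpa using this

open Polynomial in
theorem divX_smul1 (c : ℝ) (p : ℝ[X]) : divX (c • p) = c • divX p := by
  ext i; simp [coeff_divX]

open Polynomial in
theorem l1_divX (p : ℝ[X]) : l1 (divX p) ≤ l1 p := by
  have h2 : ((divX p).support.map (addRightEmbedding 1)) ⊆ p.support := by
    intro i hi
    obtain ⟨j, hj, rfl⟩ := Finset.mem_map.1 hi
    rw [Polynomial.mem_support_iff, coeff_divX] at hj
    simpa using hj
  calc l1 (divX p) = ∑ i ∈ ((divX p).support.map (addRightEmbedding 1)), |p.coeff i| := by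
        rw [Finset.sum_map, l1]; simp [coeff_divX]
    _ ≤ l1 p := Finset.sum_le_sum_of_subset_of_nonneg h2 fun _ _ _ => abs_nonneg _

open Polynomial in
theorem l1_coeff0 (p : ℝ[X]) : |p.coeff 0| ≤ l1 p := by
  by_cases h : 0 ∈ p.support
  · exact Finset.single_le_sum (f := fun i => |p.coeff i|) (fun _ _ => abs_nonneg _) h
  · rw [Polynomial.notMem_support_iff.1 h, abs_zero]; exact l1_nonneg p

open Polynomial in
theorem l1_aeval {B : Type} [NormedCommRing B] [NormedAlgebra ℝ B] (x : B) (hx : ∀ i : ℕ, ‖x ^ i‖ ≤ 1) (p : ℝ[X]) :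
    ‖aeval x p‖ ≤ l1 p := by
  have : aeval x p = ∑ i ∈ p.support, p.coeff i • x ^ i := by
    rw [aeval_def, eval₂_eq_sum, Polynomial.sum]
    exact Finset.sum_congr rfl fun i _ => by rw [Algebra.smul_def]
  rw [this, l1]
  refine (norm_sum_le _ _).trans (Finset.sum_le_sum fun i _ => ?_)
  rw [norm_smul, Real.norm_eq_abs]
  nlinarith [hx i, abs_nonneg (p.coeff i)]

open Polynomial in
theorem poly_decomp (p : ℝ[X]) : p = p.coeff 0 • (1 : ℝ[X]) + X * divX p := by
  conv_lhs => rw [← X_mul_divX_add p]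
  rw [Polynomial.smul_eq_C_mul, mul_one, add_comm]

open Polynomial in
theorem divX_X_mul1 (p : ℝ[X]) : divX (X * p) = p := by
  ext i; simp [coeff_divX, coeff_X_mul]

open Polynomial in
theorem coeff0_X_mul1 (p : ℝ[X]) : (X * p).coeff 0 = 0 := by
  simp

open Polynomial in
theorem l1_X_pow_mul (n : ℕ) (p : ℝ[X]) : l1 (X ^ n * p) ≤ l1 p := by
  have h : (X ^ n * p).support ⊆ p.support.map (addRightEmbedding n) := by
    intro i hi
    rw [Polynomial.mem_support_iff, coeff_X_pow_mul'] at hi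
    split_ifs at hi with h
    · exact Finset.mem_map.2 ⟨i - n, Polynomial.mem_support_iff.2 hi, by simp [h]⟩
    · exact absurd rfl hi
  rw [l1_eq _ _ h, Finset.sum_map, l1]
  exact (Finset.sum_congr rfl fun i _ => by simp).le

open Polynomial in
theorem l1_mul (p q : ℝ[X]) : l1 (p * q) ≤ l1 p * l1 q := by
  conv_lhs => rw [p.as_sum_support_C_mul_X_pow, Finset.sum_mul]
  refine (l1_sum _ _).trans ?_
  rw [l1, Finset.sum_mul]
  refine Finset.sum_le_sum fun i _ => ?_
  rw [mul_assoc, ← Polynomial.smul_eq_C_mul, l1_smul]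
  gcongr
  exact l1_X_pow_mul i q

noncomputable instance : SeminormedCommRing LP :=
  { RingSeminorm.toSeminormedRing (R := LP)
      { toFun := fun p => l1 p
        map_zero' := by show l1 0 = 0; simp [l1]
        add_le' := fun p q => l1_add p q
        neg' := fun p => by
          exact l1_neg p
        mul_le' := fun p q => l1_mul p q } with
    mul_comm := fun a b => mul_comm a b }

theorem LP_norm (p : LP) : ‖p‖ = l1 p := rfl

noncomputable instance : NormedAlgebra ℝ LP :=
  { (inferInstance : Algebra ℝ LP) with
    norm_smul_le := fun c p => (l1_smul c p).le }

/-- Banach algebra data -/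
structure WAlg (A : Type) [NormedCommRing A] [NormedAlgebra ℝ A] where
  T : A
  S : A →L[ℝ] A
  c : A →L[ℝ] ℝ
  χ : ℝ → A →ₐ[ℝ] ℝ
  η : ℝ → A →ₐ[ℝ] A
  T_le : ‖T‖ ≤ 1
  S_le : ∀ b, ‖S b‖ ≤ ‖b‖
  c_le : ∀ b, ‖c b‖ ≤ ‖b‖
  decomp : ∀ b, b = c b • 1 + T * S b
  S_T : ∀ b, S (T * b) = b
  c_T : ∀ b, c (T * b) = 0
  c_one : c 1 = 1
  S_one : S 1 = 0
  χ_le : ∀ τ, |τ| ≤ 1 → ∀ b, ‖χ τ b‖ ≤ ‖b‖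
  χ_T : ∀ τ, |τ| ≤ 1 → χ τ T = τ
  η_le : ∀ τ, |τ| ≤ 1 → ∀ b, ‖η τ b‖ ≤ ‖b‖
  η_T : ∀ τ, |τ| ≤ 1 → η τ T = τ • T

abbrev BA : Type := UniformSpace.Completion LP

open Polynomial in
noncomputable def LPshift : LP →ₗ[ℝ] LP where
  toFun := fun p => (Polynomial.divX p : ℝ[X])
  map_add' := fun p q => (Polynomial.divX_add : divX ((p:ℝ[X]) + q) = _)
  map_smul' := fun c p => divX_smul1 c p

open Polynomial in
noncomputable def LPc : LP →ₗ[ℝ] ℝ := (Polynomial.lcoeff ℝ 0 : ℝ[X] →ₗ[ℝ] ℝ)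

theorem LPshift_le (p : LP) : ‖LPshift p‖ ≤ ‖p‖ := l1_divX p

theorem LPc_le (p : LP) : ‖LPc p‖ ≤ ‖p‖ := l1_coeff0 p

open Polynomial in
noncomputable def LPev {B : Type} [NormedCommRing B] [NormedAlgebra ℝ B] (x : B) : LP →ₐ[ℝ] B :=
  (Polynomial.aeval x : ℝ[X] →ₐ[ℝ] B)

theorem LPev_le {B : Type} [NormedCommRing B] [NormedAlgebra ℝ B] (x : B) (hx : ∀ i : ℕ, ‖x ^ i‖ ≤ 1) (p : LP) :
    ‖LPev x p‖ ≤ ‖p‖ := l1_aeval x hx p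

theorem BA_ext_hom {B : Type} [NormedCommRing B] [NormedAlgebra ℝ B] [CompleteSpace B] (f : LP →ₐ[ℝ] B)
    (hf : ∀ p, ‖f p‖ ≤ ‖p‖) : ∃ g : BA →ₐ[ℝ] B, (∀ p : LP, g p = f p) ∧ ∀ b, ‖g b‖ ≤ ‖b‖ := by
  have hc : Continuous f := (f.toLinearMap.mkContinuous 1 (by simpa using hf)).continuous
  have hg : Continuous (UniformSpace.Completion.extensionHom f.toRingHom hc) :=
    UniformSpace.Completion.continuous_extension
  have he : ∀ p : LP, UniformSpace.Completion.extensionHom f.toRingHom hc p = f p :=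
    fun p => UniformSpace.Completion.extensionHom_coe f.toRingHom hc p
  refine ⟨{ UniformSpace.Completion.extensionHom f.toRingHom hc with
    commutes' := fun r => ?_ }, he, fun b => ?_⟩
  · show UniformSpace.Completion.extensionHom f.toRingHom hc ((algebraMap ℝ LP r : LP) : BA) = _
    rw [he]; simp
  · show ‖UniformSpace.Completion.extensionHom f.toRingHom hc b‖ ≤ ‖b‖
    refine UniformSpace.Completion.induction_on b (isClosed_le (hg.norm) continuous_norm) fun p => ?_
    rw [he, UniformSpace.Completion.norm_coe]; exact hf p

theorem BA_ext_lin {B : Type} [NormedAddCommGroup B] [NormedSpace ℝ B] [CompleteSpace B] (f : LP →ₗ[ℝ] B)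
    (hf : ∀ p, ‖f p‖ ≤ ‖p‖) : ∃ g : BA →L[ℝ] B, (∀ p : LP, g p = f p) ∧ ∀ b, ‖g b‖ ≤ ‖b‖ := by
  set f' := f.mkContinuous 1 (by simpa using hf)
  set g := f'.extend (UniformSpace.Completion.toComplL (𝕜 := ℝ) (E := LP))
  have he : ∀ p : LP, g p = f p := fun p =>
    f'.extend_eq (e := UniformSpace.Completion.toComplL (𝕜 := ℝ) (E := LP))
      UniformSpace.Completion.denseRange_coe
      (UniformSpace.Completion.isUniformInducing_coe LP) p
  refine ⟨g, he, fun b => ?_⟩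
  refine UniformSpace.Completion.induction_on b (isClosed_le (g.continuous.norm) continuous_norm) fun p => ?_
  rw [he, UniformSpace.Completion.norm_coe]; exact hf p

open Polynomial in
theorem exists_WAlg : Nonempty (WAlg BA) := by
  obtain ⟨S, hS, hS1⟩ := BA_ext_lin ((UniformSpace.Completion.toComplL (𝕜 := ℝ) (E := LP)).toLinearMap.comp LPshift)
    (fun p => by simpa using LPshift_le p)
  obtain ⟨c, hc, hc1⟩ := BA_ext_lin LPc LPc_le
  let XX : LP := (X : ℝ[X])
  have hX : ‖XX‖ ≤ 1 := by
    show l1 (X : ℝ[X]) ≤ 1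
    rw [l1_eq X {1} (by rw [Polynomial.support_X])]; simp
  have hX1 : ∀ i : ℕ, ‖XX ^ i‖ ≤ 1 := by
    intro i
    show l1 (X ^ i : ℝ[X]) ≤ 1
    rw [l1_eq (X ^ i) {i} (by rw [Polynomial.support_X_pow])]; simp
  have hχ : ∀ τ : ℝ, ∃ g : BA →ₐ[ℝ] ℝ, |τ| ≤ 1 → ((∀ p : LP, g p = LPev τ p) ∧ ∀ b, ‖g b‖ ≤ ‖b‖) := by
    intro τ
    by_cases h : |τ| ≤ 1
    · obtain ⟨g, hg⟩ := BA_ext_hom (LPev τ) (LPev_le τ fun i => by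
        rw [norm_pow]; exact pow_le_one₀ (norm_nonneg _) h)
      exact ⟨g, fun _ => hg⟩
    · obtain ⟨g, hg⟩ := BA_ext_hom (LPev (0:ℝ)) (LPev_le 0 fun i => by
        rw [norm_pow]; exact pow_le_one₀ (norm_nonneg _) (by simp))
      exact ⟨g, fun h' => absurd h' h⟩
  have hη : ∀ τ : ℝ, ∃ g : BA →ₐ[ℝ] BA, |τ| ≤ 1 → ((∀ p : LP, g p = LPev (τ • (XX : BA)) p) ∧ ∀ b, ‖g b‖ ≤ ‖b‖) := by
    intro τ
    by_cases h : |τ| ≤ 1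
    · obtain ⟨g, hg⟩ := BA_ext_hom (LPev (τ • (XX : BA))) (LPev_le _ fun i => by
        rw [_root_.smul_pow, norm_smul, norm_pow,
          show ((XX : BA)) ^ i = ((XX ^ i : LP) : BA) from (map_pow UniformSpace.Completion.coeRingHom XX i).symm,
          UniformSpace.Completion.norm_coe]
        exact mul_le_one₀ (pow_le_one₀ (norm_nonneg _) h) (norm_nonneg _) (hX1 i))
      exact ⟨g, fun _ => hg⟩
    · exact ⟨AlgHom.id ℝ BA, fun h' => absurd h' h⟩
  choose χ hχ using hχ
  choose η hη using hη
  have hcc : ∀ (p : LP), ((c (p : BA)) • (1 : BA)) = ((LPc p • (1 : LP) : LP) : BA) := by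
    intro p; rw [hc, UniformSpace.Completion.coe_smul, UniformSpace.Completion.coe_one]
  refine ⟨⟨(XX : BA), S, c, χ, η, ?_, hS1, hc1, ?_, ?_, ?_, ?_, ?_, fun τ h => (hχ τ h).2, ?_, fun τ h => (hη τ h).2, ?_⟩⟩
  · rw [UniformSpace.Completion.norm_coe]; exact hX
  · intro b
    refine UniformSpace.Completion.induction_on b (isClosed_eq continuous_id (by fun_prop)) fun p => ?_
    rw [hcc, hS]
    show ((p : LP) : BA) = ((LPc p • (1 : LP) : LP) : BA) + (XX : BA) * ((LPshift p : LP) : BA)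
    rw [← UniformSpace.Completion.coe_mul, ← UniformSpace.Completion.coe_add]
    congr 1
    exact poly_decomp p
  · intro b
    refine UniformSpace.Completion.induction_on b (isClosed_eq (by fun_prop) continuous_id) fun p => ?_
    rw [← UniformSpace.Completion.coe_mul, hS]
    show ((LPshift (XX * p) : LP) : BA) = p
    congr 1
    exact divX_X_mul1 p
  · intro b
    refine UniformSpace.Completion.induction_on b (isClosed_eq (by fun_prop) continuous_const) fun p => ?_
    rw [← UniformSpace.Completion.coe_mul, hc]
    exact coeff0_X_mul1 p
  · rw [← UniformSpace.Completion.coe_one, hc]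
    show (1 : ℝ[X]).coeff 0 = 1
    simp
  · rw [← UniformSpace.Completion.coe_one, hS]
    show ((LPshift 1 : LP) : BA) = 0
    rw [← UniformSpace.Completion.coe_zero]
    congr 1
    show divX (1 : ℝ[X]) = 0
    simp
  · intro τ h
    rw [(hχ τ h).1]
    show aeval τ (X : ℝ[X]) = τ
    simp
  · intro τ h
    rw [(hη τ h).1]
    show aeval _ (X : ℝ[X]) = _
    simp

end WP

end

section
open Filter Topology
namespace WP

namespace WAlg
variable {A : Type} [NormedCommRing A] [NormedAlgebra ℝ A] (D : WAlg A)

theorem decomp_pow (d : ℕ) (b : A) :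
    b = ∑ i ∈ Finset.range d, D.c ((D.S ^ i) b) • D.T ^ i + D.T ^ d * (D.S ^ d) b := by
  induction d with
  | zero => simp
  | succ d ih =>
    rw [Finset.sum_range_succ]
    conv_lhs => rw [ih, D.decomp ((D.S ^ d) b)]
    have : (D.S ^ (d+1)) b = D.S ((D.S ^ d) b) := by rw [pow_succ']; rfl
    rw [this, mul_add, mul_smul_comm, mul_one, pow_succ]
    ring

theorem proj_pow (d : ℕ) : ∀ (r : ℕ → ℝ) (q : A),
    (D.S ^ d) (∑ i ∈ Finset.range d, r i • D.T ^ i + D.T ^ d * q) = q ∧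
    ∀ j < d, D.c ((D.S ^ j) (∑ i ∈ Finset.range d, r i • D.T ^ i + D.T ^ d * q)) = r j := by
  induction d with
  | zero => intro r q; simp
  | succ d ih =>
    intro r q
    have e : ∑ i ∈ Finset.range (d+1), r i • D.T ^ i + D.T ^ (d+1) * q
        = r 0 • 1 + D.T * (∑ i ∈ Finset.range d, r (i+1) • D.T ^ i + D.T ^ d * q) := by
      rw [Finset.sum_range_succ', mul_add, Finset.mul_sum]
      have : ∀ i, D.T * r (i+1) • D.T ^ i = r (i+1) • D.T ^ (i+1) := by
        intro i; rw [mul_smul_comm, pow_succ']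
      simp only [this, pow_zero]
      ring
    have hS : D.S (r 0 • 1 + D.T * (∑ i ∈ Finset.range d, r (i+1) • D.T ^ i + D.T ^ d * q)) =
        (∑ i ∈ Finset.range d, r (i+1) • D.T ^ i + D.T ^ d * q) := by
      rw [map_add, map_smul, D.S_one, D.S_T]; simp
    have hS' : ∀ j (z : A), (D.S ^ (j+1)) z = (D.S ^ j) (D.S z) := by
      intro j z; rw [pow_succ]; rfl
    rw [e]
    refine ⟨?_, ?_⟩
    · rw [hS', hS]; exact (ih _ _).1
    · intro j hj
      rcases j with _ | j
      · simp [D.c_T, D.c_one]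
      · rw [hS', hS]; exact (ih (fun i => r (i+1)) q).2 j (by omega)

theorem S_norm : ‖D.S‖ ≤ 1 := D.S.opNorm_le_bound zero_le_one (by simpa using D.S_le)

variable [CompleteSpace A]

theorem isUnit_one_sub {τ : ℝ} (h : |τ| < 1) : IsUnit (1 - τ • D.S) := by
  refine isUnit_one_sub_of_norm_lt_one ?_
  rw [norm_smul, Real.norm_eq_abs]
  have := D.S_norm
  nlinarith [abs_nonneg τ, norm_nonneg D.S]

theorem hom_eq (f : A →ₐ[ℝ] ℝ) {σ : ℝ} (hσ : |σ| < 1) (hf : f D.T = σ) (b : A) :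
    f b = D.c (Ring.inverse (1 - σ • D.S) b) := by
  have h1 : ∀ z, f ((1 - σ • D.S) z) = D.c z := by
    intro z
    have : f z = D.c z + σ * f (D.S z) := by
      conv_lhs => rw [D.decomp z]
      simp [hf]
    simp [this]
  have h2 : (1 - σ • D.S) (Ring.inverse (1 - σ • D.S) b) = b := by
    have := Ring.mul_inverse_cancel _ (D.isUnit_one_sub hσ)
    exact DFunLike.congr_fun this b
  conv_lhs => rw [← h2]
  exact h1 _

theorem clm_app {X Y Z : Type} [NormedAddCommGroup X] [NormedSpace ℝ X] [NormedAddCommGroup Y] [NormedSpace ℝ Y]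
    [NormedAddCommGroup Z] [NormedSpace ℝ Z] {g : X → Y →L[ℝ] Z} {h : X → Y} {x : X}
    (hg : AnalyticAt ℝ g x) (hh : AnalyticAt ℝ h x) : AnalyticAt ℝ (fun x => g x (h x)) x :=
  AnalyticAt.fun_comp (g := fun p : (Y →L[ℝ] Z) × Y => p.1 p.2) (f := fun x => (g x, h x))
    ((ContinuousLinearMap.id ℝ (Y →L[ℝ] Z)).analyticAt_bilinear _) (hg.prod hh)

theorem χ_analyticAt {τ : ℝ} (h : |τ| < 1) (b : A) :
    AnalyticAt ℝ (fun z : ℝ × A => D.χ z.1 z.2) (τ, b) := by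
  have h1 : AnalyticAt ℝ (fun z : ℝ × A => D.c (Ring.inverse (1 - z.1 • D.S) z.2)) (τ, b) := by
    refine (D.c.analyticAt _).comp ?_
    have h2 : AnalyticAt ℝ (fun z : ℝ × A => Ring.inverse (1 - z.1 • D.S)) (τ, b) := by
      refine AnalyticAt.fun_comp (g := Ring.inverse) (f := fun z : ℝ × A => (1 - z.1 • D.S)) ?_ (analyticAt_const.sub (analyticAt_fst.smul analyticAt_const))
      obtain ⟨u, hu⟩ := D.isUnit_one_sub h
      rw [show (1 - (τ, b).1 • D.S) = (u : A →L[ℝ] A) from hu.symm]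
      exact analyticAt_inverse u
    exact clm_app h2 analyticAt_snd
  refine h1.congr ?_
  have : ∀ᶠ z : ℝ × A in 𝓝 (τ, b), |z.1| < 1 :=
    (isOpen_lt (by fun_prop) continuous_const).mem_nhds h
  filter_upwards [this] with z hz
  exact (D.hom_eq (D.χ z.1) hz (D.χ_T _ hz.le) _).symm

theorem χ_zero (b : A) : D.χ 0 b = D.c b := by
  have := D.hom_eq (D.χ 0) (by simp) (D.χ_T 0 (by simp)) b
  rw [this]
  have e : (1 - (0:ℝ) • D.S) = 1 := by ext z; simp
  rw [e, Ring.inverse_one]; rfl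

theorem χ_η {τ l : ℝ} (hτ : |τ| ≤ 1) (hl : |l| < 1) (b : A) : D.χ τ (D.η l b) = D.χ (l * τ) b := by
  have h1 : |l * τ| < 1 := by rw [abs_mul]; nlinarith [abs_nonneg l, abs_nonneg τ]
  have := D.hom_eq ((D.χ τ).comp (D.η l)) h1 (by simp [D.η_T l hl.le, D.χ_T τ hτ])
  rw [D.hom_eq _ h1 (D.χ_T _ h1.le), ← this b]; rfl

theorem χ_expand {τ : ℝ} (h : |τ| ≤ 1) (d : ℕ) (b : A) :
    D.χ τ b = ∑ i ∈ Finset.range d, D.c ((D.S ^ i) b) * τ ^ i + τ ^ d * D.χ τ ((D.S ^ d) b) := by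
  conv_lhs => rw [D.decomp_pow d b]
  simp [D.χ_T τ h]

theorem χ_eq_zero {τ : ℝ} (h : |τ| < 1) (b : A) (hb : ∀ i, D.c ((D.S ^ i) b) = 0) : D.χ τ b = 0 := by
  have hle : ∀ d, ‖(D.S ^ d) b‖ ≤ ‖b‖ := by
    intro d
    induction d with
    | zero => simp
    | succ d ih =>
      rw [pow_succ']
      exact (D.S_le _).trans ih
  have h1 : ∀ d, |D.χ τ b| ≤ |τ| ^ d * ‖b‖ := by
    intro d
    rw [D.χ_expand h.le d b]
    simp only [hb, zero_mul, Finset.sum_const_zero, zero_add, abs_mul, abs_pow]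
    gcongr
    exact (D.χ_le τ h.le _).trans (hle d)
  have h2 : Tendsto (fun d : ℕ => |τ| ^ d * ‖b‖) atTop (𝓝 0) := by
    simpa using (tendsto_pow_atTop_nhds_zero_of_lt_one (abs_nonneg τ) h).mul_const ‖b‖
  have := ge_of_tendsto' h2 h1
  exact abs_eq_zero.1 (le_antisymm this (abs_nonneg _))

theorem param {E : Type} [NormedAddCommGroup E] [NormedSpace ℝ E] [FiniteDimensional ℝ E]
    (F : ℝ × E → ℝ) (hF : AnalyticAt ℝ F 0) :
    ∃ ρ > (0:ℝ), ∃ ε > (0:ℝ), ∃ b : E → A, AnalyticOnNhd ℝ b (Metric.ball 0 ε) ∧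
      ∀ y ∈ Metric.ball (0:E) ε, ∀ τ, |τ| ≤ 1 → D.χ τ (b y) = F (τ * ρ, y) := by
  let m := Module.finrank ℝ E
  have L : E ≃L[ℝ] (Fin m → ℝ) := ContinuousLinearEquiv.ofFinrankEq (by simp [m])
  let G : (Option (Fin m) → ℝ) → ℝ := fun x => F (x none, L.symm (fun i => x (some i)))
  have hG : AnalyticAt ℝ G 0 := by
    refine AnalyticAt.fun_comp (g := F) (f := fun x : Option (Fin m) → ℝ => (x none, L.symm (fun i => x (some i)))) ?_ ?_
    · have : ((0 : Option (Fin m) → ℝ) none, L.symm (fun i => (0 : Option (Fin m) → ℝ) (some i))) = (0 : ℝ × E) := by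
        ext1
        · rfl
        · exact map_zero L.symm
      rw [this]; exact hF
    · let M : (Option (Fin m) → ℝ) →L[ℝ] ℝ × E :=
        (ContinuousLinearMap.proj none).prod
          ((L.symm : (Fin m → ℝ) →L[ℝ] E).comp (ContinuousLinearMap.pi fun i => ContinuousLinearMap.proj (some i)))
      exact M.analyticAt 0
  obtain ⟨ρ, hρ, Gh, hGh, hχ, -⟩ := base_change (A := A) G hG
  let B : E → (Option (Fin m) → A) := fun y o => o.elim ((ρ/2) • D.T) (fun i => (L y i) • 1)
  have hBc : Continuous B := by
    refine continuous_pi fun o => ?_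
    rcases o with _ | i
    · exact continuous_const
    · show Continuous fun y => (L y i) • (1 : A)
      fun_prop
  have hBa : ∀ y, AnalyticAt ℝ B y := by
    intro y
    refine AnalyticAt.pi fun o => ?_
    rcases o with _ | i
    · exact analyticAt_const
    · show AnalyticAt ℝ (fun y => (L y i) • (1 : A)) y
      exact ((((ContinuousLinearMap.proj i).comp (L : E →L[ℝ] (Fin m → ℝ))) : E →L[ℝ] ℝ).smulRight (1:A)).analyticAt y
  have hB0 : ‖B 0‖ < ρ := by
    refine lt_of_le_of_lt ?_ (half_lt_self hρ)
    refine (pi_norm_le_iff_of_nonneg (by positivity)).2 fun o => ?_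
    rcases o with _ | i
    · show ‖(ρ/2) • D.T‖ ≤ ρ/2
      rw [norm_smul, Real.norm_eq_abs, abs_of_pos (by positivity)]
      nlinarith [D.T_le]
    · show ‖(L 0 i) • (1 : A)‖ ≤ _
      simp; positivity
  obtain ⟨ε, hε, hε2⟩ := Metric.isOpen_iff.1 ((isOpen_lt hBc.norm continuous_const)) 0 hB0
  refine ⟨ρ/2, by positivity, ε, hε, fun y => Gh (B y), ?_, ?_⟩
  · intro y hy
    exact AnalyticAt.fun_comp (hGh _ (by rw [mem_ball_zero_iff]; exact hε2 hy)) (hBa y)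
  · intro y hy τ hτ
    rw [hχ (D.χ τ) (D.χ_le τ hτ) _ (hε2 hy)]
    show F _ = F _
    congr 1
    ext1
    · show D.χ τ ((ρ/2) • D.T) = τ * (ρ/2)
      simp [D.χ_T τ hτ, mul_comm]
    · show L.symm (fun i => D.χ τ ((L y i) • (1:A))) = y
      simp
end WAlg

/-- factoring out the maximal power of the first variable -/
theorem FACg {A : Type} [NormedCommRing A] [NormedAlgebra ℝ A] [CompleteSpace A] (D : WAlg A)
    {E : Type} [NormedAddCommGroup E] [NormedSpace ℝ E] [FiniteDimensional ℝ E]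
    (F : ℝ × E → ℝ) (hF : AnalyticAt ℝ F 0) (hne : ¬ ∀ᶠ z in 𝓝 (0 : ℝ × E), F z = 0) :
    ∃ k : ℕ, ∃ G : ℝ × E → ℝ, AnalyticAt ℝ G 0 ∧ (∀ᶠ z in 𝓝 (0 : ℝ × E), F z = z.1 ^ k * G z) ∧
      ¬ ∀ᶠ y in 𝓝 (0 : E), G (0, y) = 0 := by
  classical
  obtain ⟨ρ, hρ, ε, hε, b, hb, hbF⟩ := D.param F hF
  have hev : ∀ᶠ z : ℝ × E in 𝓝 0, z.2 ∈ Metric.ball (0:E) ε ∧ |z.1 / ρ| < 1 := by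
    refine (IsOpen.mem_nhds (s := {z : ℝ × E | z.2 ∈ Metric.ball (0:E) ε ∧ |z.1 / ρ| < 1}) ?_ ?_)
    · have h1 : IsOpen {z : ℝ × E | |z.1 / ρ| < 1} := isOpen_lt (by fun_prop) continuous_const
      exact (Metric.isOpen_ball.preimage continuous_snd).inter h1
    · simp [hε]
  have han : ∀ k, AnalyticOnNhd ℝ (fun y => D.c ((D.S ^ k) (b y))) (Metric.ball 0 ε) := fun k y hy =>
    ((D.c.comp (D.S ^ k)).analyticAt _).fun_comp (hb y hy)
  have hex : ∃ k, ¬ ∀ᶠ y in 𝓝 (0:E), D.c ((D.S ^ k) (b y)) = 0 := by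
    by_contra hcon
    push Not at hcon
    apply hne
    filter_upwards [hev] with z hz
    have h0 : ∀ k, D.c ((D.S ^ k) (b z.2)) = 0 := fun k =>
      (han k).eqOn_zero_of_preconnected_of_eventuallyEq_zero (convex_ball _ _).isPreconnected
        (Metric.mem_ball_self hε) (hcon k) hz.1
    have := hbF z.2 hz.1 (z.1/ρ) hz.2.le
    rw [D.χ_eq_zero hz.2 _ h0, div_mul_cancel₀ _ hρ.ne'] at this
    exact this.symm
  refine ⟨Nat.find hex, fun z => (ρ ^ (Nat.find hex))⁻¹ * D.χ (z.1/ρ) ((D.S ^ (Nat.find hex)) (b z.2)), ?_, ?_, ?_⟩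
  · refine analyticAt_const.mul ?_
    refine AnalyticAt.fun_comp (g := fun z : ℝ × A => D.χ z.1 z.2)
      (f := fun z : ℝ × E => (z.1/ρ, (D.S ^ (Nat.find hex)) (b z.2))) ?_ ?_
    · exact D.χ_analyticAt (by simp) _
    · refine AnalyticAt.prod ?_ ?_
      · simp only [div_eq_mul_inv]; exact AnalyticAt.mul (by first | exact analyticAt_fst | exact analyticAt_snd) analyticAt_const
      · exact ((D.S ^ (Nat.find hex)).analyticAt _).fun_comp ((hb 0 (Metric.mem_ball_self hε)).fun_comp (f := Prod.snd) (x := (0 : ℝ × E)) analyticAt_snd)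
  · have h1 : ∀ᶠ y in 𝓝 (0:E), ∀ i ∈ Finset.range (Nat.find hex), D.c ((D.S ^ i) (b y)) = 0 := by
      rw [Filter.eventually_all_finset]
      intro i hi
      have := Nat.find_min hex (Finset.mem_range.1 hi)
      push Not at this
      exact this
    have h2 : ∀ᶠ z : ℝ × E in 𝓝 0, ∀ i ∈ Finset.range (Nat.find hex), D.c ((D.S ^ i) (b z.2)) = 0 :=
      (continuous_snd.tendsto (0 : ℝ × E)).eventually h1
    filter_upwards [hev, h2] with z hz hz2
    have := hbF z.2 hz.1 (z.1/ρ) hz.2.le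
    rw [div_mul_cancel₀ _ hρ.ne', D.χ_expand hz.2.le (Nat.find hex)] at this
    rw [← (show F (z.1, z.2) = F z from rfl), ← this, Finset.sum_eq_zero (fun i hi => by rw [hz2 i hi, zero_mul]), div_pow]
    field_simp
    ring
  · intro hcon
    apply Nat.find_spec hex
    filter_upwards [hcon] with y hy
    simp only [zero_div, D.χ_zero] at hy
    rcases mul_eq_zero.1 hy with h | h
    · exact absurd h (by positivity)
    · exact h

/-- Weierstrass preparation -/
theorem WPTg {A : Type} [NormedCommRing A] [NormedAlgebra ℝ A] [CompleteSpace A] (D : WAlg A)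
    {P : Type} [NormedAddCommGroup P] [NormedSpace ℝ P] [FiniteDimensional ℝ P]
    (G : P × ℝ → ℝ) (hG : AnalyticAt ℝ G 0) (hne : ¬ ∀ᶠ t in 𝓝 (0 : ℝ), G (0, t) = 0) :
    ∃ d : ℕ, ∃ a : ℕ → P → ℝ, (∀ i, AnalyticAt ℝ (a i) 0) ∧ (∀ i < d, a i 0 = 0) ∧ ∃ q : P × ℝ → ℝ, AnalyticAt ℝ q 0 ∧ q 0 ≠ 0 ∧
      (∀ᶠ z in 𝓝 (0 : P × ℝ), q z * G z = z.2 ^ d + ∑ i ∈ Finset.range d, a i z.1 * z.2 ^ i) := by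
  classical
  have hF : AnalyticAt ℝ (fun z : ℝ × P => G (z.2, z.1)) 0 :=
    AnalyticAt.fun_comp (g := G) (f := fun z : ℝ × P => (z.2, z.1)) hG (analyticAt_snd.prod analyticAt_fst)
  obtain ⟨ρ, hρ, ε, hε, b, hb, hbF⟩ := D.param _ hF
  have h00 : (0:P) ∈ Metric.ball (0:P) ε := Metric.mem_ball_self hε
  have hex : ∃ k, D.c ((D.S ^ k) (b 0)) ≠ 0 := by
    by_contra hcon
    push Not at hcon
    apply hne
    have : ∀ᶠ t : ℝ in 𝓝 0, |t / ρ| < 1 := (isOpen_lt (by fun_prop) continuous_const).mem_nhds (by simp)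
    filter_upwards [this] with t ht
    have := hbF 0 h00 (t/ρ) ht.le
    rw [D.χ_eq_zero ht _ hcon, div_mul_cancel₀ _ hρ.ne'] at this
    exact this.symm
  set d := Nat.find hex with hd
  have hmin : ∀ i < d, D.c ((D.S ^ i) (b 0)) = 0 := fun i hi => by
    have := Nat.find_min hex hi; push Not at this; exact this
  set u := (D.S ^ d) (b 0) with hu
  set w := D.c u with hw
  have hw0 : w ≠ 0 := Nat.find_spec hex
  have hb0 : b 0 = D.T ^ d * u := by
    conv_lhs => rw [D.decomp_pow d (b 0), Finset.sum_eq_zero (fun i hi => by rw [hmin i (Finset.mem_range.1 hi), zero_smul]), zero_add]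
  obtain ⟨l, hl0, hl1, hl2⟩ : ∃ l : ℝ, 0 < l ∧ l < 1 ∧ l * ‖D.S u‖ < |w| := by
    have hw' : 0 < |w| := abs_pos.2 hw0
    refine ⟨min (1/2) (|w| / (2 * (‖D.S u‖ + 1))), by positivity, lt_of_le_of_lt (min_le_left _ _) (by norm_num), ?_⟩
    calc _ ≤ (|w| / (2 * (‖D.S u‖ + 1))) * ‖D.S u‖ := by gcongr; exact min_le_right _ _
      _ < |w| := by
        rw [div_mul_eq_mul_div, div_lt_iff₀ (by positivity)]
        nlinarith [norm_nonneg (D.S u)]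
  have hlabs : |l| < 1 := by rw [abs_of_pos hl0]; exact hl1
  have hunit : IsUnit (D.η l u) := by
    have e : D.η l u = w • (1 - (-(w⁻¹)) • (l • D.T * D.η l (D.S u))) := by
      conv_lhs => rw [D.decomp u]
      rw [map_add, map_smul, map_one, map_mul, D.η_T l hlabs.le, smul_sub, neg_smul, smul_neg, smul_smul,
        mul_inv_cancel₀ hw0, one_smul, sub_neg_eq_add]
    have h1 : IsUnit (1 - (-(w⁻¹)) • (l • D.T * D.η l (D.S u))) := by
      refine isUnit_one_sub_of_norm_lt_one ?_
      rw [norm_smul, norm_neg, norm_inv, Real.norm_eq_abs, inv_mul_lt_iff₀ (abs_pos.2 hw0), mul_one]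
      refine lt_of_le_of_lt ?_ hl2
      refine (norm_mul_le _ _).trans ?_
      rw [norm_smul, Real.norm_eq_abs, abs_of_pos hl0]
      have h3 := D.η_le l hlabs.le (D.S u)
      have h4 := D.T_le
      have : l * ‖D.T‖ ≤ l := by nlinarith
      exact mul_le_mul this h3 (norm_nonneg _) hl0.le
    rw [e, Algebra.smul_def]
    exact ((IsUnit.mk0 w hw0).map (algebraMap ℝ A)).mul h1
  obtain ⟨V, hV⟩ : IsUnit (l ^ d • D.η l u) := by
    rw [Algebra.smul_def]
    exact ((IsUnit.mk0 _ (pow_ne_zero d hl0.ne')).map (algebraMap ℝ A)).mul hunit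
  -- eta as continuous linear map
  let ηL : A →L[ℝ] A := (D.η l).toLinearMap.mkContinuous 1 (by simpa using D.η_le l hlabs.le)
  have hηL : ∀ z, ηL z = D.η l z := fun _ => rfl
  let b' : P → A := fun x => ηL (b x)
  have hb'a : AnalyticAt ℝ b' 0 := (ηL.analyticAt _).fun_comp (hb 0 h00)
  have hb'0 : b' 0 = D.T ^ d * V := by
    show D.η l (b 0) = _
    rw [hb0, hV, map_mul, map_pow, D.η_T l hlabs.le, smul_pow]
    simp [mul_smul_comm]
  have hb'χ : ∀ x ∈ Metric.ball (0:P) ε, ∀ τ, |τ| ≤ 1 → D.χ τ (b' x) = G (x, l * τ * ρ) := by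
    intro x hx τ hτ
    show D.χ τ (D.η l (b x)) = _
    rw [D.χ_η hτ hlabs, hbF x hx (l * τ)]
    rw [abs_mul]; nlinarith [abs_nonneg l, abs_nonneg τ]
  -- polynomial part
  let Pr : A →L[ℝ] A := ∑ i ∈ Finset.range d, (D.c.comp (D.S ^ i)).smulRight (D.T ^ i)
  have hPr : ∀ z, Pr z = ∑ i ∈ Finset.range d, D.c ((D.S ^ i) z) • D.T ^ i := by
    intro z; simp [Pr, ContinuousLinearMap.sum_apply]
  let M : A → (A →L[ℝ] A) := fun y => (ContinuousLinearMap.mul ℝ A y).comp (D.S ^ d) + Pr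
  have hM : ∀ y z, M y z = y * (D.S ^ d) z + Pr z := fun y z => rfl
  have hMa : ∀ y, AnalyticAt ℝ M y := by
    intro y
    let M' : A →L[ℝ] (A →L[ℝ] A) :=
      ((ContinuousLinearMap.compL ℝ A A A).flip (D.S ^ d)).comp (ContinuousLinearMap.mul ℝ A)
    exact (M'.analyticAt y).add analyticAt_const
  let N : A →L[ℝ] A := Pr + (ContinuousLinearMap.mul ℝ A (D.T ^ d * ((V⁻¹ : Aˣ) : A))).comp (D.S ^ d)
  have hN : ∀ z, N z = Pr z + D.T ^ d * (((V⁻¹ : Aˣ) : A) * (D.S ^ d) z) := fun z => by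
    show Pr z + (D.T ^ d * ((V⁻¹ : Aˣ) : A)) * (D.S ^ d) z = _
    rw [mul_assoc]
  have key : ∀ (z q : A), (D.S ^ d) (Pr z + D.T ^ d * q) = q ∧ Pr (Pr z + D.T ^ d * q) = Pr z := by
    intro z q
    have := D.proj_pow d (fun i => D.c ((D.S ^ i) z)) q
    refine ⟨by rw [hPr]; exact this.1, ?_⟩
    rw [hPr (_ + _)]
    rw [hPr z]
    exact Finset.sum_congr rfl fun j hj => by rw [this.2 j (Finset.mem_range.1 hj)]
  have hMN : M (b' 0) * N = 1 := by
    ext1 z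
    show M (b' 0) (N z) = z
    rw [hM, hN, (key _ _).1, (key _ _).2, hb'0, mul_assoc, Units.mul_inv_cancel_left, add_comm, hPr]
    exact (D.decomp_pow d z).symm
  have hNM : N * M (b' 0) = 1 := by
    ext1 z
    show N (M (b' 0) z) = z
    have e : M (b' 0) z = Pr z + D.T ^ d * (V * (D.S ^ d) z) := by
      rw [hM, hb'0]; ring
    rw [hN, e, (key _ _).1, (key _ _).2, Units.inv_mul_cancel_left, hPr]
    exact (D.decomp_pow d z).symm
  let U : (A →L[ℝ] A)ˣ := ⟨M (b' 0), N, hMN, hNM⟩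
  let zz : P → A := fun x => Ring.inverse (M (b' x)) (D.T ^ d)
  have hzz : AnalyticAt ℝ zz 0 := by
    have h2 : AnalyticAt ℝ (fun x => Ring.inverse (M (b' x))) 0 := by
      refine AnalyticAt.fun_comp (g := Ring.inverse) (f := fun x => M (b' x)) ?_ ((hMa _).fun_comp hb'a)
      exact analyticAt_inverse U
    exact WAlg.clm_app h2 analyticAt_const
  have hMzz : ∀ᶠ x in 𝓝 (0:P), M (b' x) (zz x) = D.T ^ d := by
    have h1 : ∀ᶠ y in 𝓝 (M (b' 0)), IsUnit y := Units.isOpen.mem_nhds U.isUnit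
    have h2 : ContinuousAt (fun x => M (b' x)) 0 := ((hMa _).fun_comp hb'a).continuousAt
    filter_upwards [h2.eventually h1] with x hx
    exact DFunLike.congr_fun (Ring.mul_inverse_cancel _ hx) (D.T ^ d)
  have hzz0 : (D.S ^ d) (zz 0) = ((V⁻¹ : Aˣ) : A) := by
    show (D.S ^ d) (Ring.inverse (M (b' 0)) (D.T ^ d)) = _
    have e1 : Ring.inverse (M (b' 0)) = N := Ring.inverse_unit U
    have e2 := D.proj_pow d (fun _ => 0) 1
    have e3 : D.T ^ d = ∑ i ∈ Finset.range d, (0:ℝ) • D.T ^ i + D.T ^ d * 1 := by simp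
    rw [e1, hN, (key _ _).1]
    conv_lhs => rw [e3]
    rw [e2.1, mul_one]
  have hzz1 : ∀ i < d, D.c ((D.S ^ i) (zz 0)) = 0 := by
    intro i hi
    show D.c ((D.S ^ i) (Ring.inverse (M (b' 0)) (D.T ^ d))) = _
    have e1 : Ring.inverse (M (b' 0)) = N := Ring.inverse_unit U
    have e2 := D.proj_pow d (fun _ => 0) 1
    have e3 : D.T ^ d = ∑ i ∈ Finset.range d, (0:ℝ) • D.T ^ i + D.T ^ d * 1 := by simp
    have e4 : Pr (D.T ^ d) = ∑ i ∈ Finset.range d, (0:ℝ) • D.T ^ i := by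
      rw [hPr, e3]
      exact Finset.sum_congr rfl fun j hj => by rw [e2.2 j (Finset.mem_range.1 hj)]
    rw [e1, hN, e4]
    exact (D.proj_pow d (fun _ => 0) _).2 i hi
  set σ := l * ρ with hσ
  have hσ0 : 0 < σ := by positivity
  refine ⟨d, fun i x => - (D.c ((D.S ^ i) (zz x)) * σ ^ (d - i)), ?_,
    fun i hi => by
      show -(D.c ((D.S ^ i) (zz 0)) * σ ^ (d - i)) = 0
      rw [hzz1 i hi, zero_mul, neg_zero], fun z => σ ^ d * D.χ (z.2 / σ) ((D.S ^ d) (zz z.1)), ?_, ?_, ?_⟩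
  · intro i
    refine (AnalyticAt.mul ?_ analyticAt_const).neg
    exact ((D.c.comp (D.S ^ i)).analyticAt _).fun_comp hzz
  · refine analyticAt_const.mul ?_
    refine AnalyticAt.fun_comp (g := fun z : ℝ × A => D.χ z.1 z.2)
      (f := fun z : P × ℝ => (z.2/σ, (D.S ^ d) (zz z.1))) ?_ ?_
    · exact D.χ_analyticAt (by simp) _
    · refine AnalyticAt.prod ?_ ?_
      · simp only [div_eq_mul_inv]; exact AnalyticAt.mul (by first | exact analyticAt_fst | exact analyticAt_snd) analyticAt_const
      · exact ((D.S ^ d).analyticAt _).fun_comp (hzz.fun_comp (f := Prod.fst) (g := zz) (x := (0 : P × ℝ)) analyticAt_fst)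
  · simp only [Prod.snd_zero, Prod.fst_zero, zero_div, hzz0]
    refine mul_ne_zero (by positivity) ?_
    exact ((V⁻¹).isUnit.map (D.χ 0)).ne_zero
  · have e1 : ∀ᶠ z : P × ℝ in 𝓝 0, z.1 ∈ Metric.ball (0:P) ε ∧ |z.2 / σ| < 1 := by
      refine (IsOpen.mem_nhds (s := {z : P × ℝ | z.1 ∈ Metric.ball (0:P) ε ∧ |z.2 / σ| < 1}) ?_ ?_)
      · have h1 : IsOpen {z : P × ℝ | |z.2 / σ| < 1} := isOpen_lt (by fun_prop) continuous_const
        exact (Metric.isOpen_ball.preimage continuous_fst).inter h1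
      · simp [hε]
    have e2 : ∀ᶠ z : P × ℝ in 𝓝 0, M (b' z.1) (zz z.1) = D.T ^ d :=
      (continuous_fst.tendsto (0 : P × ℝ)).eventually hMzz
    filter_upwards [e1, e2] with z hz1 hz2
    have h1 := congrArg (D.χ (z.2/σ)) hz2
    rw [hM, hPr, map_add, map_mul, map_pow, D.χ_T _ hz1.2.le, hb'χ _ hz1.1 _ hz1.2.le, map_sum] at h1
    have h2 : l * (z.2 / σ) * ρ = z.2 := by rw [hσ]; field_simp
    rw [h2] at h1
    have h3 : σ ^ d * (z.2/σ) ^ d = z.2 ^ d := by rw [← mul_pow]; congr 1; field_simp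
    have h4 : ∀ i ∈ Finset.range d, σ ^ d * D.χ (z.2/σ) (D.c ((D.S ^ i) (zz z.1)) • D.T ^ i) =
        D.c ((D.S ^ i) (zz z.1)) * σ ^ (d - i) * z.2 ^ i := by
      intro i hi
      have hi' := Finset.mem_range.1 hi
      rw [map_smul, map_pow, D.χ_T _ hz1.2.le, div_pow, smul_eq_mul]
      have : σ ^ d = σ ^ (d - i) * σ ^ i := by rw [← pow_add]; congr 1; omega
      rw [this]; field_simp
    have h5 := congrArg (fun t => σ ^ d * t) h1
    simp only [mul_add, Finset.mul_sum] at h5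
    rw [Finset.sum_congr rfl h4, h3] at h5
    show σ ^ d * D.χ (z.2 / σ) ((D.S ^ d) (zz z.1)) * G z = _
    have h6 : ∑ i ∈ Finset.range d, -(D.c ((D.S ^ i) (zz z.1)) * σ ^ (d - i)) * z.2 ^ i =
      - ∑ i ∈ Finset.range d, D.c ((D.S ^ i) (zz z.1)) * σ ^ (d - i) * z.2 ^ i := by
      rw [← Finset.sum_neg_distrib]; exact Finset.sum_congr rfl fun _ _ => by ring
    rw [h6, ← h5]
    ring

/-- factoring out the maximal power of the first variable -/
theorem FAC {E : Type} [NormedAddCommGroup E] [NormedSpace ℝ E] [FiniteDimensional ℝ E]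
    (F : ℝ × E → ℝ) (hF : AnalyticAt ℝ F 0) (hne : ¬ ∀ᶠ z in 𝓝 (0 : ℝ × E), F z = 0) :
    ∃ k : ℕ, ∃ G : ℝ × E → ℝ, AnalyticAt ℝ G 0 ∧ (∀ᶠ z in 𝓝 (0 : ℝ × E), F z = z.1 ^ k * G z) ∧
      ¬ ∀ᶠ y in 𝓝 (0 : E), G (0, y) = 0 := by
  obtain ⟨D⟩ := exists_WAlg
  exact FACg D F hF hne

/-- Weierstrass preparation -/
theorem WPT {P : Type} [NormedAddCommGroup P] [NormedSpace ℝ P] [FiniteDimensional ℝ P]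
    (G : P × ℝ → ℝ) (hG : AnalyticAt ℝ G 0) (hne : ¬ ∀ᶠ t in 𝓝 (0 : ℝ), G (0, t) = 0) :
    ∃ d : ℕ, ∃ a : ℕ → P → ℝ, (∀ i, AnalyticAt ℝ (a i) 0) ∧ (∀ i < d, a i 0 = 0) ∧ ∃ q : P × ℝ → ℝ, AnalyticAt ℝ q 0 ∧ q 0 ≠ 0 ∧
      (∀ᶠ z in 𝓝 (0 : P × ℝ), q z * G z = z.2 ^ d + ∑ i ∈ Finset.range d, a i z.1 * z.2 ^ i) := by
  obtain ⟨D⟩ := exists_WAlg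
  exact WPTg D G hG hne
end WP

end

section
open Filter Topology Polynomial
namespace Det

noncomputable def mv (a b x y t : ℝ) : ℝ :=
  if t ≤ a then t else if t ≤ x then a + (t - a) * ((y - a) / (x - a))
    else if t ≤ b then b - (b - t) * ((b - y) / (b - x)) else t

theorem mv_inv {a b x y : ℝ} (hax : a < x) (hxb : x < b) (hay : a < y) (hyb : y < b) (t : ℝ) :
    mv a b y x (mv a b x y t) = t := by
  have h1 : 0 < x - a := by linarith
  have h2 : 0 < y - a := by linarith
  have h3 : 0 < b - x := by linarith
  have h4 : 0 < b - y := by linarith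
  by_cases c1 : t ≤ a
  · simp [mv, c1]
  push Not at c1
  by_cases c2 : t ≤ x
  · have e : mv a b x y t = a + (t - a) * ((y - a) / (x - a)) := by simp [mv, c1.not_ge, c2]
    have k1 : a < a + (t - a) * ((y - a) / (x - a)) := by
      have : 0 < (t - a) * ((y - a) / (x - a)) := mul_pos (by linarith) (by positivity)
      linarith
    have k2 : a + (t - a) * ((y - a) / (x - a)) ≤ y := by
      have : (t - a) * ((y - a) / (x - a)) ≤ (x - a) * ((y - a) / (x - a)) := by
        gcongr
      rw [mul_div_cancel₀ _ h1.ne'] at this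
      linarith
    rw [e, mv, if_neg k1.not_ge, if_pos k2]
    field_simp
    ring
  push Not at c2
  by_cases c3 : t ≤ b
  · have e : mv a b x y t = b - (b - t) * ((b - y) / (b - x)) := by simp [mv, c1.not_ge, c2.not_ge, c3]
    have k2 : y < b - (b - t) * ((b - y) / (b - x)) := by
      have : (b - t) * ((b - y) / (b - x)) < (b - x) * ((b - y) / (b - x)) := by
        have : 0 < (b - y) / (b - x) := by positivity
        exact mul_lt_mul_of_pos_right (by linarith) this
      rw [mul_div_cancel₀ _ h3.ne'] at this
      linarith
    have k3 : b - (b - t) * ((b - y) / (b - x)) ≤ b := by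
      have : 0 ≤ (b - t) * ((b - y) / (b - x)) := mul_nonneg (by linarith) (by positivity)
      linarith
    rw [e, mv, if_neg (by linarith), if_neg (by linarith), if_pos k3]
    field_simp
    ring
  · have e : mv a b x y t = t := by simp [mv, c1.not_ge, c2.not_ge, c3]
    push Not at c3
    rw [e, mv, if_neg (by linarith), if_neg (by linarith), if_neg (by linarith)]

theorem mv_mono {a b x y : ℝ} (hax : a < x) (hxb : x < b) (hay : a < y) (hyb : y < b) :
    Monotone (mv a b x y) := by
  have h1 : 0 < x - a := by linarith
  have h2 : 0 < y - a := by linarith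
  have h3 : 0 < b - x := by linarith
  have h4 : 0 < b - y := by linarith
  have p1 : 0 < (y - a) / (x - a) := by positivity
  have p2 : 0 < (b - y) / (b - x) := by positivity
  have q1 : (x - a) * ((y - a) / (x - a)) = y - a := by field_simp
  have q2 : (b - x) * ((b - y) / (b - x)) = b - y := by field_simp
  intro s t hst
  unfold mv
  split_ifs <;> nlinarith

theorem move {a b x y : ℝ} (hax : a < x) (hxb : x < b) (hay : a < y) (hyb : y < b) :
    ∃ ψ : ℝ ≃o ℝ, ψ x = y ∧ (∀ t, t ≤ a → ψ t = t) ∧ (∀ t, b ≤ t → ψ t = t) := by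
  have i1 := mv_inv hax hxb hay hyb
  have i2 := mv_inv hay hyb hax hxb
  have m1 : StrictMono (mv a b x y) :=
    (mv_mono hax hxb hay hyb).strictMono_of_injective (Function.LeftInverse.injective i1)
  refine ⟨StrictMono.orderIsoOfRightInverse (mv a b x y) m1 (mv a b y x) i2, ?_, ?_, ?_⟩
  · show mv a b x y x = y
    have : 0 < x - a := by linarith
    rw [mv, if_neg hax.not_ge, if_pos le_rfl]; field_simp; ring
  · intro t ht
    show mv a b x y t = t
    rw [mv, if_pos ht]
  · intro t ht
    show mv a b x y t = t
    rw [mv, if_neg (by linarith), if_neg (by linarith)]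
    split_ifs with h
    · have : b = t := le_antisymm ht h
      subst this; ring
    · rfl

theorem gap (Z : Finset ℝ) {α β t : ℝ} (hα : α ∈ Z) (hβ : β ∈ Z) (h1 : α < t) (h2 : t < β) (ht : t ∉ Z) :
    ∃ a ∈ Z, ∃ b ∈ Z, a < t ∧ t < b ∧ ∀ z ∈ Z, z ≤ a ∨ b ≤ z := by
  classical
  obtain ⟨a, ha, ha2⟩ := (Z.filter (· < t)).exists_max_image id ⟨α, by simp [hα, h1]⟩
  obtain ⟨b, hb, hb2⟩ := (Z.filter (t < ·)).exists_min_image id ⟨β, by simp [hβ, h2]⟩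
  simp only [Finset.mem_filter, id] at ha hb ha2 hb2
  refine ⟨a, ha.1, b, hb.1, ha.2, hb.2, fun z hz => ?_⟩
  rcases lt_trichotomy z t with h | h | h
  · exact Or.inl (ha2 z ⟨hz, h⟩)
  · exact absurd (h ▸ hz) ht
  · exact Or.inr (hb2 z ⟨hz, h⟩)

open SignType in
theorem sign_const {f : ℝ → ℝ} {s t : ℝ} (hf : ContinuousOn f (Set.uIcc s t))
    (h : ∀ u ∈ Set.uIcc s t, f u ≠ 0) : sign (f s) = sign (f t) := by
  have hI := intermediate_value_uIcc hf
  have hn : (0:ℝ) ∉ Set.uIcc (f s) (f t) := fun h0 => by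
    obtain ⟨u, hu, hu0⟩ := hI h0; exact h u hu hu0
  rcases lt_trichotomy (f s) 0 with h1 | h1 | h1
  · rcases lt_trichotomy (f t) 0 with h2 | h2 | h2
    · rw [sign_neg h1, sign_neg h2]
    · exact absurd h2 (h t Set.right_mem_uIcc)
    · exact absurd (Set.mem_uIcc.2 (Or.inl ⟨h1.le, h2.le⟩)) hn
  · exact absurd h1 (h s Set.left_mem_uIcc)
  · rcases lt_trichotomy (f t) 0 with h2 | h2 | h2
    · exact absurd (Set.mem_uIcc.2 (Or.inr ⟨h2.le, h1.le⟩)) hn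
    · exact absurd h2 (h t Set.right_mem_uIcc)
    · rw [sign_pos h1, sign_pos h2]

open SignType in
theorem mono_sign {f g : ℝ → ℝ} {a b a' b' t t' : ℝ} (hf : StrictMonoOn f (Set.Icc a b))
    (hg : StrictMonoOn g (Set.Icc a' b')) (hfc : ContinuousOn f (Set.Icc a b))
    (ha : sign (f a) = sign (g a')) (hb : sign (f b) = sign (g b'))
    (ht : t ∈ Set.Ioo a b) (ht' : t' ∈ Set.Ioo a' b')
    (H : ∀ w ∈ Set.Ioo a b, f w = 0 → ∃ w' ∈ Set.Ioo a' b', g w' = 0 ∧ (t < w → t' < w') ∧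
      (w < t → w' < t') ∧ (w = t → w' = t')) : sign (f t) = sign (g t') := by
  have hab : a < b := ht.1.trans ht.2
  have hab' : a' < b' := ht'.1.trans ht'.2
  have la : a ∈ Set.Icc a b := ⟨le_rfl, hab.le⟩
  have lb : b ∈ Set.Icc a b := ⟨hab.le, le_rfl⟩
  have la' : a' ∈ Set.Icc a' b' := ⟨le_rfl, hab'.le⟩
  have lb' : b' ∈ Set.Icc a' b' := ⟨hab'.le, le_rfl⟩
  have lt : t ∈ Set.Icc a b := Set.Ioo_subset_Icc_self ht
  have lt' : t' ∈ Set.Icc a' b' := Set.Ioo_subset_Icc_self ht'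
  by_cases c1 : 0 ≤ f a
  · have c2 : 0 ≤ g a' := by rw [← sign_nonneg_iff, ← ha, sign_nonneg_iff]; exact c1
    rw [sign_pos (c1.trans_lt (hf la lt ht.1)), sign_pos (c2.trans_lt (hg la' lt' ht'.1))]
  by_cases c3 : f b ≤ 0
  · have c2 : g b' ≤ 0 := by rw [← sign_nonpos_iff, ← hb, sign_nonpos_iff]; exact c3
    rw [sign_neg ((hf lt lb ht.2).trans_le c3), sign_neg ((hg lt' lb' ht'.2).trans_le c2)]
  push Not at c1 c3
  obtain ⟨w, hw, hw0⟩ := intermediate_value_Ioo hab.le hfc (show (0:ℝ) ∈ Set.Ioo (f a) (f b) from ⟨c1, c3⟩)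
  obtain ⟨w', hw', hw0', k1, k2, k3⟩ := H w hw hw0
  have lw := Set.Ioo_subset_Icc_self hw
  have lw' := Set.Ioo_subset_Icc_self hw'
  rcases lt_trichotomy t w with h | h | h
  · have e1 := hf lt lw h
    have e2 := hg lt' lw' (k1 h)
    rw [hw0] at e1; rw [hw0'] at e2
    rw [sign_neg e1, sign_neg e2]
  · rw [h, hw0, ← k3 h.symm, hw0']
  · have e1 := hf lw lt h
    have e2 := hg lw' lt' (k2 h)
    rw [hw0] at e1; rw [hw0'] at e2
    rw [sign_pos e1, sign_pos e2]

variable {R : Type} [CommRing R]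

theorem prem (q : R[X]) (hq : 1 ≤ q.natDegree) (p : R[X]) :
    ∃ (k : ℕ) (s r : R[X]), C q.leadingCoeff ^ (2 * k) * p = q * s + r ∧ r.natDegree < q.natDegree := by
  have main : ∀ n, ∀ p : R[X], p.natDegree ≤ n →
      ∃ (k : ℕ) (s r : R[X]), C q.leadingCoeff ^ k * p = q * s + r ∧ r.natDegree < q.natDegree := by
    intro n
    induction n with
    | zero => intro p hp; exact ⟨0, 0, p, by simp, by omega⟩
    | succ n ih =>
      intro p hp
      by_cases h : p.natDegree < q.natDegree
      · exact ⟨0, 0, p, by simp, h⟩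
      push Not at h
      set p1 := C q.leadingCoeff * p - C p.leadingCoeff * X ^ (p.natDegree - q.natDegree) * q with hp1
      have hd : p1.natDegree ≤ n := by
        rw [natDegree_le_iff_coeff_eq_zero]
        intro N hN
        have e : (C p.leadingCoeff * X ^ (p.natDegree - q.natDegree) * q).coeff N =
            p.leadingCoeff * q.coeff (N - (p.natDegree - q.natDegree)) := by
          rw [mul_assoc, coeff_C_mul, coeff_X_pow_mul', if_pos (by omega)]
        rw [hp1, coeff_sub, e, coeff_C_mul]
        by_cases hN2 : N = p.natDegree
        · rw [hN2, show p.natDegree - (p.natDegree - q.natDegree) = q.natDegree by omega]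
          simp only [leadingCoeff]; ring
        · rw [coeff_eq_zero_of_natDegree_lt (show p.natDegree < N by omega),
            coeff_eq_zero_of_natDegree_lt (show q.natDegree < N - (p.natDegree - q.natDegree) by omega)]
          ring
      obtain ⟨k, s, r, h1, h2⟩ := ih p1 hd
      refine ⟨k + 1, s + C q.leadingCoeff ^ k * (C p.leadingCoeff * X ^ (p.natDegree - q.natDegree)), r, ?_, h2⟩
      have : C q.leadingCoeff ^ (k+1) * p = C q.leadingCoeff ^ k * p1 +
          C q.leadingCoeff ^ k * (C p.leadingCoeff * X ^ (p.natDegree - q.natDegree) * q) := by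
        rw [hp1]; ring
      rw [this, h1]; ring
  obtain ⟨k, s, r, h1, h2⟩ := main _ p le_rfl
  refine ⟨k, C q.leadingCoeff ^ k * s, C q.leadingCoeff ^ k * r, ?_, ?_⟩
  · rw [two_mul, pow_add, mul_assoc, h1]; ring
  · refine lt_of_le_of_lt ?_ h2
    rw [← C_pow]; exact natDegree_C_mul_le _ _

open SignType in
/-- the core interpolation step -/
theorem core (e e' : R →+* ℝ) {α β : ℝ} (hαβ : α < β) (S : Finset R[X]) (p : R[X])
    (θ : ℝ ≃o ℝ) (hθα : θ α = α) (hθβ : θ β = β)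
    (hS : ∀ q ∈ S, ∀ t ∈ Set.Icc α β, sign ((q.map e).eval t) = sign ((q.map e').eval (θ t)))
    (hder : derivative p ∈ S) (hp : (derivative p).map e ≠ 0)
    (hsg : ∀ z ∈ Set.Icc α β, (z = α ∨ z = β ∨ ∃ q ∈ S, q.map e ≠ 0 ∧ (q.map e).eval z = 0) →
      sign ((p.map e).eval z) = sign ((p.map e').eval (θ z))) :
    ∃ θ' : ℝ ≃o ℝ, θ' α = α ∧ θ' β = β ∧ (∀ t ∈ Set.Icc α β,
      sign ((p.map e).eval t) = sign ((p.map e').eval (θ' t))) ∧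
      ∀ q ∈ S, ∀ t ∈ Set.Icc α β, sign ((q.map e).eval t) = sign ((q.map e').eval (θ' t)) := by
  classical
  set Z : Finset ℝ := insert α (insert β ((S.biUnion fun q => (q.map e).roots.toFinset).filter
    (fun z => z ∈ Set.Icc α β))) with hZ
  have hαZ : α ∈ Z := by simp [hZ]
  have hβZ : β ∈ Z := by simp [hZ]
  have hZI : ∀ z ∈ Z, z ∈ Set.Icc α β := by
    intro z hz
    simp only [hZ, Finset.mem_insert, Finset.mem_filter] at hz
    rcases hz with rfl | rfl | h
    · exact ⟨le_rfl, hαβ.le⟩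
    · exact ⟨hαβ.le, le_rfl⟩
    · exact h.2
  have hroot : ∀ q ∈ S, q.map e ≠ 0 → ∀ z ∈ Set.Icc α β, (q.map e).eval z = 0 → z ∈ Z := by
    intro q hq hq0 z hz hz0
    simp only [hZ, Finset.mem_insert, Finset.mem_filter, Finset.mem_biUnion, Multiset.mem_toFinset,
      mem_roots', IsRoot.def]
    exact Or.inr (Or.inr ⟨⟨q, hq, hq0, hz0⟩, hz⟩)
  have hZp : ∀ z ∈ Z, sign ((p.map e).eval z) = sign ((p.map e').eval (θ z)) := by
    intro z hz
    refine hsg z (hZI z hz) ?_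
    simp only [hZ, Finset.mem_insert, Finset.mem_filter, Finset.mem_biUnion, Multiset.mem_toFinset,
      mem_roots', IsRoot.def] at hz
    rcases hz with h | h | ⟨⟨q, hq, h1, h2⟩, _⟩
    · exact Or.inl h
    · exact Or.inr (Or.inl h)
    · exact Or.inr (Or.inr ⟨q, hq, h1, h2⟩)
  -- on a gap, sign of q at corresponding points for any θ'
  have hgapq : ∀ a ∈ Z, ∀ b ∈ Z, (∀ z ∈ Z, z ≤ a ∨ b ≤ z) → ∀ q ∈ S, q.map e ≠ 0 →
      (∀ s ∈ Set.Ioo a b, (q.map e).eval s ≠ 0) ∧ (∀ s ∈ Set.Ioo (θ a) (θ b), (q.map e').eval s ≠ 0) := by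
    intro a ha b hb hab q hq hq0
    have h1 : ∀ s ∈ Set.Ioo a b, (q.map e).eval s ≠ 0 := by
      intro s hs h0
      have := hroot q hq hq0 s ⟨(hZI a ha).1.trans hs.1.le, hs.2.le.trans (hZI b hb).2⟩ h0
      rcases hab s this with h | h
      · exact absurd hs.1 h.not_gt
      · exact absurd hs.2 h.not_gt
    refine ⟨h1, fun s hs h0 => ?_⟩
    have hs' : θ.symm s ∈ Set.Ioo a b := ⟨(θ.lt_symm_apply).2 hs.1, (θ.symm_apply_lt).2 hs.2⟩
    have := hS q hq (θ.symm s) ⟨(hZI a ha).1.trans hs'.1.le, hs'.2.le.trans (hZI b hb).2⟩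
    rw [θ.apply_symm_apply, h0, sign_zero, sign_eq_zero_iff] at this
    exact h1 _ hs' this
  have hgapS : ∀ θ' : ℝ ≃o ℝ, (∀ z ∈ Z, θ' z = θ z) → ∀ q ∈ S, ∀ t ∈ Set.Icc α β,
      sign ((q.map e).eval t) = sign ((q.map e').eval (θ' t)) := by
    intro θ' h q hq t ht
    by_cases hq0 : q.map e = 0
    · have h0 : q.map e' = 0 := by
        apply Polynomial.eq_zero_of_infinite_isRoot
        refine Set.Infinite.mono ?_ (Set.Icc_infinite hαβ)
        intro s hs
        have := hS q hq (θ.symm s) ⟨by rw [← hθα] at hs; exact (θ.le_symm_apply).2 hs.1,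
          by rw [← hθβ] at hs; exact (θ.symm_apply_le).2 hs.2⟩
        rw [hq0, eval_zero, sign_zero, θ.apply_symm_apply] at this
        exact sign_eq_zero_iff.1 this.symm
      rw [hq0, h0]; simp
    by_cases htZ : t ∈ Z
    · rw [h t htZ]; exact hS q hq t ht
    have hα' : α < t := lt_of_le_of_ne ht.1 (fun h => htZ (h ▸ hαZ))
    have hβ' : t < β := lt_of_le_of_ne ht.2 (fun h => htZ (h ▸ hβZ))
    obtain ⟨a, ha, b, hb, hat, htb, hab⟩ := gap Z hαZ hβZ hα' hβ' htZ
    rw [hS q hq t ht]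
    refine sign_const (f := fun s => (q.map e').eval s) (by fun_prop) fun u hu => ?_
    refine (hgapq a ha b hb hab q hq hq0).2 u ?_
    refine Set.ordConnected_Ioo.uIcc_subset (x := θ t) (y := θ' t) ?_ ?_ hu
    · exact ⟨θ.strictMono hat, θ.strictMono htb⟩
    · rw [← h a ha, ← h b hb]; exact ⟨θ'.strictMono hat, θ'.strictMono htb⟩
  -- monotonicity on gaps
  have hmono : ∀ a ∈ Z, ∀ b ∈ Z, a < b → (∀ z ∈ Z, z ≤ a ∨ b ≤ z) →
      (StrictMonoOn (fun s => (p.map e).eval s) (Set.Icc a b) ∧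
        StrictMonoOn (fun s => (p.map e').eval s) (Set.Icc (θ a) (θ b))) ∨
      (StrictMonoOn (fun s => -(p.map e).eval s) (Set.Icc a b) ∧
        StrictMonoOn (fun s => -(p.map e').eval s) (Set.Icc (θ a) (θ b))) := by
    intro a ha b hb hab hgap
    obtain ⟨k1, k2⟩ := hgapq a ha b hb hgap _ hder hp
    set m := (a + b) / 2 with hm
    have hmI : m ∈ Set.Ioo a b := ⟨by rw [hm]; linarith, by rw [hm]; linarith⟩
    have hmI' : θ m ∈ Set.Ioo (θ a) (θ b) := ⟨θ.strictMono hmI.1, θ.strictMono hmI.2⟩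
    have hms := hS _ hder m ⟨(hZI a ha).1.trans hmI.1.le, hmI.2.le.trans (hZI b hb).2⟩
    have d1 : ∀ s ∈ Set.Ioo a b, sign (((derivative p).map e).eval s) = sign (((derivative p).map e).eval m) := by
      intro s hs
      refine sign_const (f := fun s => ((derivative p).map e).eval s) (by fun_prop) fun u hu => k1 u ?_
      exact Set.ordConnected_Ioo.uIcc_subset hs hmI hu
    have d2 : ∀ s ∈ Set.Ioo (θ a) (θ b), sign (((derivative p).map e').eval s) = sign (((derivative p).map e).eval m) := by
      intro s hs
      rw [hms]
      refine sign_const (f := fun s => ((derivative p).map e').eval s) (by fun_prop) fun u hu => k2 u ?_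
      exact Set.ordConnected_Ioo.uIcc_subset hs hmI' hu
    rcases (k1 m hmI).lt_or_gt with hneg | hpos
    · right
      constructor
      · refine strictMonoOn_of_deriv_pos (convex_Icc _ _) (by fun_prop) fun s hs => ?_
        rw [interior_Icc] at hs
        rw [deriv.fun_neg, Polynomial.deriv, derivative_map]
        have := d1 s hs
        rw [sign_neg hneg, sign_eq_neg_one_iff] at this
        linarith
      · refine strictMonoOn_of_deriv_pos (convex_Icc _ _) (by fun_prop) fun s hs => ?_
        rw [interior_Icc] at hs
        rw [deriv.fun_neg, Polynomial.deriv, derivative_map]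
        have := d2 s hs
        rw [sign_neg hneg, sign_eq_neg_one_iff] at this
        linarith
    · left
      constructor
      · refine strictMonoOn_of_deriv_pos (convex_Icc _ _) (by fun_prop) fun s hs => ?_
        rw [interior_Icc] at hs
        rw [Polynomial.deriv, derivative_map]
        have := d1 s hs
        rw [sign_pos hpos, sign_eq_one_iff] at this
        linarith
      · refine strictMonoOn_of_deriv_pos (convex_Icc _ _) (by fun_prop) fun s hs => ?_
        rw [interior_Icc] at hs
        rw [Polynomial.deriv, derivative_map]
        have := d2 s hs
        rw [sign_pos hpos, sign_eq_one_iff] at this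
        linarith
  have hp0 : p.map e ≠ 0 := by
    intro h
    apply hp
    rw [← derivative_map, h, derivative_zero]
  -- adjust
  have hadj : ∀ W : Finset ℝ, (∀ w ∈ W, w ∈ Set.Ioo α β ∧ w ∉ Z ∧ (p.map e).eval w = 0) →
      ∃ θ' : ℝ ≃o ℝ, (∀ z ∈ Z, θ' z = θ z) ∧ ∀ w ∈ W, (p.map e').eval (θ' w) = 0 := by
    intro W
    induction W using Finset.induction_on with
    | empty => intro _; exact ⟨θ, fun _ _ => rfl, by simp⟩
    | insert w W hw ih =>
      intro hW
      obtain ⟨θ', h1, h2⟩ := ih (fun v hv => hW v (Finset.mem_insert_of_mem hv))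
      obtain ⟨hwI, hwZ, hw0⟩ := hW w (Finset.mem_insert_self _ _)
      obtain ⟨a, ha, b, hb, haw, hwb, hgap⟩ := gap Z hαZ hβZ hwI.1 hwI.2 hwZ
      have hab := haw.trans hwb
      have hθab : θ a < θ b := θ.strictMono hab
      have la : a ∈ Set.Icc a b := ⟨le_rfl, hab.le⟩
      have lb : b ∈ Set.Icc a b := ⟨hab.le, le_rfl⟩
      have lw : w ∈ Set.Icc a b := ⟨haw.le, hwb.le⟩
      have sa := hZp a ha
      have sb := hZp b hb
      have hw' : ∃ w' ∈ Set.Ioo (θ a) (θ b), (p.map e').eval w' = 0 := by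
        rcases hmono a ha b hb hab hgap with ⟨m1, -⟩ | ⟨m1, -⟩
        · have r1 := m1 la lw haw
          have r2 := m1 lw lb hwb
          simp only [hw0] at r1 r2
          rw [sign_neg r1, eq_comm, sign_eq_neg_one_iff] at sa
          rw [sign_pos r2, eq_comm, sign_eq_one_iff] at sb
          exact intermediate_value_Ioo hθab.le (f := fun s => (p.map e').eval s) (by fun_prop) ⟨sa, sb⟩
        · have r1 := m1 la lw haw
          have r2 := m1 lw lb hwb
          simp only [hw0, neg_zero, neg_pos, neg_neg_iff_pos] at r1 r2
          have r1' : 0 < (p.map e).eval a := by linarith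
          have r2' : (p.map e).eval b < 0 := by linarith
          rw [sign_pos r1', eq_comm, sign_eq_one_iff] at sa
          rw [sign_neg r2', eq_comm, sign_eq_neg_one_iff] at sb
          exact intermediate_value_Ioo' hθab.le (f := fun s => (p.map e').eval s) (by fun_prop) ⟨sb, sa⟩
      obtain ⟨w', hw'I, hw'0⟩ := hw'
      have q1 : θ a < θ' w := by rw [← h1 a ha]; exact θ'.strictMono haw
      have q2 : θ' w < θ b := by rw [← h1 b hb]; exact θ'.strictMono hwb
      obtain ⟨ψ, p1, p2, p3⟩ := move q1 q2 hw'I.1 hw'I.2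
      refine ⟨θ'.trans ψ, ?_, ?_⟩
      · intro z hz
        show ψ (θ' z) = θ z
        rw [h1 z hz]
        rcases hgap z hz with h | h
        · exact p2 _ (θ.monotone h)
        · exact p3 _ (θ.monotone h)
      · intro v hv
        show (p.map e').eval (ψ (θ' v)) = 0
        rcases Finset.mem_insert.1 hv with rfl | hvW
        · rw [p1]; exact hw'0
        · have hvw : v ≠ w := fun h => hw (h ▸ hvW)
          have hv0 := (hW v hv).2.2
          have hout : v ≤ a ∨ b ≤ v := by
            by_contra hcon
            push Not at hcon
            have lv : v ∈ Set.Icc a b := ⟨hcon.1.le, hcon.2.le⟩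
            rcases hmono a ha b hb hab hgap with ⟨m1, -⟩ | ⟨m1, -⟩
            · exact hvw (m1.injOn lv lw (by simp [hv0, hw0]))
            · exact hvw (m1.injOn lv lw (by simp [hv0, hw0]))
          have : ψ (θ' v) = θ' v := by
            rcases hout with h | h
            · exact p2 _ (by rw [← h1 a ha]; exact θ'.monotone h)
            · exact p3 _ (by rw [← h1 b hb]; exact θ'.monotone h)
          rw [this]; exact h2 v hvW
  obtain ⟨θ', h1, h2⟩ := hadj ((p.map e).roots.toFinset.filter (fun w => w ∈ Set.Ioo α β ∧ w ∉ Z)) (by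
    intro w hw
    simp only [Finset.mem_filter, Multiset.mem_toFinset, mem_roots', IsRoot.def] at hw
    exact ⟨hw.2.1, hw.2.2, hw.1.2⟩)
  have h2' : ∀ w ∈ Set.Ioo α β, w ∉ Z → (p.map e).eval w = 0 → (p.map e').eval (θ' w) = 0 := by
    intro w h1 h3 h4
    refine h2 w ?_
    simp only [Finset.mem_filter, Multiset.mem_toFinset, mem_roots', IsRoot.def]
    exact ⟨⟨hp0, h4⟩, h1, h3⟩
  refine ⟨θ', (h1 α hαZ).trans hθα, (h1 β hβZ).trans hθβ, ?_, hgapS θ' h1⟩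
  intro t ht
  by_cases htZ : t ∈ Z
  · rw [h1 t htZ]; exact hZp t htZ
  have hα' : α < t := lt_of_le_of_ne ht.1 (fun h => htZ (h ▸ hαZ))
  have hβ' : t < β := lt_of_le_of_ne ht.2 (fun h => htZ (h ▸ hβZ))
  obtain ⟨a, ha, b, hb, hat, htb, hgap⟩ := gap Z hαZ hβZ hα' hβ' htZ
  have hwit : ∀ w ∈ Set.Ioo a b, (p.map e).eval w = 0 → θ' w ∈ Set.Ioo (θ a) (θ b) ∧
      (p.map e').eval (θ' w) = 0 := by
    intro w hw hw0
    refine ⟨by rw [← h1 a ha, ← h1 b hb]; exact ⟨θ'.strictMono hw.1, θ'.strictMono hw.2⟩, ?_⟩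
    refine h2' w ⟨(hZI a ha).1.trans_lt hw.1, hw.2.trans_le (hZI b hb).2⟩ ?_ hw0
    intro hwZ
    rcases hgap w hwZ with h | h
    · exact absurd hw.1 h.not_gt
    · exact absurd hw.2 h.not_gt
  have htI' : θ' t ∈ Set.Ioo (θ a) (θ b) := by
    rw [← h1 a ha, ← h1 b hb]; exact ⟨θ'.strictMono hat, θ'.strictMono htb⟩
  rcases hmono a ha b hb (hat.trans htb) hgap with ⟨m1, m2⟩ | ⟨m1, m2⟩
  · refine mono_sign m1 m2 (by fun_prop) (hZp a ha) (hZp b hb) ⟨hat, htb⟩ htI' ?_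
    intro w hw hw0
    obtain ⟨g1, g2⟩ := hwit w hw hw0
    exact ⟨θ' w, g1, g2, fun h => θ'.strictMono h, fun h => θ'.strictMono h, fun h => by rw [h]⟩
  · have hneg : ∀ x y : ℝ, sign x = sign y → sign (-x) = sign (-y) := by
      intro x y h; rw [Left.sign_neg, Left.sign_neg, h]
    have := mono_sign m1 m2 (by fun_prop) (hneg _ _ (hZp a ha)) (hneg _ _ (hZp b hb)) ⟨hat, htb⟩ htI' (by
      intro w hw hw0
      obtain ⟨g1, g2⟩ := hwit w hw (by simpa using hw0)
      exact ⟨θ' w, g1, by simpa using g2, fun h => θ'.strictMono h, fun h => θ'.strictMono h, fun h => by rw [h]⟩)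
    simpa using hneg _ _ this

def DP (α β : R) (M : Multiset R[X]) : Prop :=
  ∃ A : Finset R, ∀ e e' : R →+* ℝ, e α = e' α → e β = e' β → e α < e β →
    (∀ a ∈ A, SignType.sign (e a) = SignType.sign (e' a)) →
    ∃ θ : ℝ ≃o ℝ, θ (e α) = e α ∧ θ (e β) = e β ∧
      ∀ p ∈ M, ∀ t ∈ Set.Icc (e α) (e β), SignType.sign ((p.map e).eval t) = SignType.sign ((p.map e').eval (θ t))

theorem map_eraseLead_of (e : R →+* ℝ) (q : R[X]) (h : e q.leadingCoeff = 0) :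
    q.eraseLead.map e = q.map e := by
  have := congrArg (Polynomial.map e) (eraseLead_add_C_mul_X_pow q)
  rw [Polynomial.map_add, Polynomial.map_mul, map_C, h, C_0, zero_mul, add_zero] at this
  exact this

theorem det_aux (α β : R) (M : Multiset R[X]) : DP α β M := by
  classical
  have wf : WellFounded (fun M N : Multiset R[X] =>
      Multiset.IsDershowitzMannaLT (M.map natDegree) (N.map natDegree)) :=
    InvImage.wf _ Multiset.wellFounded_isDershowitzMannaLT
  induction M using wf.induction with
  | _ M ih =>
  by_cases hall : ∀ q ∈ M, q.natDegree = 0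
  · refine ⟨M.toFinset.image (fun q => q.coeff 0), fun e e' _ _ _ hA => ⟨OrderIso.refl ℝ, rfl, rfl, ?_⟩⟩
    intro p hp t _
    have h0 := hA (p.coeff 0) (Finset.mem_image_of_mem _ (Multiset.mem_toFinset.2 hp))
    rw [eq_C_of_natDegree_eq_zero (hall p hp)]
    simpa using h0
  push Not at hall
  obtain ⟨q0, hq0, hq0d⟩ := hall
  obtain ⟨p, hpM, hpmax⟩ := M.toFinset.exists_max_image natDegree ⟨q0, Multiset.mem_toFinset.2 hq0⟩
  rw [Multiset.mem_toFinset] at hpM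
  have hpmax : ∀ q ∈ M, q.natDegree ≤ p.natDegree := fun q hq => hpmax q (Multiset.mem_toFinset.2 hq)
  have hp1 : 1 ≤ p.natDegree := by have := hpmax q0 hq0; omega
  obtain ⟨𝓖, rfl⟩ := Multiset.exists_cons_of_mem hpM
  -- truncation
  have htr : ∀ q, ∃ A : Finset R, q ∈ p ::ₘ 𝓖 → 1 ≤ q.natDegree → ∀ e e' : R →+* ℝ, e α = e' α → e β = e' β → e α < e β →
    (∀ a ∈ A, SignType.sign (e a) = SignType.sign (e' a)) →
    ∃ θ : ℝ ≃o ℝ, θ (e α) = e α ∧ θ (e β) = e β ∧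
      ∀ r ∈ q.eraseLead ::ₘ (p ::ₘ 𝓖).erase q, ∀ t ∈ Set.Icc (e α) (e β), SignType.sign ((r.map e).eval t) = SignType.sign ((r.map e').eval (θ t)) := by
    intro q
    by_cases hq : q ∈ p ::ₘ 𝓖 ∧ 1 ≤ q.natDegree
    · have := ih (q.eraseLead ::ₘ (p ::ₘ 𝓖).erase q) ?_
      · obtain ⟨A, hA⟩ := this
        exact ⟨A, fun _ _ => hA⟩
      · refine ⟨((p ::ₘ 𝓖).erase q).map natDegree, {q.eraseLead.natDegree}, {q.natDegree}, by simp, ?_, ?_, ?_⟩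
        · rw [Multiset.map_cons, ← Multiset.singleton_add, add_comm]
        · conv_lhs => rw [← Multiset.cons_erase hq.1]
          rw [Multiset.map_cons, ← Multiset.singleton_add, add_comm]
        · intro y hy
          refine ⟨_, Multiset.mem_singleton_self _, ?_⟩
          rw [Multiset.mem_singleton.1 hy]
          rcases eraseLead_natDegree_lt_or_eraseLead_eq_zero q with h | h
          · exact h
          · rw [h, natDegree_zero]; exact hq.2
    · exact ⟨∅, fun h1 h2 => absurd ⟨h1, h2⟩ hq⟩
  choose Atr hAtr using htr
  -- remainders
  have hrem : ∀ q : R[X], ∃ (k : ℕ) (s r : R[X]), 1 ≤ q.natDegree →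
      C q.leadingCoeff ^ (2 * k) * p = q * s + r ∧ r.natDegree < q.natDegree := by
    intro q
    by_cases hq : 1 ≤ q.natDegree
    · obtain ⟨k, s, r, h⟩ := prem q hq p
      exact ⟨k, s, r, fun _ => h⟩
    · exact ⟨0, 0, 0, fun h => absurd h hq⟩
  choose kk ss rr hrr using hrem
  let rm : R[X] → R[X] := fun q => if 1 ≤ q.natDegree then rr q else 0
  have hdd : (derivative p).natDegree < p.natDegree := natDegree_derivative_lt (by omega)
  obtain ⟨Am, hAm⟩ := ih (𝓖 + (derivative p ::ₘ (derivative p ::ₘ 𝓖).map rm)) (by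
    refine ⟨𝓖.map natDegree, (derivative p ::ₘ (derivative p ::ₘ 𝓖).map rm).map natDegree, {p.natDegree}, by simp, ?_, ?_, ?_⟩
    · rw [Multiset.map_add]
    · rw [Multiset.map_cons, ← Multiset.singleton_add, add_comm]
    · intro y hy
      refine ⟨_, Multiset.mem_singleton_self _, ?_⟩
      obtain ⟨q, hq, rfl⟩ := Multiset.mem_map.1 hy
      rcases Multiset.mem_cons.1 hq with rfl | hq
      · exact hdd
      · obtain ⟨q, hq', rfl⟩ := Multiset.mem_map.1 hq
        have hqle : q.natDegree ≤ p.natDegree := by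
          rcases Multiset.mem_cons.1 hq' with rfl | hq
          · exact hdd.le
          · exact hpmax q (Multiset.mem_cons_of_mem hq)
        simp only [rm]
        split_ifs with h
        · exact (hrr q h).2.trans_le hqle
        · rw [natDegree_zero]; omega)
  refine ⟨Am ∪ (p ::ₘ 𝓖).toFinset.biUnion Atr ∪ (p ::ₘ 𝓖).toFinset.image leadingCoeff ∪ {p.eval α, p.eval β}, ?_⟩
  intro e e' hα hβ hαβ hA
  have hA1 : ∀ a ∈ Am, SignType.sign (e a) = SignType.sign (e' a) := fun a ha => hA a (by simp [ha])
  have hA2 : ∀ q ∈ p ::ₘ 𝓖, ∀ a ∈ Atr q, SignType.sign (e a) = SignType.sign (e' a) := fun q hq a ha =>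
    hA a (by
      simp only [Finset.mem_union, Finset.mem_biUnion, Multiset.mem_toFinset]
      exact Or.inl (Or.inl (Or.inr ⟨q, hq, ha⟩)))
  have hA3 : ∀ q ∈ p ::ₘ 𝓖, SignType.sign (e q.leadingCoeff) = SignType.sign (e' q.leadingCoeff) := fun q hq =>
    hA _ (by
      simp only [Finset.mem_union, Finset.mem_image, Multiset.mem_toFinset]
      exact Or.inl (Or.inr ⟨q, hq, rfl⟩))
  have hA4 : SignType.sign (e (p.eval α)) = SignType.sign (e' (p.eval α)) := hA _ (by simp)
  have hA5 : SignType.sign (e (p.eval β)) = SignType.sign (e' (p.eval β)) := hA _ (by simp)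
  by_cases hz : ∃ q ∈ p ::ₘ 𝓖, 1 ≤ q.natDegree ∧ e q.leadingCoeff = 0
  · obtain ⟨q, hq, hq1, hqe⟩ := hz
    have hqe' : e' q.leadingCoeff = 0 := by
      have := hA3 q hq
      rw [hqe, sign_zero, eq_comm, sign_eq_zero_iff] at this
      exact this
    obtain ⟨θ, h1, h2, h3⟩ := hAtr q hq hq1 e e' hα hβ hαβ (hA2 q hq)
    refine ⟨θ, h1, h2, fun r hr t ht => ?_⟩
    by_cases hrq : r = q
    · have := h3 q.eraseLead (Multiset.mem_cons_self _ _) t ht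
      rw [map_eraseLead_of e q hqe, map_eraseLead_of e' q hqe'] at this
      rw [hrq]; exact this
    · exact h3 r (Multiset.mem_cons_of_mem ((Multiset.mem_erase_of_ne hrq).2 hr)) t ht
  push Not at hz
  obtain ⟨θ, h1, h2, h3⟩ := hAm e e' hα hβ hαβ hA1
  have hpl : e p.leadingCoeff ≠ 0 := hz p (Multiset.mem_cons_self _ _) hp1
  have hdc : ((derivative p).map e).coeff (p.natDegree - 1) ≠ 0 := by
    rw [coeff_map, coeff_derivative, show p.natDegree - 1 + 1 = p.natDegree by omega, map_mul]
    refine mul_ne_zero hpl ?_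
    simp only [map_add, map_natCast, map_one]
    positivity
  have hdn : (derivative p).natDegree = p.natDegree - 1 := by
    refine le_antisymm (by omega) (le_natDegree_of_ne_zero fun h => hdc ?_)
    rw [coeff_map, h, map_zero]
  have hdl : e (derivative p).leadingCoeff ≠ 0 := by
    rw [leadingCoeff, hdn, ← coeff_map]; exact hdc
  have hlead : ∀ q ∈ derivative p ::ₘ 𝓖, 1 ≤ q.natDegree → e q.leadingCoeff ≠ 0 := by
    intro q hq h
    rcases Multiset.mem_cons.1 hq with rfl | hq
    · exact hdl
    · exact hz q (Multiset.mem_cons_of_mem hq) h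
  have hsgl : ∀ q ∈ derivative p ::ₘ 𝓖, 1 ≤ q.natDegree → e' q.leadingCoeff ≠ 0 := by
    intro q hq h
    rcases Multiset.mem_cons.1 hq with rfl | hq
    · have hp' : e' p.leadingCoeff ≠ 0 := by
        intro h0
        have := hA3 p (Multiset.mem_cons_self _ _)
        rw [h0, sign_zero, sign_eq_zero_iff] at this
        exact hpl this
      rw [leadingCoeff, hdn, coeff_derivative, show p.natDegree - 1 + 1 = p.natDegree by omega, map_mul]
      refine mul_ne_zero hp' ?_
      simp only [map_add, map_natCast, map_one]
      positivity
    · intro h0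
      have := hA3 q (Multiset.mem_cons_of_mem hq)
      rw [h0, sign_zero, sign_eq_zero_iff] at this
      exact hz q (Multiset.mem_cons_of_mem hq) h this
  have hev : ∀ (e : R →+* ℝ) q, 1 ≤ q.natDegree → e q.leadingCoeff ≠ 0 → ∀ t, (q.map e).eval t = 0 →
      SignType.sign ((p.map e).eval t) = SignType.sign (((rr q).map e).eval t) := by
    intro e q hq hl t ht
    have h := congrArg (fun r => (r.map e).eval t) (hrr q hq).1
    simp only [Polynomial.map_mul, Polynomial.map_add, Polynomial.map_pow, map_C, eval_mul, eval_add, eval_pow, eval_C, ht,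
      zero_mul, zero_add] at h
    have hpos : 0 < e q.leadingCoeff ^ (2 * kk q) := by rw [pow_mul]; positivity
    rw [← h, sign_mul, sign_pos hpos, one_mul]
  obtain ⟨θ', g1, g2, g3, g4⟩ := core e e' hαβ (derivative p ::ₘ 𝓖).toFinset p θ h1 h2 (by
      intro q hq t ht
      refine h3 q ?_ t ht
      rcases Multiset.mem_cons.1 (Multiset.mem_toFinset.1 hq) with rfl | hq
      · simp
      · exact Multiset.mem_add.2 (Or.inl hq)) (by simp) (fun h => hdc (by rw [h, coeff_zero])) (by
      intro z hz hz'
      rcases hz' with rfl | rfl | ⟨q, hq, hqe, hqz⟩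
      · rw [h1, eval_map_apply, hα, eval_map_apply]; exact hA4
      · rw [h2, eval_map_apply, hβ, eval_map_apply]; exact hA5
      · rw [Multiset.mem_toFinset] at hq
        have hq1 : 1 ≤ q.natDegree := by
          by_contra hcon
          have h0 : q.natDegree = 0 := by omega
          rw [eq_C_of_natDegree_eq_zero h0] at hqe hqz
          simp only [map_C, eval_C] at hqz
          exact hqe (by rw [map_C, hqz, C_0])
        have hqm : rr q ∈ 𝓖 + (derivative p ::ₘ (derivative p ::ₘ 𝓖).map rm) := by
          refine Multiset.mem_add.2 (Or.inr (Multiset.mem_cons_of_mem ?_))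
          exact Multiset.mem_map.2 ⟨q, hq, by simp [rm, hq1]⟩
        have hqS : q ∈ 𝓖 + (derivative p ::ₘ (derivative p ::ₘ 𝓖).map rm) := by
          rcases Multiset.mem_cons.1 hq with rfl | hq
          · simp
          · exact Multiset.mem_add.2 (Or.inl hq)
        have hqz' : (q.map e').eval (θ z) = 0 := by
          have := h3 q hqS z hz
          rw [hqz, sign_zero, eq_comm, sign_eq_zero_iff] at this
          exact this
        rw [hev e q hq1 (hlead q hq hq1) z hqz, hev e' q hq1 (hsgl q hq hq1) _ hqz']
        exact h3 _ hqm z hz)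
  refine ⟨θ', g1, g2, fun q hq t ht => ?_⟩
  rcases Multiset.mem_cons.1 hq with rfl | hq
  · exact g3 t ht
  · exact g4 q (Multiset.mem_toFinset.2 (Multiset.mem_cons_of_mem hq)) t ht

end Det

end

section
open Filter Topology Polynomial

namespace Pu

/-- functions analytic at the origin -/
def An (X : Type) [NormedAddCommGroup X] [NormedSpace ℝ X] : Subring (X → ℝ) where
  carrier := {f | AnalyticAt ℝ f 0}
  mul_mem' := fun ha hb => AnalyticAt.mul ha hb
  one_mem' := analyticAt_const
  add_mem' := fun ha hb => AnalyticAt.add ha hb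
  zero_mem' := analyticAt_const
  neg_mem' := fun ha => AnalyticAt.neg ha

/-- evaluation -/
def ev {X : Type} [NormedAddCommGroup X] [NormedSpace ℝ X] (x : X) : An X →+* ℝ :=
  (Pi.evalRingHom (fun _ : X => ℝ) x).comp (An X).subtype

theorem ev_apply {X : Type} [NormedAddCommGroup X] [NormedSpace ℝ X] (x : X) (f : An X) :
    ev x f = (f : X → ℝ) x := rfl

def Pui {E : Type} [NormedAddCommGroup E] [NormedSpace ℝ E] (γ : ℝ → E) : Prop :=
  ∃ Q : ℕ, 1 ≤ Q ∧ ∃ A : ℝ → E, AnalyticAt ℝ A 0 ∧ ∀ᶠ s in 𝓝[>] (0:ℝ), γ (s ^ Q) = A s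

theorem tendsto_pow_gt {Q : ℕ} (hQ : 1 ≤ Q) :
    Tendsto (fun s : ℝ => s ^ Q) (𝓝[>] 0) (𝓝[>] 0) := by
  apply tendsto_nhdsWithin_iff.2
  constructor
  · have : Tendsto (fun s : ℝ => s ^ Q) (𝓝 0) (𝓝 (0 ^ Q)) := (continuous_pow Q).tendsto 0
    rw [zero_pow (by omega)] at this
    exact this.mono_left nhdsWithin_le_nhds
  · filter_upwards [self_mem_nhdsWithin] with s hs
    exact pow_pos (Set.mem_Ioi.1 hs) Q

theorem an_pow {E : Type} [NormedAddCommGroup E] [NormedSpace ℝ E] {A : ℝ → E}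
    (hA : AnalyticAt ℝ A 0) {Q : ℕ} (hQ : 1 ≤ Q) : AnalyticAt ℝ (fun s => A (s ^ Q)) 0 := by
  have h : AnalyticAt ℝ (fun s : ℝ => s ^ Q) 0 := analyticAt_id.pow Q
  exact AnalyticAt.fun_comp_of_eq hA h (by simp; omega)

theorem Pui.mul {E : Type} [NormedAddCommGroup E] [NormedSpace ℝ E] {γ : ℝ → E} {Q : ℕ}
    (hQ : 1 ≤ Q) {A : ℝ → E} (hA : AnalyticAt ℝ A 0)
    (h : ∀ᶠ s in 𝓝[>] (0:ℝ), γ (s ^ Q) = A s) {k : ℕ} (hk : 1 ≤ k) :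
    ∃ B : ℝ → E, AnalyticAt ℝ B 0 ∧ B 0 = A 0 ∧ ∀ᶠ s in 𝓝[>] (0:ℝ), γ (s ^ (Q * k)) = B s := by
  refine ⟨fun s => A (s ^ k), an_pow hA hk, by simp [zero_pow (show k ≠ 0 by omega)], ?_⟩
  filter_upwards [(tendsto_pow_gt hk).eventually h] with s hs
  rw [mul_comm, pow_mul, hs]

/-- composition with an analytic map of the pair -/
theorem Pui.pair {E F : Type} [NormedAddCommGroup E] [NormedSpace ℝ E]
    [NormedAddCommGroup F] [NormedSpace ℝ F] {γ : ℝ → E} {η : ℝ → F} (hγ : Pui γ) (hη : Pui η) :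
    Pui (fun s => (γ s, η s)) := by
  obtain ⟨Q, hQ, A, hA, h⟩ := hγ
  obtain ⟨Q', hQ', A', hA', h'⟩ := hη
  obtain ⟨B, hB, -, hb⟩ := Pui.mul hQ hA h hQ'
  obtain ⟨B', hB', -, hb'⟩ := Pui.mul hQ' hA' h' hQ
  refine ⟨Q * Q', Nat.mul_pos hQ hQ', fun s => (B s, B' s), hB.prod hB', ?_⟩
  filter_upwards [hb, hb'] with s h1 h2
  rw [h1, mul_comm Q Q', h2]

theorem Pui.clm {E F : Type} [NormedAddCommGroup E] [NormedSpace ℝ E]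
    [NormedAddCommGroup F] [NormedSpace ℝ F] {γ : ℝ → E} (hγ : Pui γ) (L : E →L[ℝ] F) :
    Pui (fun s => L (γ s)) := by
  obtain ⟨Q, hQ, A, hA, h⟩ := hγ
  refine ⟨Q, hQ, fun s => L (A s), (L.analyticAt _).comp hA, ?_⟩
  filter_upwards [h] with s h1
  rw [h1]

theorem Pui.of_an {E : Type} [NormedAddCommGroup E] [NormedSpace ℝ E] {γ : ℝ → E}
    (h : AnalyticAt ℝ γ 0) : Pui γ :=
  ⟨1, le_rfl, γ, h, by simp⟩

theorem Pui.add {E : Type} [NormedAddCommGroup E] [NormedSpace ℝ E] {γ η : ℝ → E}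
    (hγ : Pui γ) (hη : Pui η) : Pui (fun s => γ s + η s) :=
  (hγ.pair hη).clm (ContinuousLinearMap.fst ℝ E E + ContinuousLinearMap.snd ℝ E E)

theorem Pui.congr {E : Type} [NormedAddCommGroup E] [NormedSpace ℝ E] {γ η : ℝ → E}
    (hγ : Pui γ) (h : ∀ᶠ s in 𝓝[>] (0:ℝ), η s = γ s) : Pui η := by
  obtain ⟨Q, hQ, A, hA, h'⟩ := hγ
  refine ⟨Q, hQ, A, hA, ?_⟩
  filter_upwards [h', (tendsto_pow_gt hQ).eventually h] with s h1 h2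
  rw [h2, h1]

/-- unwinding a substitution `s = τ ^ Q` -/
theorem Pui.of_pow {E : Type} [NormedAddCommGroup E] [NormedSpace ℝ E] {γ : ℝ → E} {Q : ℕ}
    (hQ : 1 ≤ Q) (h : Pui (fun s => γ (s ^ Q))) : Pui γ := by
  obtain ⟨Q', hQ', A, hA, h'⟩ := h
  refine ⟨Q' * Q, Nat.mul_pos hQ' hQ, A, hA, ?_⟩
  filter_upwards [h'] with s h1
  rw [pow_mul, h1]

theorem Pui.mul_fun {γ : ℝ → ℝ} {g : ℝ → ℝ} (hg : AnalyticAt ℝ g 0) (h : Pui γ) :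
    Pui (fun s => g s * γ s) := by
  obtain ⟨Q, hQ, A, hA, h'⟩ := h
  refine ⟨Q, hQ, fun s => g (s ^ Q) * A s, (an_pow hg hQ).mul hA, ?_⟩
  filter_upwards [h'] with s h1
  rw [h1]

theorem taylor_pred {R : Type} [CommRing R] (p : R[X]) (m : ℕ) (hm : 1 ≤ m) (hp : p.Monic)
    (hd : p.natDegree = m) (r : R) :
    (taylor r p).coeff (m - 1) = p.coeff (m - 1) + m * r := by
  rw [taylor_coeff]
  have hle : (hasseDeriv (m - 1) p).natDegree < 2 := by
    have := natDegree_hasseDeriv_le p (m - 1)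
    omega
  rw [eval_eq_sum_range' hle]
  simp only [Finset.sum_range_succ, Finset.sum_range_zero, hasseDeriv_coeff]
  have h1 : p.coeff (1 + (m - 1)) = 1 := by
    rw [show 1 + (m - 1) = m by omega, ← hd]; exact hp
  rw [h1]
  have : (1 + (m - 1)).choose (m - 1) = m := by
    obtain ⟨k, rfl⟩ : ∃ k, m = k + 1 := ⟨m - 1, by omega⟩
    simp [add_comm 1 k]
  rw [this]
  simp

/-- the monic polynomial with given lower coefficients -/
noncomputable def mon {R : Type} [CommRing R] (m : ℕ) (a : ℕ → R) : R[X] :=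
  X ^ m + ∑ i ∈ Finset.range m, C (a i) * X ^ i

theorem mon_deg_lt {R : Type} [CommRing R] (m : ℕ) (a : ℕ → R) :
    (∑ i ∈ Finset.range m, C (a i) * X ^ i : R[X]).degree < m := by
  refine lt_of_le_of_lt (degree_sum_le _ _) ?_
  refine (Finset.sup_lt_iff (WithBot.bot_lt_coe m)).2 ?_
  intro i hi
  refine lt_of_le_of_lt (degree_C_mul_X_pow_le i (a i)) ?_
  exact Nat.cast_lt.2 (Finset.mem_range.1 hi)

theorem mon_monic {R : Type} [CommRing R] (m : ℕ) (a : ℕ → R) : (mon m a).Monic :=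
  monic_X_pow_add (mon_deg_lt m a)

theorem mon_natDegree {R : Type} [CommRing R] [Nontrivial R] (m : ℕ) (a : ℕ → R) :
    (mon m a).natDegree = m := by
  apply natDegree_eq_of_degree_eq_some
  rw [mon, degree_add_eq_left_of_degree_lt, degree_X_pow]
  rw [degree_X_pow]; exact mon_deg_lt m a

theorem mon_coeff {R : Type} [CommRing R] (m : ℕ) (a : ℕ → R) (i : ℕ) (hi : i < m) :
    (mon m a).coeff i = a i := by
  simp [mon, coeff_X_pow, hi, hi.ne]

theorem mon_eval {R : Type} [CommRing R] (m : ℕ) (a : ℕ → R) (x : R) :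
    (mon m a).eval x = x ^ m + ∑ i ∈ Finset.range m, a i * x ^ i := by
  simp [mon, eval_finsetSum]

theorem mon_map {R S : Type} [CommRing R] [CommRing S] (e : R →+* S) (m : ℕ) (a : ℕ → R) :
    (mon m a).map e = mon m (fun i => e (a i)) := by
  simp [mon, Polynomial.map_sum]

theorem eq_mon {R : Type} [CommRing R] {p : R[X]} (hp : p.Monic) :
    p = mon p.natDegree p.coeff := hp.as_sum

/-- Tschirnhaus -/
theorem tsch (m : ℕ) (hm : 1 ≤ m) (a : ℕ → ℝ → ℝ) (ha : ∀ i, AnalyticAt ℝ (a i) 0) :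
    ∃ b : ℕ → ℝ → ℝ, (∀ i, AnalyticAt ℝ (b i) 0) ∧ (∀ s, b (m - 1) s = 0) ∧
      ∀ s x, x ^ m + ∑ i ∈ Finset.range m, a i s * x ^ i =
        (x + a (m-1) s / m) ^ m + ∑ i ∈ Finset.range m, b i s * (x + a (m-1) s / m) ^ i := by
  let a' : ℕ → An ℝ := fun i => ⟨a i, ha i⟩
  let r : An ℝ := ⟨fun s => - (a (m-1) s / m), (((ha (m-1)).div analyticAt_const
    (by positivity))).neg⟩
  let p := taylor r (mon m a')
  have hpm : p.Monic := by
    rw [Polynomial.Monic, leadingCoeff_taylor]; exact mon_monic m a'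
  have hd : p.natDegree = m := by
    simp only [p, natDegree_taylor]
    exact mon_natDegree m a'
  refine ⟨fun i => (p.coeff i : An ℝ), fun i => (p.coeff i).2, ?_, ?_⟩
  · intro s
    have : p.coeff (m-1) = 0 := by
      simp only [p]
      rw [taylor_pred _ m hm (mon_monic m a') (mon_natDegree m a'), mon_coeff _ _ _ (by omega)]
      apply Subtype.ext
      funext s
      have hm' : (m:ℝ) ≠ 0 := by positivity
      simp only [a', r]
      simp
      field_simp
      simp
    simp [this]
  · intro s x
    have h1 : (p.map (ev s)).eval (x + a (m-1) s / m) = ((mon m a').map (ev s)).eval x := by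
      simp only [p]
      rw [map_taylor, taylor_eval]
      congr 1
      simp [r, ev_apply]
    rw [mon_map, mon_eval, eq_mon hpm, mon_map, mon_eval, hd] at h1
    exact h1.symm

end Pu

end

section
open Filter Topology Polynomial

namespace Pu

theorem root_bound (m : ℕ) (b : ℕ → ℝ) (x : ℝ) (B : ℝ) (hB : ∑ i ∈ Finset.range m, |b i| ≤ B)
    (h : x ^ m + ∑ i ∈ Finset.range m, b i * x ^ i = 0) : |x| ≤ max 1 B := by
  by_contra hc
  push Not at hc
  have h1 : 1 < |x| := lt_of_le_of_lt (le_max_left _ _) hc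
  have h2 : B < |x| := lt_of_le_of_lt (le_max_right _ _) hc
  rcases Nat.eq_zero_or_pos m with rfl | hm
  · simp at h
  have h3 : |x| ^ m ≤ ∑ i ∈ Finset.range m, |b i| * |x| ^ (m-1) := by
    have : x ^ m = - ∑ i ∈ Finset.range m, b i * x ^ i := by linarith
    rw [← abs_pow, this, abs_neg]
    refine (Finset.abs_sum_le_sum_abs _ _).trans ?_
    apply Finset.sum_le_sum
    intro i hi
    rw [abs_mul, abs_pow]
    gcongr
    · exact h1.le
    · have := Finset.mem_range.1 hi; omega
  rw [← Finset.sum_mul] at h3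
  obtain ⟨k, rfl⟩ : ∃ k, m = k + 1 := ⟨m - 1, by omega⟩
  simp only [Nat.add_sub_cancel, pow_succ'] at h3
  have h4 : 0 < |x| ^ k := by positivity
  have := le_of_mul_le_mul_right h3 h4
  linarith

theorem ioo_ev {p : ℝ → Prop} (h : ∀ᶠ s in 𝓝[>] (0:ℝ), p s) :
    ∃ δ > 0, ∀ s, 0 < s → s < δ → p s := by
  obtain ⟨u, hu, h⟩ := mem_nhdsGT_iff_exists_Ioo_subset.1 h
  exact ⟨u, hu, fun s h0 h1 => h ⟨h0, h1⟩⟩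

theorem lim_root (m : ℕ) (b : ℕ → ℝ → ℝ) (hb : ∀ i, ContinuousAt (b i) 0)
    (η : ℝ → ℝ) (hc : ∀ᶠ s in 𝓝[>] (0:ℝ), ContinuousAt η s)
    (hr : ∀ᶠ s in 𝓝[>] (0:ℝ), η s ^ m + ∑ i ∈ Finset.range m, b i s * η s ^ i = 0) :
    ∃ c, Tendsto η (𝓝[>] 0) (𝓝 c) := by
  have hbd : ∃ B, ∀ᶠ s in 𝓝[>] (0:ℝ), |η s| ≤ B := by
    have hcont : ContinuousAt (fun s => ∑ i ∈ Finset.range m, |b i s|) 0 :=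
      tendsto_finsetSum _ fun i _ => (hb i).abs
    have h1 : ∀ᶠ s in 𝓝 (0:ℝ), ∑ i ∈ Finset.range m, |b i s| <
        (∑ i ∈ Finset.range m, |b i 0|) + 1 := hcont.eventually (gt_mem_nhds (by linarith))
    refine ⟨max 1 ((∑ i ∈ Finset.range m, |b i 0|) + 1), ?_⟩
    · filter_upwards [hr, h1.filter_mono nhdsWithin_le_nhds] with s h2 h3
      exact root_bound m (fun i => b i s) (η s) _ h3.le h2
  obtain ⟨B, hB⟩ := hbd
  refine tendsto_of_no_upcrossings dense_univ ?_ ?_ ?_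
  · rintro u - v - huv ⟨h1, h2⟩
    have key : ∀ w ∈ Set.Ioo u v, (mon m (fun i => b i 0)).IsRoot w := by
      intro w hw
      have hfr : ∃ᶠ s in 𝓝[>] (0:ℝ), η s = w := by
        intro hne
        obtain ⟨δ, hδ, hd⟩ := ioo_ev (hne.and hc)
        have hI : Set.Ioo 0 δ ∈ 𝓝[>] (0:ℝ) := Ioo_mem_nhdsGT hδ
        obtain ⟨s1, hs1, hs1'⟩ := (h1.and_eventually hI).exists
        obtain ⟨s2, hs2, hs2'⟩ := (h2.and_eventually hI).exists
        have hcon : ContinuousOn η (Set.Ioo 0 δ) := fun s hs =>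
          (hd s hs.1 hs.2).2.continuousWithinAt
        obtain ⟨s, hs, hsw⟩ := isPreconnected_Ioo.intermediate_value hs1' hs2' hcon
          ⟨(hs1.trans hw.1).le, (hw.2.trans hs2).le⟩
        exact (hd s hs.1 hs.2).1 hsw
      rw [IsRoot, mon_eval]
      have hcw : ContinuousAt (fun s => w ^ m + ∑ i ∈ Finset.range m, b i s * w ^ i) 0 :=
        tendsto_const_nhds.add
          (tendsto_finsetSum _ fun i _ => (hb i).mul tendsto_const_nhds)
      by_contra hne
      have h3 := (hcw.eventually_ne hne).filter_mono (nhdsWithin_le_nhds (s := Set.Ioi 0))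
      obtain ⟨s, hs1, hs2, hs3⟩ := (hfr.and_eventually (h3.and hr)).exists
      rw [hs1] at hs3
      exact hs2 hs3
    have : (mon m (fun i => b i 0)) = 0 :=
      eq_zero_of_infinite_isRoot _ ((Set.Ioo_infinite huv).mono key)
    exact (mon_monic m (fun i => b i 0)).ne_zero this
  · exact ⟨B, by
      rw [eventually_map]
      filter_upwards [hB] with s hs using (abs_le.1 hs).2⟩
  · exact ⟨-B, by
      rw [eventually_map]
      filter_upwards [hB] with s hs using (abs_le.1 hs).1⟩

/-- rescaling -/
theorem rescale (m : ℕ) (a : ℕ → ℝ → ℝ) (ha : ∀ i, AnalyticAt ℝ (a i) 0)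
    (hne : ∃ i < m, ¬ ∀ᶠ s in 𝓝 (0:ℝ), a i s = 0) :
    ∃ N p : ℕ, 1 ≤ N ∧ ∃ b : ℕ → ℝ → ℝ, (∀ i, AnalyticAt ℝ (b i) 0) ∧
      (∃ i < m, b i 0 ≠ 0) ∧ (∀ i < m, (∀ᶠ s in 𝓝 (0:ℝ), a i s = 0) → b i 0 = 0) ∧
      ∀ᶠ s in 𝓝 (0:ℝ), ∀ i < m, a i (s ^ N) = s ^ (p * (m - i)) * b i s := by
  classical
  have hog : ∀ i, ∃ o : ℕ, ∃ g : ℝ → ℝ, AnalyticAt ℝ g 0 ∧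
      ((¬ ∀ᶠ s in 𝓝 (0:ℝ), a i s = 0) → g 0 ≠ 0) ∧
      ((∀ᶠ s in 𝓝 (0:ℝ), a i s = 0) → ∀ s, g s = 0) ∧
      ∀ᶠ s in 𝓝 (0:ℝ), a i s = s ^ o * g s := by
    intro i
    by_cases h : ∀ᶠ s in 𝓝 (0:ℝ), a i s = 0
    · exact ⟨0, fun _ => 0, analyticAt_const, fun h' => absurd h h', fun _ _ => rfl, by simpa using h⟩
    · obtain ⟨o, g, h1, h2, h3⟩ := (ha i).exists_eventuallyEq_pow_smul_nonzero_iff.2 h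
      exact ⟨o, g, h1, fun _ => h2, fun h' => absurd h' h, by simpa using h3⟩
  choose o g hg1 hg2 hg2' hg3 using hog
  let S := (Finset.range m).filter (fun i => ¬ ∀ᶠ s in 𝓝 (0:ℝ), a i s = 0)
  have hS : S.Nonempty := by
    obtain ⟨i, hi, h⟩ := hne
    exact ⟨i, by simp only [S, Finset.mem_filter, Finset.mem_range]; exact ⟨hi, h⟩⟩
  let N := m.factorial
  have hN : 1 ≤ N := Nat.factorial_pos m
  obtain ⟨i0, hi0, hmin⟩ := S.exists_min_image (fun i => o i * (N / (m - i))) hS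
  have hi0' : i0 < m ∧ ¬ ∀ᶠ s in 𝓝 (0:ℝ), a i0 s = 0 := by
    simpa only [S, Finset.mem_filter, Finset.mem_range] using hi0
  let p := o i0 * (N / (m - i0))
  have hdiv : ∀ i < m, (m - i) * (N / (m - i)) = N := fun i hi =>
    Nat.mul_div_cancel' (Nat.dvd_factorial (by omega) (by omega))
  have hle : ∀ i ∈ S, p * (m - i) ≤ N * o i := by
    intro i hi
    have hi' : i < m := by
      have := (Finset.mem_filter.1 hi).1
      simpa using this
    calc p * (m - i) ≤ o i * (N / (m - i)) * (m - i) := Nat.mul_le_mul_right _ (hmin i hi)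
      _ = N * o i := by rw [mul_assoc, mul_comm (N / (m - i)), hdiv i hi', mul_comm]
  refine ⟨N, p, hN, fun i s => s ^ (N * o i - p * (m - i)) * g i (s ^ N), fun i =>
    (analyticAt_id.pow _).mul (an_pow (hg1 i) hN), ⟨i0, hi0'.1, ?_⟩, ?_, ?_⟩
  · have h : N * o i0 - p * (m - i0) = 0 := by
      have : p * (m - i0) = N * o i0 := by
        simp only [p]
        rw [mul_assoc, mul_comm (N / (m - i0)), hdiv i0 hi0'.1, mul_comm]
      omega
    simp only [h, pow_zero, one_mul]
    rw [zero_pow (by omega)]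
    exact hg2 i0 hi0'.2
  · intro i _ h
    simp [hg2' i h]
  · have h1 : ∀ᶠ s in 𝓝 (0:ℝ), ∀ i ∈ Finset.range m, a i (s ^ N) = (s ^ N) ^ o i * g i (s ^ N) := by
      have ht : Tendsto (fun s : ℝ => s ^ N) (𝓝 0) (𝓝 0) := by
        have : Tendsto (fun s : ℝ => s ^ N) (𝓝 0) (𝓝 (0 ^ N)) := (continuous_pow N).tendsto 0
        rwa [zero_pow (by omega)] at this
      exact (Finset.eventually_all _).2 fun i _ => ht.eventually (hg3 i)
    filter_upwards [h1] with s hs i hi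
    rw [hs i (Finset.mem_range.2 hi)]
    by_cases h : ∀ᶠ s in 𝓝 (0:ℝ), a i s = 0
    · simp [hg2' i h]
    · rw [← mul_assoc, ← pow_add, ← pow_mul]
      congr 2
      have := hle i (by simp only [S, Finset.mem_filter, Finset.mem_range]; exact ⟨hi, h⟩)
      omega

theorem deg_lt (m : ℕ) (hm : 1 ≤ m) (b : ℕ → ℝ) (h1 : b (m-1) = 0) (i0 : ℕ) (hi0 : i0 < m)
    (h0 : b i0 ≠ 0) (c : ℝ) (q : ℝ → ℝ) (hq : ContinuousAt q 0) (hq0 : q 0 ≠ 0) (d : ℕ)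
    (h : ∀ᶠ x in 𝓝 (0:ℝ), q x * (mon m b).eval (x + c) = x ^ d) : d < m := by
  by_contra hd
  push Not at hd
  let P := taylor c (mon m b)
  have hP : P.Monic := by
    rw [Polynomial.Monic, leadingCoeff_taylor]; exact mon_monic m b
  have hPd : P.natDegree = m := by
    simp only [P, natDegree_taylor]; exact mon_natDegree m b
  obtain ⟨P1, hP1, hnd⟩ := exists_eq_pow_rootMultiplicity_mul_and_not_dvd P hP.ne_zero 0
  set k := P.rootMultiplicity 0
  rw [dvd_iff_isRoot, IsRoot] at hnd
  simp only [map_zero, sub_zero] at hP1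
  have hP1' : P1.Monic := by
    have : (X ^ k * P1).Monic := hP1 ▸ hP
    exact (monic_X_pow k).of_mul_monic_left this
  have hdeg : k + P1.natDegree = m := by
    rw [← hPd, hP1, (monic_X_pow k).natDegree_mul hP1', natDegree_X_pow]
  rcases Nat.lt_or_ge k m with hk | hk
  · have h2 : ∀ᶠ x in 𝓝[≠] (0:ℝ), q x * P1.eval x = x ^ (d - k) := by
      filter_upwards [h.filter_mono nhdsWithin_le_nhds, self_mem_nhdsWithin] with x hx hx0
      have hx0' : x ≠ 0 := hx0
      rw [← taylor_eval] at hx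
      change q x * P.eval x = _ at hx
      rw [hP1, eval_mul, eval_pow, eval_X] at hx
      have : x ^ d = x ^ k * x ^ (d - k) := by rw [← pow_add]; congr 1; omega
      rw [this] at hx
      apply mul_left_cancel₀ (pow_ne_zero k hx0')
      linarith
    have h3 : Tendsto (fun x => q x * P1.eval x) (𝓝[≠] 0) (𝓝 (q 0 * P1.eval 0)) :=
      (hq.mul P1.continuous.continuousAt).tendsto.mono_left nhdsWithin_le_nhds
    have h4 : Tendsto (fun x : ℝ => x ^ (d - k)) (𝓝[≠] 0) (𝓝 (0 ^ (d - k))) :=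
      ((continuous_pow (d - k)).tendsto 0).mono_left nhdsWithin_le_nhds
    rw [zero_pow (by omega)] at h4
    have := tendsto_nhds_unique h3 (h4.congr' (h2.mono fun x hx => hx.symm))
    exact mul_ne_zero hq0 hnd this
  · have hP1d : P1.natDegree = 0 := by omega
    have hP1e : P1 = 1 := hP1'.natDegree_eq_zero.1 hP1d
    have hkm : k = m := by omega
    rw [hP1e, mul_one, hkm] at hP1
    have h5 := taylor_pred (mon m b) m hm (mon_monic m b) (mon_natDegree m b) c
    change P.coeff _ = _ at h5
    rw [hP1, coeff_X_pow, if_neg (by omega), mon_coeff _ _ _ (by omega), h1, zero_add] at h5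
    have hc : c = 0 := by
      have : (m:ℝ) ≠ 0 := by positivity
      rcases mul_eq_zero.1 h5.symm with h | h
      · exact absurd h this
      · exact h
    have h6 : mon m b = X ^ m := by
      rw [← hP1]; simp only [P]; rw [hc, taylor_zero]
    have h7 := mon_coeff m b i0 hi0
    rw [h6, coeff_X_pow, if_neg hi0.ne] at h7
    exact h0 h7.symm

theorem puiseux (m : ℕ) : ∀ (a : ℕ → ℝ → ℝ) (_ : ∀ i, AnalyticAt ℝ (a i) 0)
    (ξ : ℝ → ℝ) (_ : ∀ᶠ s in 𝓝[>] (0:ℝ), ContinuousAt ξ s)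
    (_ : ∀ᶠ s in 𝓝[>] (0:ℝ), ξ s ^ m + ∑ i ∈ Finset.range m, a i s * ξ s ^ i = 0), Pui ξ := by
  induction m using Nat.strong_induction_on with
  | _ m IH =>
  intro a0 ha0 ξ0 hξ0 hr0
  rcases Nat.eq_zero_or_pos m with rfl | hm
  · simp at hr0
    exact absurd hr0 (NeBot.ne inferInstance)
  obtain ⟨a, ha, ham, hab⟩ := tsch m hm a0 ha0
  let ξ : ℝ → ℝ := fun s => ξ0 s + a0 (m-1) s / m
  have hr : ∀ᶠ s in 𝓝[>] (0:ℝ), ξ s ^ m + ∑ i ∈ Finset.range m, a i s * ξ s ^ i = 0 := by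
    filter_upwards [hr0] with s hs
    rw [← hs, hab]
  have hξ : ∀ᶠ s in 𝓝[>] (0:ℝ), ContinuousAt ξ s := by
    filter_upwards [hξ0, ((ha0 (m-1)).eventually_analyticAt).filter_mono nhdsWithin_le_nhds]
      with s h1 h2
    exact h1.add (h2.continuousAt.div_const _)
  suffices hP : Pui ξ by
    have : AnalyticAt ℝ (fun s => -(a0 (m-1) s / m)) 0 :=
      ((ha0 (m-1)).div analyticAt_const (by positivity)).neg
    refine (hP.add (Pui.of_an this)).congr (Eventually.of_forall fun s => ?_)
    simp [ξ]
  by_cases hz : ∀ i < m, ∀ᶠ s in 𝓝 (0:ℝ), a i s = 0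
  · have hz' : ∀ᶠ s in 𝓝 (0:ℝ), ∀ i ∈ Finset.range m, a i s = 0 :=
      (Finset.eventually_all _).2 fun i hi => hz i (Finset.mem_range.1 hi)
    refine (Pui.of_an (analyticAt_const (v := (0:ℝ)))).congr ?_
    filter_upwards [hr, hz'.filter_mono nhdsWithin_le_nhds] with s h1 h2
    rw [Finset.sum_eq_zero (fun i hi => by rw [h2 i hi, zero_mul]), add_zero] at h1
    exact pow_eq_zero_iff (by omega) |>.1 h1
  have hz : ∃ i < m, ¬ ∀ᶠ s in 𝓝 (0:ℝ), a i s = 0 := by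
    by_contra h
    exact hz fun i hi => by
      by_contra h'
      exact h ⟨i, hi, h'⟩
  obtain ⟨N, p, hN, b, hb, ⟨i0, hi0, hbi0⟩, hb0, hbe⟩ := rescale m a ha hz
  have hbm : b (m-1) 0 = 0 := hb0 (m-1) (by omega) (Eventually.of_forall ham)
  let η : ℝ → ℝ := fun s => ξ (s ^ N) / s ^ p
  have hηc : ∀ᶠ s in 𝓝[>] (0:ℝ), ContinuousAt η s := by
    filter_upwards [(tendsto_pow_gt hN).eventually hξ, self_mem_nhdsWithin] with s h1 h2
    have h2' : (0:ℝ) < s := h2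
    refine ContinuousAt.div ?_ (by fun_prop) (by positivity)
    exact ContinuousAt.comp (f := fun s : ℝ => s ^ N) (g := ξ) h1 (by fun_prop)
  have hηr : ∀ᶠ s in 𝓝[>] (0:ℝ), η s ^ m + ∑ i ∈ Finset.range m, b i s * η s ^ i = 0 := by
    filter_upwards [(tendsto_pow_gt hN).eventually hr, self_mem_nhdsWithin,
      hbe.filter_mono nhdsWithin_le_nhds] with s h1 h2 h3
    have h2' : (0:ℝ) < s := h2
    have h4 : ξ (s ^ N) = s ^ p * η s := by
      simp only [η]; field_simp
    rw [h4] at h1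
    have h5 : (s ^ p * η s) ^ m + ∑ i ∈ Finset.range m, a i (s ^ N) * (s ^ p * η s) ^ i =
        s ^ (p * m) * (η s ^ m + ∑ i ∈ Finset.range m, b i s * η s ^ i) := by
      rw [mul_add, Finset.mul_sum]
      congr 1
      · rw [mul_pow, pow_mul]
      · apply Finset.sum_congr rfl
        intro i hi
        have hi' := Finset.mem_range.1 hi
        rw [h3 i hi', mul_pow, ← pow_mul]
        have : s ^ (p * m) = s ^ (p * (m - i)) * s ^ (p * i) := by
          rw [← pow_add, ← mul_add]; congr 2; omega
        rw [this]; ring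
    rw [h5] at h1
    rcases mul_eq_zero.1 h1 with h | h
    · exact absurd h (by positivity)
    · exact h
  obtain ⟨c, hc⟩ := lim_root m b (fun i => (hb i).continuousAt) η hηc hηr
  let G : ℝ × ℝ → ℝ := fun z => (z.2 + c) ^ m + ∑ i ∈ Finset.range m, b i z.1 * (z.2 + c) ^ i
  have hG : AnalyticAt ℝ G 0 := by
    have h1 : AnalyticAt ℝ (fun z : ℝ × ℝ => z.2 + c) 0 := analyticAt_snd.add analyticAt_const
    refine (h1.pow m).add ?_
    refine Finset.analyticAt_fun_sum _ fun i _ => ?_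
    refine AnalyticAt.mul ?_ (h1.pow i)
    exact AnalyticAt.fun_comp_of_eq (hb i) analyticAt_fst rfl
  have hG0 : ∀ x, G (0, x) = (mon m (fun i => b i 0)).eval (x + c) := fun x => by
    rw [mon_eval]
  have hGne : ¬ ∀ᶠ t in 𝓝 (0:ℝ), G (0, t) = 0 := by
    intro h
    have h1 : ∀ᶠ t in 𝓝 (0:ℝ), (taylor c (mon m (fun i => b i 0))).IsRoot t := by
      filter_upwards [h] with t ht
      rw [IsRoot, taylor_eval, ← hG0, ht]
    have h2 : taylor c (mon m (fun i => b i 0)) = 0 := by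
      apply eq_zero_of_infinite_isRoot
      exact infinite_of_mem_nhds 0 h1
    rw [taylor_eq_zero] at h2
    exact (mon_monic m (fun i => b i 0)).ne_zero h2
  obtain ⟨d, a', ha', ha'0, q, hq, hq0, hqe⟩ := WP.WPT G hG hGne
  have hdm : d < m := by
    refine deg_lt m hm (fun i => b i 0) hbm i0 hi0 hbi0 c (fun x => q (0, x)) ?_ hq0 d ?_
    · exact ContinuousAt.comp (f := fun x : ℝ => ((0:ℝ), x)) (g := q) hq.continuousAt (by fun_prop)
    · have ht : Tendsto (fun x : ℝ => ((0:ℝ), x)) (𝓝 0) (𝓝 0) := by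
        have : Continuous (fun x : ℝ => ((0:ℝ), x)) := by fun_prop
        exact this.tendsto' 0 0 rfl
      filter_upwards [ht.eventually hqe] with x hx
      rw [← hG0, hx, Finset.sum_eq_zero, add_zero]
      intro i hi
      simp [ha'0 i (Finset.mem_range.1 hi)]
  have hζ : Pui (fun s => η s - c) := by
    refine IH d hdm a' ha' _ ?_ ?_
    · filter_upwards [hηc] with s hs using hs.sub continuousAt_const
    · have ht : Tendsto (fun s : ℝ => (s, η s - c)) (𝓝[>] 0) (𝓝 0) := by
        have h1 : Tendsto (fun s : ℝ => s) (𝓝[>] 0) (𝓝 0) := nhdsWithin_le_nhds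
        have h2 : Tendsto (fun s : ℝ => η s - c) (𝓝[>] 0) (𝓝 0) := by
          simpa using hc.sub_const c
        exact h1.prodMk_nhds h2
      filter_upwards [ht.eventually hqe, hηr] with s h1 h2
      rw [← h1]
      simp only [G, sub_add_cancel]
      rw [h2, mul_zero]
  apply Pui.of_pow hN
  have h1 := Pui.mul_fun (g := fun s => s ^ p) (analyticAt_id.pow p)
    (hζ.add (Pui.of_an (analyticAt_const (v := c))))
  refine h1.congr ?_
  filter_upwards [self_mem_nhdsWithin] with s hs
  have hs' : (0:ℝ) < s := hs
  simp only [η, sub_add_cancel]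
  field_simp

end Pu

end

section
open Filter Topology Polynomial

namespace Cell
open Pu

/-- evaluation of a polynomial with analytic coefficients -/
noncomputable def pe {X : Type} [NormedAddCommGroup X] [NormedSpace ℝ X] (p : (An X)[X]) (x : X) (t : ℝ) : ℝ :=
  (p.map (ev x)).eval t

structure Good {E : Type} [NormedAddCommGroup E] [NormedSpace ℝ E] (δ : ℝ) (C : Set (ℝ × E)) : Prop where
  P0 : ∀ z ∈ C, z.1 ∈ Set.Ioo 0 δ
  P1 : ∃ γ : ℝ → E, Pui γ ∧ ∀ r ∈ Set.Ioo 0 δ, ContDiffAt ℝ 1 γ r ∧ (r, γ r) ∈ C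
  P2 : ∀ r x y, (r, x) ∈ C → (r, y) ∈ C → ∃ σ : ℝ → E, ContDiff ℝ 1 σ ∧ σ 0 = x ∧ σ 1 = y ∧
    ∀ t, (r, σ t) ∈ C

def LC {P : Type} [NormedAddCommGroup P] [NormedSpace ℝ P] (D : Set P) (ξ : P → ℝ) : Prop :=
  ∀ x ∈ D, ∃ φ : P → ℝ, ContDiffAt ℝ 1 φ x ∧ ∀ᶠ y in 𝓝[D] x, ξ y = φ y

def Rt {P : Type} [NormedAddCommGroup P] [NormedSpace ℝ P] (D : Set P) (ξ : P → ℝ) : Prop :=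
  ∃ p : (An P)[X], p.Monic ∧ (∀ i, ∀ x ∈ closure D, AnalyticAt ℝ (p.coeff i : P → ℝ) x) ∧
    ∀ x ∈ D, pe p x (ξ x) = 0

theorem LC.comp {P : Type} [NormedAddCommGroup P] [NormedSpace ℝ P] {D : Set P} {ξ : P → ℝ}
    (h : LC D ξ) {σ : ℝ → P} {t : ℝ} (hσ : ContDiffAt ℝ 1 σ t) (hD : ∀ᶠ s in 𝓝 t, σ s ∈ D) :
    ContDiffAt ℝ 1 (fun s => ξ (σ s)) t := by
  obtain ⟨φ, hφ, he⟩ := h (σ t) hD.self_of_nhds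
  have h1 : ContDiffAt ℝ 1 (fun s => φ (σ s)) t := hφ.comp t hσ
  refine h1.congr_of_eventuallyEq ?_
  have h2 : Tendsto σ (𝓝 t) (𝓝[D] (σ t)) :=
    tendsto_nhdsWithin_iff.2 ⟨hσ.continuousAt, hD⟩
  exact h2.eventually he

theorem root_pui {E : Type} [NormedAddCommGroup E] [NormedSpace ℝ E] {δ : ℝ} (hδ : 0 < δ)
    {D : Set (ℝ × E)} {γ : ℝ → E} (hγ : Pui γ)
    (hγ' : ∀ r ∈ Set.Ioo 0 δ, ContDiffAt ℝ 1 γ r ∧ (r, γ r) ∈ D)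
    {ξ : ℝ × E → ℝ} (h1 : LC D ξ) (h2 : Rt D ξ) : Pui (fun r => ξ (r, γ r)) := by
  obtain ⟨Q, hQ, A, hA, hAe⟩ := hγ
  obtain ⟨p, hp, hpa, hpr⟩ := h2
  apply Pui.of_pow hQ
  have hI : ∀ᶠ r in 𝓝[>] (0:ℝ), r ∈ Set.Ioo 0 δ := Ioo_mem_nhdsGT hδ
  have hIQ := (tendsto_pow_gt hQ).eventually hI
  have hAa : AnalyticAt ℝ (fun s : ℝ => (s ^ Q, A s)) 0 := (analyticAt_id.pow Q).prod hA
  have hcl : ((0:ℝ) ^ Q, A 0) ∈ closure D := by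
    have ht : Tendsto (fun s : ℝ => (s ^ Q, A s)) (𝓝[>] 0) (𝓝 ((0:ℝ) ^ Q, A 0)) :=
      hAa.continuousAt.tendsto.mono_left nhdsWithin_le_nhds
    refine mem_closure_of_tendsto ht ?_
    filter_upwards [hIQ, hAe] with s hs hs'
    rw [← hs']
    exact (hγ' _ hs).2
  refine puiseux p.natDegree (fun i s => (p.coeff i : ℝ × E → ℝ) (s ^ Q, A s)) ?_ _ ?_ ?_
  · intro i
    exact AnalyticAt.fun_comp_of_eq (hpa i _ hcl) hAa rfl
  · filter_upwards [hIQ] with s hs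
    have hc : ContinuousAt (fun r => ξ (r, γ r)) (s ^ Q) := by
      refine (LC.comp h1 (σ := fun r => (r, γ r)) (contDiffAt_id.prodMk (hγ' _ hs).1) ?_).continuousAt
      filter_upwards [isOpen_Ioo.mem_nhds hs] with r hr using (hγ' r hr).2
    exact ContinuousAt.comp (f := fun s : ℝ => s ^ Q) (g := fun r => ξ (r, γ r)) hc (by fun_prop)
  · filter_upwards [hIQ, hAe] with s hs hs'
    have h3 := hpr _ (hγ' _ hs).2
    rw [pe, eq_mon hp, mon_map, mon_eval] at h3
    rw [← h3, ← hs']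
    rfl

theorem goodFib {E : Type} [NormedAddCommGroup E] [NormedSpace ℝ E] {δ : ℝ} (hδ : 0 < δ)
    {D : Set (ℝ × E)} (hD : Good δ D) {ξ ξ' : ℝ × E → ℝ} (h1 : LC D ξ) (h2 : Rt D ξ)
    (h1' : LC D ξ') (h2' : Rt D ξ') (N : Set ℝ) (hN : Convex ℝ N) (hNe : N.Nonempty) :
    Good δ {z : ℝ × (E × ℝ) | (z.1, z.2.1) ∈ D ∧
      ∃ ν ∈ N, z.2.2 = (1 - ν) * ξ (z.1, z.2.1) + ν * ξ' (z.1, z.2.1)} := by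
  refine ⟨fun z hz => hD.P0 _ hz.1, ?_, ?_⟩
  · obtain ⟨γ, hγ, hγ'⟩ := hD.P1
    obtain ⟨ν, hν⟩ := hNe
    refine ⟨fun r => (γ r, (1 - ν) * ξ (r, γ r) + ν * ξ' (r, γ r)), ?_, ?_⟩
    · refine hγ.pair (Pui.add ?_ ?_)
      · exact Pui.mul_fun analyticAt_const (root_pui hδ hγ hγ' h1 h2)
      · exact Pui.mul_fun analyticAt_const (root_pui hδ hγ hγ' h1' h2')
    · intro r hr
      refine ⟨?_, (hγ' r hr).2, ν, hν, rfl⟩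
      have hev : ∀ᶠ s in 𝓝 r, (s, γ s) ∈ D := by
        filter_upwards [isOpen_Ioo.mem_nhds hr] with s hs using (hγ' s hs).2
      have hc : ContDiffAt ℝ 1 (fun s => (s, γ s)) r := contDiffAt_id.prodMk (hγ' r hr).1
      exact (hγ' r hr).1.prodMk ((contDiffAt_const.mul (h1.comp hc hev)).add
        (contDiffAt_const.mul (h1'.comp hc hev)))
  · rintro r ⟨x, t⟩ ⟨y, u⟩ ⟨hx, ν, hν, ht⟩ ⟨hy, μ, hμ, hu⟩
    dsimp only at hx hy ht hu
    subst ht hu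
    obtain ⟨σ, hσ, h0, h1e, hσD⟩ := hD.P2 r x y hx hy
    have hc : ∀ s, ContDiffAt ℝ 1 (fun s => (r, σ s)) s := fun s =>
      contDiffAt_const.prodMk hσ.contDiffAt
    let w : ℝ → ℝ := fun s => ν + (μ - ν) * Real.smoothTransition s
    have hw : ContDiff ℝ 1 w := contDiff_const.add (contDiff_const.mul Real.smoothTransition.contDiff)
    refine ⟨fun s => (σ s, (1 - w s) * ξ (r, σ s) + w s * ξ' (r, σ s)), ?_, ?_, ?_, ?_⟩
    · rw [contDiff_iff_contDiffAt]
      intro s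
      exact hσ.contDiffAt.prodMk (((contDiffAt_const.sub hw.contDiffAt).mul
        (h1.comp (hc s) (Eventually.of_forall hσD))).add
        (hw.contDiffAt.mul (h1'.comp (hc s) (Eventually.of_forall hσD))))
    · simp [w, h0]
    · simp [w, h1e]
    · intro s
      refine ⟨hσD s, w s, ?_, rfl⟩
      have h3 : w s = (1 - Real.smoothTransition s) • ν + Real.smoothTransition s • μ := by
        simp only [w, smul_eq_mul]; ring
      rw [h3]
      exact hN hν hμ (by linarith [Real.smoothTransition.le_one s])
        (Real.smoothTransition.nonneg s) (by ring)

theorem self_id (Z : Finset ℝ) (f : ℝ → ℝ) (h : ∀ z ∈ Z, f z ∈ Z) (hm : ∀ a ∈ Z, ∀ b ∈ Z, a < b → f a < f b)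
    (z : ℝ) (hz : z ∈ Z) : f z = z := by
  let g : Z → Z := fun a => ⟨f a, h a a.2⟩
  have hg : StrictMono g := fun a b hab => hm a a.2 b b.2 hab
  have h1 := hg.le_apply (x := ⟨z, hz⟩)
  have h2 := hg.apply_le (x := ⟨z, hz⟩)
  exact le_antisymm h2 h1

theorem pe_contDiffAt {X : Type} [NormedAddCommGroup X] [NormedSpace ℝ X] (p : (An X)[X]) (x : X) (t : ℝ)
    (h : ∀ i, AnalyticAt ℝ (p.coeff i : X → ℝ) x) :
    ContDiffAt ℝ 1 (fun z : X × ℝ => pe p z.1 z.2) (x, t) := by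
  have : (fun z : X × ℝ => pe p z.1 z.2) = fun z : X × ℝ =>
      ∑ i ∈ Finset.range (p.natDegree + 1), (p.coeff i : X → ℝ) z.1 * z.2 ^ i := by
    funext z
    rw [pe, eval_map, eval₂_eq_sum_range]
    rfl
  rw [this]
  refine ContDiffAt.sum fun i _ => ?_
  refine ContDiffAt.mul ?_ (contDiffAt_snd.pow i)
  have h1 : ContDiffAt ℝ 1 (p.coeff i : X → ℝ) x := (h i).contDiffAt
  exact ContDiffAt.comp (x, t) h1 contDiffAt_fst

theorem ift {X : Type} [NormedAddCommGroup X] [NormedSpace ℝ X] [CompleteSpace X] (p : (An X)[X]) (x : X) (t : ℝ)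
    (h : ∀ i, AnalyticAt ℝ (p.coeff i : X → ℝ) x) (h0 : pe p x t = 0)
    (h1 : pe (derivative p) x t ≠ 0) :
    ∃ φ : X → ℝ, ContDiffAt ℝ 1 φ x ∧ φ x = t ∧ ∀ᶠ y in 𝓝 x, pe p y (φ y) = 0 := by
  have hf := pe_contDiffAt p x t h
  set f : X × ℝ → ℝ := fun z => pe p z.1 z.2 with hfd
  have hd : HasFDerivAt f (fderiv ℝ f (x, t)) (x, t) :=
    (hf.differentiableAt (by norm_num)).hasFDerivAt
  have hpart : HasDerivAt (fun s => f (x, s)) (fderiv ℝ f (x, t) (0, 1)) t := by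
    have h3 : HasDerivAt (fun s : ℝ => (x, s)) ((0 : X), (1:ℝ)) t :=
      (hasDerivAt_const t x).prodMk (hasDerivAt_id t)
    exact hd.comp_hasDerivAt t h3
  have hpart' : HasDerivAt (fun s => f (x, s)) (pe (derivative p) x t) t := by
    have := (p.map (ev x)).hasDerivAt t
    rw [derivative_map] at this
    exact this
  have he := hpart.unique hpart'
  have hinv : (fderiv ℝ f (x, t) ∘L ContinuousLinearMap.inr ℝ X ℝ).IsInvertible := by
    refine ⟨ContinuousLinearEquiv.unitsEquivAut ℝ (Units.mk0 _ h1), ?_⟩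
    ext
    simp [he]
  refine ⟨hf.implicitFunction one_ne_zero hinv, ?_, ?_, ?_⟩
  · exact hf.contDiffAt_implicitFunction one_ne_zero hinv
  · exact hf.implicitFunction_apply_self one_ne_zero hinv
  · have := hf.eventually_apply_implicitFunction one_ne_zero hinv
    filter_upwards [this] with y hy
    exact hy.trans h0

end Cell

end

section
open Filter Topology Polynomial

namespace Cell
open Pu

/-- normalised derivative -/
noncomputable def nd {X : Type} [NormedAddCommGroup X] [NormedSpace ℝ X] (p : (An X)[X]) : (An X)[X] :=
  C (⟨fun _ => ((p.natDegree : ℝ))⁻¹, analyticAt_const⟩ : An X) * derivative p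

theorem nd_monic {X : Type} [NormedAddCommGroup X] [NormedSpace ℝ X] (p : (An X)[X])
    (hp : p.Monic) (h : 1 ≤ p.natDegree) :
    (nd p).Monic ∧ (nd p).natDegree + 1 = p.natDegree := by
  have hle : (nd p).natDegree ≤ p.natDegree - 1 :=
    (natDegree_C_mul_le _ _).trans (natDegree_derivative_le p)
  have hco : (nd p).coeff (p.natDegree - 1) = 1 := by
    rw [nd, coeff_C_mul, coeff_derivative]
    rw [show p.natDegree - 1 + 1 = p.natDegree by omega, coeff_natDegree, hp.leadingCoeff]
    apply Subtype.ext
    funext x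
    have : (p.natDegree : ℝ) ≠ 0 := by positivity
    have h2 : ((p.natDegree - 1 : ℕ) : ℝ) + 1 = p.natDegree := by
      have : p.natDegree - 1 + 1 = p.natDegree := by omega
      exact_mod_cast this
    simp [h2, this]
  constructor
  · exact monic_of_natDegree_le_of_coeff_eq_one _ hle hco
  · have : (nd p).natDegree = p.natDegree - 1 := by
      apply le_antisymm hle
      apply le_natDegree_of_ne_zero
      rw [hco]
      intro h
      exact one_ne_zero (α := ℝ) (congrFun (congrArg Subtype.val h) 0)
    omega

theorem pe_nd {X : Type} [NormedAddCommGroup X] [NormedSpace ℝ X] (p : (An X)[X]) (x : X) (t : ℝ) :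
    pe (nd p) x t = (p.natDegree : ℝ)⁻¹ * pe (derivative p) x t := by
  simp only [pe, nd, Polynomial.map_mul, eval_mul, map_C, eval_C]
  rfl

theorem closedFam {X : Type} [NormedAddCommGroup X] [NormedSpace ℝ X] (M : Finset (An X)[X])
    (hM : ∀ p ∈ M, p.Monic) : ∃ F : Finset (An X)[X], M ⊆ F ∧ (∀ p ∈ F, p.Monic) ∧
      ∀ p ∈ F, 1 ≤ p.natDegree → nd p ∈ F := by
  classical
  let F := M.biUnion fun p => (Finset.range (p.natDegree + 1)).image fun k => nd^[k] p
  have key : ∀ p ∈ M, ∀ k ≤ p.natDegree, (nd^[k] p).Monic ∧ (nd^[k] p).natDegree + k = p.natDegree := by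
    intro p hp k
    induction k with
    | zero => intro _; exact ⟨hM p hp, rfl⟩
    | succ k ih =>
      intro hk
      obtain ⟨h1, h2⟩ := ih (by omega)
      rw [Function.iterate_succ_apply']
      obtain ⟨h3, h4⟩ := nd_monic _ h1 (by omega)
      exact ⟨h3, by omega⟩
  refine ⟨F, ?_, ?_, ?_⟩
  · intro p hp
    exact Finset.mem_biUnion.2 ⟨p, hp, Finset.mem_image.2 ⟨0, by simp, rfl⟩⟩
  · intro q hq
    obtain ⟨p, hp, hq⟩ := Finset.mem_biUnion.1 hq
    obtain ⟨k, hk, rfl⟩ := Finset.mem_image.1 hq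
    exact (key p hp k (by have := Finset.mem_range.1 hk; omega)).1
  · intro q hq hd
    obtain ⟨p, hp, hq⟩ := Finset.mem_biUnion.1 hq
    obtain ⟨k, hk, rfl⟩ := Finset.mem_image.1 hq
    have hk' := Finset.mem_range.1 hk
    have := (key p hp k (by omega)).2
    exact Finset.mem_biUnion.2 ⟨p, hp, Finset.mem_image.2 ⟨k + 1, by
      rw [Finset.mem_range]; omega, Function.iterate_succ_apply' _ _ _⟩⟩

theorem pe_mem_finite {X : Type} [NormedAddCommGroup X] [NormedSpace ℝ X] (F : Finset (An X)[X])
    (hF : ∀ p ∈ F, p.Monic) (x : X) : {t : ℝ | ∃ p ∈ F, pe p x t = 0}.Finite := by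
  have : {t : ℝ | ∃ p ∈ F, pe p x t = 0} = ⋃ p ∈ F, {t | pe p x t = 0} := by
    ext t; simp
  rw [this]
  refine Set.Finite.biUnion F.finite_toSet ?_
  intro p hp
  exact finite_setOfPred_isRoot ((hF p hp).map (ev x)).ne_zero

theorem pe_cont {X : Type} [NormedAddCommGroup X] [NormedSpace ℝ X] (p : (An X)[X]) (x : X) :
    Continuous (pe p x) := (p.map (ev x)).continuous

/-- cells over one base cell -/
theorem cellD {E : Type} [NormedAddCommGroup E] [NormedSpace ℝ E] [CompleteSpace E]
    {δ ε : ℝ} (hδ : 0 < δ) (hε : 0 < ε)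
    {D : Set (ℝ × E)} (hD : Good δ D) (F : Finset (An (ℝ × E))[X]) (hF : ∀ p ∈ F, p.Monic)
    (hFn : ∀ p ∈ F, 1 ≤ p.natDegree → nd p ∈ F)
    (hFe : ∃ p ∈ F, ∀ x, pe p x ε = 0) (hFe' : ∃ p ∈ F, ∀ x, pe p x (-ε) = 0)
    (hFa : ∀ p ∈ F, ∀ i, ∀ x ∈ closure D, AnalyticAt ℝ (p.coeff i : ℝ × E → ℝ) x)
    (x0 : ℝ × E) (_hx0 : x0 ∈ D) (θ : ℝ × E → ℝ ≃o ℝ)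
    (hθ : ∀ x ∈ D, θ x ε = ε ∧ θ x (-ε) = -ε ∧ ∀ p ∈ F, ∀ t ∈ Set.Icc (-ε) ε,
      SignType.sign (pe p x0 t) = SignType.sign (pe p x (θ x t))) :
    ∃ 𝒞 : Set (Set (ℝ × (E × ℝ))), 𝒞.Finite ∧
      (∀ C ∈ 𝒞, Good δ C ∧ (∀ z ∈ C, (z.1, z.2.1) ∈ D ∧ z.2.2 ∈ Set.Icc (-ε) ε) ∧
        ∀ p ∈ F, ∀ z ∈ C, ∀ w ∈ C, SignType.sign (pe p (z.1, z.2.1) z.2.2) =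
          SignType.sign (pe p (w.1, w.2.1) w.2.2)) ∧
      ∀ z : ℝ × (E × ℝ), (z.1, z.2.1) ∈ D → z.2.2 ∈ Set.Ioo (-ε) ε → ∃ C ∈ 𝒞, z ∈ C := by
  classical
  have hZf : {t : ℝ | t ∈ Set.Icc (-ε) ε ∧ ∃ p ∈ F, pe p x0 t = 0}.Finite :=
    (pe_mem_finite F hF x0).subset fun t ht => ht.2
  let Z : Finset ℝ := hZf.toFinset
  have hZ : ∀ t, t ∈ Z ↔ t ∈ Set.Icc (-ε) ε ∧ ∃ p ∈ F, pe p x0 t = 0 := fun t => by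
    simp only [Z, Set.Finite.mem_toFinset]; rfl
  have hεZ : ε ∈ Z := (hZ _).2 ⟨⟨by linarith, le_rfl⟩, by
    obtain ⟨p, hp, h⟩ := hFe; exact ⟨p, hp, h x0⟩⟩
  have hεZ' : -ε ∈ Z := (hZ _).2 ⟨⟨le_rfl, by linarith⟩, by
    obtain ⟨p, hp, h⟩ := hFe'; exact ⟨p, hp, h x0⟩⟩
  have hzero : ∀ x ∈ D, ∀ p ∈ F, ∀ t ∈ Set.Icc (-ε) ε, pe p x0 t = 0 ↔ pe p x (θ x t) = 0 := by
    intro x hx p hp t ht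
    rw [← sign_eq_zero_iff, (hθ x hx).2.2 p hp t ht, sign_eq_zero_iff]
  -- roots
  have hRt : ∀ z ∈ Z, Rt D (fun x => θ x z) := by
    intro z hz
    obtain ⟨hzI, p, hp, hpz⟩ := (hZ z).1 hz
    exact ⟨p, hF p hp, hFa p hp, fun x hx => (hzero x hx p hp z hzI).1 hpz⟩
  have hZrange : ∀ x ∈ D, ∀ t ∈ Set.Icc (-ε) ε, (∃ p ∈ F, pe p x t = 0) → (θ x).symm t ∈ Z := by
    rintro x hx t ht ⟨p, hp, hpt⟩
    have hI : (θ x).symm t ∈ Set.Icc (-ε) ε := by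
      constructor
      · rw [(θ x).le_symm_apply, (hθ x hx).2.1]; exact ht.1
      · rw [(θ x).symm_apply_le, (hθ x hx).1]; exact ht.2
    refine (hZ _).2 ⟨hI, p, hp, ?_⟩
    rw [hzero x hx p hp _ hI, OrderIso.apply_symm_apply]; exact hpt
  have hloc : ∀ x1 ∈ D, ∀ z ∈ Z, ∃ φ : ℝ × E → ℝ, ContDiffAt ℝ 1 φ x1 ∧ φ x1 = θ x1 z ∧
      ((z = ε ∨ z = -ε) → ∀ x, φ x = z) ∧
      ∀ᶠ x in 𝓝 x1, ∃ p ∈ F, pe p x (φ x) = 0 := by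
    intro x1 hx1 z hz
    by_cases hz1 : z = ε
    · refine ⟨fun _ => ε, contDiffAt_const, by rw [hz1, (hθ x1 hx1).1], fun _ _ => hz1.symm, ?_⟩
      obtain ⟨p, hp, h⟩ := hFe
      exact Eventually.of_forall fun x => ⟨p, hp, h x⟩
    by_cases hz2 : z = -ε
    · refine ⟨fun _ => -ε, contDiffAt_const, by rw [hz2, (hθ x1 hx1).2.1], fun _ _ => hz2.symm, ?_⟩
      obtain ⟨p, hp, h⟩ := hFe'
      exact Eventually.of_forall fun x => ⟨p, hp, h x⟩
    obtain ⟨hzI, hzp⟩ := (hZ z).1 hz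
    obtain ⟨p, hp, hmin⟩ := (F.filter fun p => pe p x0 z = 0).exists_min_image
      (fun p => p.natDegree) (by
        obtain ⟨p, hp, h⟩ := hzp
        exact ⟨p, Finset.mem_filter.2 ⟨hp, h⟩⟩)
    obtain ⟨hpF, hp0⟩ := Finset.mem_filter.1 hp
    have hdeg : 1 ≤ p.natDegree := by
      by_contra hlt
      have : p = 1 := (hF p hpF).natDegree_eq_zero.1 (by omega)
      rw [this] at hp0
      simp [pe] at hp0
    have hnd := nd_monic p (hF p hpF) hdeg
    have hnd0 : pe (nd p) x0 z ≠ 0 := by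
      intro h
      have := hmin (nd p) (Finset.mem_filter.2 ⟨hFn p hpF hdeg, h⟩)
      omega
    have h1 : pe p x1 (θ x1 z) = 0 := (hzero x1 hx1 p hpF z hzI).1 hp0
    have h2 : pe (derivative p) x1 (θ x1 z) ≠ 0 := by
      intro h
      apply hnd0
      rw [hzero x1 hx1 (nd p) (hFn p hpF hdeg) z hzI, pe_nd, h, mul_zero]
    obtain ⟨φ, hφ1, hφ2, hφ3⟩ := ift p x1 (θ x1 z)
      (fun i => hFa p hpF i x1 (subset_closure hx1)) h1 h2
    refine ⟨φ, hφ1, hφ2, ?_, ?_⟩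
    · rintro (h | h)
      · exact absurd h hz1
      · exact absurd h hz2
    · filter_upwards [hφ3] with x hx using ⟨p, hpF, hx⟩
  have hLC : ∀ z ∈ Z, LC D (fun x => θ x z) := by
    intro z hz x1 hx1
    have hloc' : ∀ z, ∃ φ : ℝ × E → ℝ, z ∈ Z → ContDiffAt ℝ 1 φ x1 ∧ φ x1 = θ x1 z ∧
      ((z = ε ∨ z = -ε) → ∀ x, φ x = z) ∧
      ∀ᶠ x in 𝓝 x1, ∃ p ∈ F, pe p x (φ x) = 0 := by
      intro z
      by_cases hz : z ∈ Z
      · obtain ⟨φ, h⟩ := hloc x1 hx1 z hz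
        exact ⟨φ, fun _ => h⟩
      · exact ⟨fun _ => 0, fun h => absurd h hz⟩
    choose φ hφ using hloc'
    refine ⟨φ z, (hφ z hz).1, ?_⟩
    have hmono : ∀ᶠ x in 𝓝 x1, ∀ a ∈ Z, ∀ b ∈ Z, a < b → φ a x < φ b x := by
      refine (Finset.eventually_all _).2 fun a ha => (Finset.eventually_all _).2 fun b hb => ?_
      by_cases hab : a < b
      · have h1 : φ a x1 < φ b x1 := by
          rw [(hφ a ha).2.1, (hφ b hb).2.1]; exact (θ x1).strictMono hab
        filter_upwards [(hφ a ha).1.continuousAt.eventually_lt (hφ b hb).1.continuousAt h1] with x hx _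
          using hx
      · exact Eventually.of_forall fun x h => absurd h hab
    have hroot : ∀ᶠ x in 𝓝 x1, ∀ a ∈ Z, ∃ p ∈ F, pe p x (φ a x) = 0 :=
      (Finset.eventually_all _).2 fun a ha => (hφ a ha).2.2.2
    filter_upwards [hmono.filter_mono nhdsWithin_le_nhds, hroot.filter_mono nhdsWithin_le_nhds,
      self_mem_nhdsWithin] with x hm hr hx
    have hI : ∀ a ∈ Z, φ a x ∈ Set.Icc (-ε) ε := by
      intro a ha
      have haI := ((hZ a).1 ha).1
      constructor
      · rcases haI.1.eq_or_lt with h | h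
        · rw [(hφ a ha).2.2.1 (Or.inr h.symm) x, ← h]
        · have := hm _ hεZ' _ ha h
          rw [(hφ _ hεZ').2.2.1 (Or.inr rfl) x] at this
          exact this.le
      · rcases haI.2.eq_or_lt with h | h
        · rw [(hφ a ha).2.2.1 (Or.inl h) x, h]
        · have := hm _ ha _ hεZ h
          rw [(hφ _ hεZ).2.2.1 (Or.inl rfl) x] at this
          exact this.le
    have := self_id Z (fun a => (θ x).symm (φ a x)) (fun a ha => hZrange x hx _ (hI a ha) (hr a ha))
      (fun a ha b hb hab => (θ x).symm.strictMono (hm a ha b hb hab)) z hz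
    rw [OrderIso.symm_apply_eq] at this
    exact this.symm
  -- cells
  let cell : ℝ × ℝ → Set ℝ → Set (ℝ × (E × ℝ)) := fun ab N => {z : ℝ × (E × ℝ) | (z.1, z.2.1) ∈ D ∧
      ∃ ν ∈ N, z.2.2 = (1 - ν) * θ (z.1, z.2.1) ab.1 + ν * θ (z.1, z.2.1) ab.2}
  let adj : ℝ × ℝ → Prop := fun ab => ab.1 < ab.2 ∧ ∀ z ∈ Z, z ≤ ab.1 ∨ ab.2 ≤ z
  let 𝒞 : Set (Set (ℝ × (E × ℝ))) := ((fun a => cell (a, a) {0}) '' (Z : Set ℝ)) ∪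
    ((fun ab => cell ab (Set.Ioo 0 1)) '' {ab | ab ∈ Z ×ˢ Z ∧ adj ab})
  refine ⟨𝒞, ?_, ?_, ?_⟩
  · refine (Z.finite_toSet.image _).union (Set.Finite.image _ ?_)
    exact (Z ×ˢ Z).finite_toSet.subset fun ab h => h.1
  · rintro C (⟨a, ha, rfl⟩ | ⟨⟨a, b⟩, ⟨hab, hadj⟩, rfl⟩)
    · have ha' : a ∈ Z := ha
      have haI := ((hZ a).1 ha').1
      refine ⟨goodFib hδ hD (hLC a ha) (hRt a ha) (hLC a ha) (hRt a ha) {0} (convex_singleton 0) ⟨0, rfl⟩,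
        ?_, ?_⟩
      · rintro z ⟨hz, ν, hν, h⟩
        refine ⟨hz, ?_⟩
        have hν' : ν = 0 := hν
        rw [h, hν']
        simp only [sub_zero, one_mul, zero_mul, add_zero]
        constructor
        · rw [← (hθ _ hz).2.1]; exact (θ _).monotone haI.1
        · conv_rhs => rw [← (hθ _ hz).1]
          exact (θ _).monotone haI.2
      · have : ∀ p ∈ F, ∀ z ∈ cell (a, a) {0}, SignType.sign (pe p (z.1, z.2.1) z.2.2) =
            SignType.sign (pe p x0 a) := by
          rintro p hp z ⟨hz, ν, hν, h⟩
          have hν' : ν = 0 := hν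
          rw [h, hν']
          simp only [sub_zero, one_mul, zero_mul, add_zero]
          exact ((hθ _ hz).2.2 p hp a haI).symm
        intro p hp z hz w hw
        rw [this p hp z hz, this p hp w hw]
    · obtain ⟨ha, hb⟩ := Finset.mem_product.1 hab
      have haI := ((hZ a).1 ha).1
      have hbI := ((hZ b).1 hb).1
      obtain ⟨hlt, hadj⟩ := hadj
      have hpt : ∀ z ∈ cell (a, b) (Set.Ioo 0 1), (z.1, z.2.1) ∈ D ∧
          ∃ u ∈ Set.Ioo a b, z.2.2 = θ (z.1, z.2.1) u := by
        rintro z ⟨hz, ν, hν, h⟩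
        refine ⟨hz, (θ (z.1, z.2.1)).symm z.2.2, ?_, by simp⟩
        have h1 : θ (z.1, z.2.1) a < θ (z.1, z.2.1) b := (θ _).strictMono hlt
        constructor
        · rw [(θ _).lt_symm_apply, h]
          simp only
          nlinarith [hν.1, hν.2]
        · rw [(θ _).symm_apply_lt, h]
          simp only
          nlinarith [hν.1, hν.2]
      refine ⟨goodFib hδ hD (hLC a ha) (hRt a ha) (hLC b hb) (hRt b hb) _ (convex_Ioo 0 1) ⟨1/2, by norm_num⟩,
        ?_, ?_⟩
      · intro z hz
        obtain ⟨hzD, u, hu, h⟩ := hpt z hz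
        refine ⟨hzD, ?_⟩
        rw [h]
        constructor
        · rw [← (hθ _ hzD).2.1]; exact (θ _).monotone (haI.1.trans hu.1.le)
        · conv_rhs => rw [← (hθ _ hzD).1]
          exact (θ _).monotone (hu.2.le.trans hbI.2)
      · intro p hp z hz w hw
        obtain ⟨hzD, u, hu, h⟩ := hpt z hz
        obtain ⟨hwD, v, hv, h'⟩ := hpt w hw
        rw [h, h']
        have hsub : ∀ s ∈ Set.Ioo a b, s ∈ Set.Icc (-ε) ε := fun s hs =>
          ⟨haI.1.trans hs.1.le, hs.2.le.trans hbI.2⟩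
        rw [← (hθ _ hzD).2.2 p hp u (hsub u hu), ← (hθ _ hwD).2.2 p hp v (hsub v hv)]
        refine Det.sign_const (pe_cont p x0).continuousOn ?_
        intro s hs h0
        have hsI : s ∈ Set.Ioo a b := (Set.ordConnected_Ioo.uIcc_subset hu hv) hs
        rcases hadj s ((hZ s).2 ⟨hsub s hsI, p, hp, h0⟩) with h | h
        · exact absurd hsI.1 (not_lt.2 h)
        · exact absurd hsI.2 (not_lt.2 h)
  · intro z hz ht
    set x := (z.1, z.2.1) with hx
    have h1 : -ε < (θ x).symm z.2.2 := by
      rw [(θ x).lt_symm_apply, (hθ x hz).2.1]; exact ht.1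
    have h2 : (θ x).symm z.2.2 < ε := by
      rw [(θ x).symm_apply_lt, (hθ x hz).1]; exact ht.2
    by_cases hu : (θ x).symm z.2.2 ∈ Z
    · refine ⟨_, Or.inl ⟨_, hu, rfl⟩, hz, 0, rfl, ?_⟩
      rw [← hx]; simp
    · obtain ⟨a, ha, b, hb, hau, hub, hadj⟩ := Det.gap Z hεZ' hεZ h1 h2 hu
      refine ⟨_, Or.inr ⟨(a, b), ⟨Finset.mem_product.2 ⟨ha, hb⟩, hau.trans hub, hadj⟩, rfl⟩, hz, ?_⟩
      rw [← hx]
      simp only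
      rw [(θ x).lt_symm_apply] at hau
      rw [(θ x).symm_apply_lt] at hub
      have hlt := hau.trans hub
      refine ⟨(z.2.2 - θ x a) / (θ x b - θ x a), ⟨by
        apply div_pos <;> linarith, by
        rw [div_lt_one (by linarith)]; linarith⟩, ?_⟩
      have : θ x b - θ x a ≠ 0 := by linarith
      field_simp
      ring

end Cell

end

section
open Filter Topology Polynomial

namespace Cell
open Pu

def TT (E : Type) [NormedAddCommGroup E] [NormedSpace ℝ E] : Prop :=
  ∀ S : Finset (An (ℝ × E)), ∀ U ∈ 𝓝 (0 : ℝ × E), ∃ δ > (0:ℝ), ∃ 𝒞 : Set (Set (ℝ × E)), 𝒞.Finite ∧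
    (∀ C ∈ 𝒞, Good δ C ∧ C ⊆ U ∧ ∀ F ∈ S, ∀ z ∈ C, ∀ w ∈ C,
      SignType.sign ((F : ℝ × E → ℝ) z) = SignType.sign ((F : ℝ × E → ℝ) w)) ∧
    ∃ V ∈ 𝓝 (0 : ℝ × E), ∀ z ∈ V, z.1 ∈ Set.Ioo 0 δ → ∃ C ∈ 𝒞, z ∈ C

/-- a constant as an element of `An` -/
def cst {X : Type} [NormedAddCommGroup X] [NormedSpace ℝ X] (c : ℝ) : An X :=
  ⟨fun _ => c, analyticAt_const⟩

theorem coeff_an {X : Type} [NormedAddCommGroup X] [NormedSpace ℝ X] (F : Finset (An X)[X]) :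
    ∀ᶠ x in 𝓝 (0:X), ∀ p ∈ F, ∀ i, AnalyticAt ℝ (p.coeff i : X → ℝ) x := by
  refine (Finset.eventually_all _).2 fun p _ => ?_
  have h : ∀ᶠ x in 𝓝 (0:X), ∀ i ∈ Finset.range (p.natDegree + 1), AnalyticAt ℝ (p.coeff i : X → ℝ) x :=
    (Finset.eventually_all _).2 fun i _ => (p.coeff i).2.eventually_analyticAt
  filter_upwards [h] with x hx i
  by_cases hi : i ∈ Finset.range (p.natDegree + 1)
  · exact hx i hi
  · rw [coeff_eq_zero_of_natDegree_lt (by rw [Finset.mem_range] at hi; omega)]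
    exact analyticAt_const

theorem stepPoly {E : Type} [NormedAddCommGroup E] [NormedSpace ℝ E] [FiniteDimensional ℝ E]
    (hTT : TT E) (M : Finset (An (ℝ × E))[X]) (hM : ∀ p ∈ M, p.Monic)
    (U : Set (ℝ × (E × ℝ))) (hU : U ∈ 𝓝 0) :
    ∃ δ > (0:ℝ), ∃ 𝒞 : Set (Set (ℝ × (E × ℝ))), 𝒞.Finite ∧
    (∀ C ∈ 𝒞, Good δ C ∧ C ⊆ U ∧ ∀ p ∈ M, ∀ z ∈ C, ∀ w ∈ C,
      SignType.sign (pe p (z.1, z.2.1) z.2.2) = SignType.sign (pe p (w.1, w.2.1) w.2.2)) ∧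
    ∃ V ∈ 𝓝 (0 : ℝ × (E × ℝ)), ∀ z ∈ V, z.1 ∈ Set.Ioo 0 δ → ∃ C ∈ 𝒞, z ∈ C := by
  classical
  haveI : CompleteSpace E := FiniteDimensional.complete ℝ E
  obtain ⟨ε, hε, hεU⟩ := Metric.nhds_basis_closedBall.mem_iff.1 hU
  have hεU' : ∀ z : ℝ × (E × ℝ), |z.1| ≤ ε → ‖z.2.1‖ ≤ ε → |z.2.2| ≤ ε → z ∈ U := by
    intro z h1 h2 h3
    apply hεU
    rw [mem_closedBall_zero_iff]
    exact max_le h1 (max_le h2 h3)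
  have hadd : ∀ c : ℝ, ∀ x : ℝ × E, ∀ t, pe (X - C (cst c)) x t = t - c := by
    intro c x t
    simp only [pe, Polynomial.map_sub, map_X, map_C, eval_sub, eval_X, eval_C]
    rfl
  obtain ⟨F, hMF, hF, hFn⟩ := closedFam (insert (X - C (cst ε)) (insert (X - C (cst (-ε))) M)) (by
    intro p hp
    rcases Finset.mem_insert.1 hp with rfl | hp
    · exact monic_X_sub_C _
    rcases Finset.mem_insert.1 hp with rfl | hp
    · exact monic_X_sub_C _
    · exact hM p hp)
  obtain ⟨η, hη, hηa⟩ := Metric.nhds_basis_closedBall.mem_iff.1 (coeff_an F)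
  set η' := min η ε with hη'
  have hη'0 : 0 < η' := lt_min hη hε
  obtain ⟨A, hA⟩ := Det.det_aux (cst (-ε) : An (ℝ × E)) (cst ε) F.val
  obtain ⟨δ, hδ, 𝒟, h𝒟f, h𝒟, V1, hV1, hcov⟩ := hTT A (Metric.closedBall 0 η')
    (Metric.closedBall_mem_nhds 0 hη'0)
  have key : ∀ D, ∃ 𝒞 : Set (Set (ℝ × (E × ℝ))), D ∈ 𝒟 → 𝒞.Finite ∧
      (∀ C ∈ 𝒞, Good δ C ∧ (∀ z ∈ C, (z.1, z.2.1) ∈ D ∧ z.2.2 ∈ Set.Icc (-ε) ε) ∧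
        ∀ p ∈ F, ∀ z ∈ C, ∀ w ∈ C, SignType.sign (pe p (z.1, z.2.1) z.2.2) =
          SignType.sign (pe p (w.1, w.2.1) w.2.2)) ∧
      ∀ z : ℝ × (E × ℝ), (z.1, z.2.1) ∈ D → z.2.2 ∈ Set.Ioo (-ε) ε → ∃ C ∈ 𝒞, z ∈ C := by
    intro D
    by_cases hDm : D ∈ 𝒟
    swap
    · exact ⟨∅, fun h => absurd h hDm⟩
    obtain ⟨hg, hsub, hsg⟩ := h𝒟 D hDm
    obtain ⟨γ, -, hγ⟩ := hg.P1
    have hx0 := (hγ (δ/2) ⟨by linarith, by linarith⟩).2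
    set x0 : ℝ × E := (δ/2, γ (δ/2)) with hx0d
    have hθ : ∀ x : ℝ × E, ∃ θ : ℝ ≃o ℝ, x ∈ D → θ ε = ε ∧ θ (-ε) = -ε ∧ ∀ p ∈ F, ∀ t ∈ Set.Icc (-ε) ε,
      SignType.sign (pe p x0 t) = SignType.sign (pe p x (θ t)) := by
      intro x
      by_cases hx : x ∈ D
      swap
      · exact ⟨OrderIso.refl ℝ, fun h => absurd h hx⟩
      obtain ⟨θ, h1, h2, h3⟩ := hA (ev x0) (ev x) rfl rfl (by change -ε < ε; linarith)
        (fun a ha => hsg a ha x0 hx0 x hx)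
      exact ⟨θ, fun _ => ⟨h2, h1, h3⟩⟩
    choose θ hθ using hθ
    have hcl : closure D ⊆ Metric.closedBall 0 η' := by
      rw [Metric.isClosed_closedBall.closure_subset_iff]; exact hsub
    obtain ⟨𝒞, h⟩ := cellD hδ hε hg F hF hFn
      ⟨_, hMF (Finset.mem_insert_self _ _), fun x => by rw [hadd, sub_self]⟩
      ⟨_, hMF (Finset.mem_insert_of_mem (Finset.mem_insert_self _ _)), fun x => by rw [hadd, sub_self]⟩
      (fun p hp i x hx => hηa (Metric.closedBall_subset_closedBall (min_le_left _ _) (hcl hx)) p hp i)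
      x0 hx0 θ hθ
    exact ⟨𝒞, fun _ => h⟩
  choose 𝒞 h𝒞 using key
  refine ⟨δ, hδ, ⋃ D ∈ 𝒟, 𝒞 D, h𝒟f.biUnion fun D hD => (h𝒞 D hD).1, ?_, ?_⟩
  · intro C hC
    obtain ⟨D, hD, hC⟩ := Set.mem_iUnion₂.1 hC
    obtain ⟨h1, h2, h3⟩ := (h𝒞 D hD).2.1 C hC
    refine ⟨h1, ?_, fun p hp => h3 p (hMF (Finset.mem_insert_of_mem (Finset.mem_insert_of_mem hp)))⟩
    intro z hz
    obtain ⟨hzD, hzt⟩ := h2 z hz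
    have hb := (h𝒟 D hD).2.1 hzD
    rw [mem_closedBall_zero_iff] at hb
    have hb' : max ‖z.1‖ ‖z.2.1‖ ≤ η' := hb
    have h4 := (max_le_iff.1 hb')
    exact hεU' z (h4.1.trans (min_le_right _ _)) (h4.2.trans (min_le_right _ _)) (abs_le.2 hzt)
  · refine ⟨{z | (z.1, z.2.1) ∈ V1 ∧ z.2.2 ∈ Set.Ioo (-ε) ε}, ?_, ?_⟩
    · have c1 : Tendsto (fun z : ℝ × (E × ℝ) => (z.1, z.2.1)) (𝓝 0) (𝓝 0) := by
        have : Continuous (fun z : ℝ × (E × ℝ) => (z.1, z.2.1)) := by fun_prop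
        exact this.tendsto' _ _ rfl
      have c2 : Tendsto (fun z : ℝ × (E × ℝ) => z.2.2) (𝓝 0) (𝓝 0) := by
        have : Continuous (fun z : ℝ × (E × ℝ) => z.2.2) := by fun_prop
        exact this.tendsto' _ _ rfl
      filter_upwards [c1.eventually hV1, c2.eventually (Ioo_mem_nhds (by linarith : -ε < 0) hε)] with z h1 h2
        using ⟨h1, h2⟩
    · rintro z ⟨hz1, hz2⟩ hz3
      obtain ⟨D, hD, hzD⟩ := hcov _ hz1 hz3
      obtain ⟨C, hC, hzC⟩ := (h𝒞 D hD).2.2 z hzD hz2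
      exact ⟨C, Set.mem_iUnion₂.2 ⟨D, hD, hC⟩, hzC⟩

theorem signq {X : Type} [TopologicalSpace X] {q : X → ℝ} {x : X} (hq : ContinuousAt q x) (h : q x ≠ 0) :
    ∀ᶠ z in 𝓝 x, SignType.sign (q z) = SignType.sign (q x) := by
  rcases lt_or_gt_of_ne h with h | h
  · filter_upwards [hq.eventually (gt_mem_nhds h)] with z hz
    rw [sign_neg h, sign_neg hz]
  · filter_upwards [hq.eventually (lt_mem_nhds h)] with z hz
    rw [sign_pos h, sign_pos hz]

theorem facs {E : Type} [NormedAddCommGroup E] [NormedSpace ℝ E] [FiniteDimensional ℝ E]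
    (F : An (ℝ × E)) : ∃ s : SignType, ∃ G : ℝ × E → ℝ, AnalyticAt ℝ G 0 ∧
      (¬ ∀ᶠ y in 𝓝 (0:E), G (0, y) = 0) ∧ ∀ᶠ z in 𝓝 (0 : ℝ × E), 0 < z.1 →
        SignType.sign ((F : ℝ × E → ℝ) z) = s * SignType.sign (G z) := by
  by_cases h : ∀ᶠ z in 𝓝 (0 : ℝ × E), (F : ℝ × E → ℝ) z = 0
  · refine ⟨0, fun _ => 1, analyticAt_const, fun h => by
      obtain ⟨y, hy⟩ := h.exists
      exact one_ne_zero hy, ?_⟩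
    filter_upwards [h] with z hz _
    simp [hz]
  · obtain ⟨k, G, hG, hFG, hne⟩ := WP.FAC (F : ℝ × E → ℝ) F.2 h
    refine ⟨1, G, hG, hne, ?_⟩
    filter_upwards [hFG] with z hz hz0
    rw [hz, sign_mul, sign_pos (pow_pos hz0 k)]

theorem wpts {P : Type} [NormedAddCommGroup P] [NormedSpace ℝ P] [FiniteDimensional ℝ P]
    (G : P × ℝ → ℝ) (hG : AnalyticAt ℝ G 0) (hne : ¬ ∀ᶠ t in 𝓝 (0:ℝ), G (0, t) = 0) :
    ∃ p : (An P)[X], p.Monic ∧ ∃ s : SignType, ∀ᶠ z in 𝓝 (0 : P × ℝ),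
      SignType.sign (G z) = s * SignType.sign (pe p z.1 z.2) := by
  obtain ⟨d, a, ha, -, q, hq, hq0, he⟩ := WP.WPT G hG hne
  let p : (An P)[X] := mon d (fun i => ⟨a i, ha i⟩)
  refine ⟨p, mon_monic _ _, SignType.sign (q 0), ?_⟩
  filter_upwards [he, signq hq.continuousAt hq0] with z h1 h2
  have h3 : pe p z.1 z.2 = q z * G z := by
    rw [h1, pe, mon_map, mon_eval]
    rfl
  rw [h3, sign_mul, h2, ← mul_assoc]
  have : SignType.sign (q 0) * SignType.sign (q 0) = 1 := by
    rcases lt_or_gt_of_ne hq0 with h | h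
    · rw [sign_neg h]; rfl
    · rw [sign_pos h]; rfl
  rw [this, one_mul]

theorem Good.map {E E' : Type} [NormedAddCommGroup E] [NormedSpace ℝ E] [NormedAddCommGroup E']
    [NormedSpace ℝ E'] (L : E' ≃L[ℝ] E) {δ : ℝ} {C : Set (ℝ × E')} (h : Good δ C) :
    Good δ {z : ℝ × E | (z.1, L.symm z.2) ∈ C} := by
  refine ⟨fun z hz => h.P0 _ hz, ?_, ?_⟩
  · obtain ⟨γ, h1, h2⟩ := h.P1
    refine ⟨fun r => L (γ r), h1.clm (L : E' →L[ℝ] E), fun r hr => ⟨?_, ?_⟩⟩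
    · exact L.contDiff.contDiffAt.comp r (h2 r hr).1
    · simpa using (h2 r hr).2
  · intro r x y hx hy
    obtain ⟨σ, h1, h2, h3, h4⟩ := h.P2 r _ _ hx hy
    refine ⟨fun t => L (σ t), L.contDiff.comp h1, by simp [h2], by simp [h3], fun t => ?_⟩
    simpa using h4 t

theorem common_ne {E : Type} [NormedAddCommGroup E] [NormedSpace ℝ E] (S : Finset (E → ℝ)) {η : ℝ}
    (hη : 0 < η) (ha : ∀ g ∈ S, AnalyticOnNhd ℝ g (Metric.ball 0 η))
    (hne : ∀ g ∈ S, ¬ ∀ᶠ y in 𝓝 (0:E), g y = 0) :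
    ∀ W : Set E, IsOpen W → W.Nonempty → W ⊆ Metric.ball 0 η → ∃ y ∈ W, ∀ g ∈ S, g y ≠ 0 := by
  classical
  induction S using Finset.induction_on with
  | empty => intro W _ ⟨y, hy⟩ _; exact ⟨y, hy, by simp⟩
  | insert g S hg ih =>
    intro W hW hWn hWb
    have hga := ha g (Finset.mem_insert_self _ _)
    have h1 : ∃ y ∈ W, g y ≠ 0 := by
      by_contra hc
      push Not at hc
      obtain ⟨y, hy⟩ := hWn
      have h2 := hga.eqOn_zero_of_preconnected_of_eventuallyEq_zero
        (convex_ball (0:E) η).isPreconnected (hWb hy)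
        (by filter_upwards [hW.mem_nhds hy] with z hz using hc z hz)
      apply hne g (Finset.mem_insert_self _ _)
      filter_upwards [Metric.ball_mem_nhds (0:E) hη] with z hz using h2 hz
    obtain ⟨y, hy, hgy⟩ := h1
    have hopen : IsOpen (W ∩ {y | g y ≠ 0}) :=
      (hga.continuousOn.mono hWb).isOpen_inter_preimage hW isOpen_ne
    obtain ⟨y', hy', h⟩ := ih (fun g' hg' => ha g' (Finset.mem_insert_of_mem hg'))
      (fun g' hg' => hne g' (Finset.mem_insert_of_mem hg')) _ hopen ⟨y, hy, hgy⟩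
      (Set.inter_subset_left.trans hWb)
    refine ⟨y', hy'.1, fun g' hg' => ?_⟩
    rcases Finset.mem_insert.1 hg' with rfl | hg'
    · exact hy'.2
    · exact h g' hg'

theorem direction {E : Type} [NormedAddCommGroup E] [NormedSpace ℝ E] [Nontrivial E] (S : Finset (E → ℝ))
    (ha : ∀ g ∈ S, AnalyticAt ℝ g 0) (hne : ∀ g ∈ S, ¬ ∀ᶠ y in 𝓝 (0:E), g y = 0) :
    ∃ c : E, c ≠ 0 ∧ ∀ g ∈ S, ¬ ∀ᶠ t in 𝓝 (0:ℝ), g (t • c) = 0 := by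
  have h1 : ∀ᶠ y in 𝓝 (0:E), ∀ g ∈ S, AnalyticAt ℝ g y :=
    (Finset.eventually_all _).2 fun g hg => (ha g hg).eventually_analyticAt
  obtain ⟨η, hη, hb⟩ := Metric.nhds_basis_ball.mem_iff.1 h1
  have hW : (Metric.ball (0:E) η ∩ {0}ᶜ).Nonempty := by
    obtain ⟨v, hv⟩ := exists_ne (0:E)
    refine ⟨(η / 2 / ‖v‖) • v, ?_, ?_⟩
    · rw [mem_ball_zero_iff, norm_smul, Real.norm_eq_abs, abs_of_pos (by positivity)]
      have := norm_pos_iff.2 hv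
      field_simp
      linarith
    · simp only [Set.mem_compl_iff, Set.mem_singleton_iff, smul_eq_zero, not_or]
      have := norm_pos_iff.2 hv
      exact ⟨by positivity, hv⟩
  obtain ⟨c, hc, hcg⟩ := common_ne S hη (fun g hg y hy => hb hy g hg) hne _
    (Metric.isOpen_ball.inter isOpen_compl_singleton) hW Set.inter_subset_left
  refine ⟨c, hc.2, fun g hg h => hcg g hg ?_⟩
  let T : Set ℝ := {t | t • c ∈ Metric.ball (0:E) η}
  have hT : Convex ℝ T := (convex_ball (0:E) η).is_linear_preimage (f := fun t : ℝ => t • c)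
    ⟨fun a b => add_smul a b c, fun a b => by simp [mul_smul]⟩
  have han : AnalyticOnNhd ℝ (fun t : ℝ => g (t • c)) T := by
    intro t ht
    have : AnalyticAt ℝ (fun t : ℝ => t • c) t := analyticAt_id.smul analyticAt_const
    exact AnalyticAt.fun_comp_of_eq (hb ht g hg) this rfl
  have := han.eqOn_zero_of_preconnected_of_eventuallyEq_zero hT.isPreconnected
    (z₀ := 0) (by simp [T, hη]) h (x := 1) (by simpa [T] using hc.1)
  simpa using this

theorem TT_zero (E : Type) [NormedAddCommGroup E] [NormedSpace ℝ E] [FiniteDimensional ℝ E] [Subsingleton E] :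
    TT E := by
  intro S U hU
  have h : ∀ F ∈ S, ∃ s : SignType, ∀ᶠ z in 𝓝 (0 : ℝ × E), 0 < z.1 →
      SignType.sign ((F : ℝ × E → ℝ) z) = s := by
    intro F _
    obtain ⟨s, G, hG, hne, he⟩ := facs F
    have hG0 : G 0 ≠ 0 := by
      intro h0
      apply hne
      refine Eventually.of_forall fun y => ?_
      rw [Subsingleton.elim y 0]; exact h0
    refine ⟨s * SignType.sign (G 0), ?_⟩
    filter_upwards [he, signq hG.continuousAt hG0] with z h1 h2 h3
    rw [h1 h3, h2]
  choose! s hs using h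
  have hall : ∀ᶠ z in 𝓝 (0 : ℝ × E), z ∈ U ∧ ∀ F ∈ S, 0 < z.1 →
      SignType.sign ((F : ℝ × E → ℝ) z) = s F :=
    (show ∀ᶠ z in 𝓝 (0 : ℝ × E), z ∈ U from hU).and ((Finset.eventually_all _).2 fun F hF => hs F hF)
  obtain ⟨δ, hδ, hb⟩ := Metric.nhds_basis_ball.mem_iff.1 hall
  have hin : ∀ z : ℝ × E, z.1 ∈ Set.Ioo 0 δ → z ∈ Metric.ball (0 : ℝ × E) δ := by
    intro z hz
    rw [mem_ball_zero_iff]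
    refine max_lt ?_ ?_
    · rw [Real.norm_eq_abs, abs_of_pos hz.1]; exact hz.2
    · rw [Subsingleton.elim z.2 0, norm_zero]; exact hδ
  refine ⟨δ, hδ, {({z : ℝ × E | z.1 ∈ Set.Ioo 0 δ})}, Set.finite_singleton _, ?_, Set.univ, univ_mem,
    fun z _ hz => ⟨{z : ℝ × E | z.1 ∈ Set.Ioo 0 δ}, rfl, hz⟩⟩
  rintro C rfl
  refine ⟨⟨fun z hz => hz, ⟨fun _ => 0, Pui.of_an analyticAt_const, fun r hr =>
    ⟨contDiffAt_const, hr⟩⟩, ?_⟩, fun z hz => (hb (hin z hz)).1, ?_⟩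
  · intro r x y hx _
    exact ⟨fun _ => x, contDiff_const, rfl, Subsingleton.elim _ _, fun _ => hx⟩
  · intro F hF z hz w hw
    rw [(hb (hin z hz)).2 F hF hz.1, (hb (hin w hw)).2 F hF hw.1]

theorem TT_succ (E' E : Type) [NormedAddCommGroup E'] [NormedSpace ℝ E'] [FiniteDimensional ℝ E']
    [NormedAddCommGroup E] [NormedSpace ℝ E] [FiniteDimensional ℝ E]
    (hd : Module.finrank ℝ E = Module.finrank ℝ E' + 1) (hTT : TT E') : TT E := by
  classical
  intro S U hU
  haveI : Nontrivial E := Module.nontrivial_of_finrank_pos (R := ℝ) (by omega)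
  choose s G hG hGne hGs using facs (E := E)
  obtain ⟨c, hc, hcG⟩ := direction (S.image fun F => fun y => G F (0, y))
    (by
      intro g hg
      obtain ⟨F, -, rfl⟩ := Finset.mem_image.1 hg
      exact AnalyticAt.fun_comp_of_eq (hG F) (analyticAt_const.prod analyticAt_id) rfl)
    (by
      intro g hg
      obtain ⟨F, -, rfl⟩ := Finset.mem_image.1 hg
      exact hGne F)
  have L0 : (E' × ℝ) ≃L[ℝ] E := ContinuousLinearEquiv.ofFinrankEq (by simp [hd])
  obtain ⟨A, hA⟩ := SeparatingDual.exists_continuousLinearEquiv_apply_eq (R := ℝ)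
    (x := L0 (0, 1)) (y := c) (by simp) hc
  let L := L0.trans A
  have hL : L (0, 1) = c := hA
  let H : An (ℝ × E) → (ℝ × E') × ℝ → ℝ := fun F z => G F (z.1.1, L (z.1.2, z.2))
  have hH : ∀ F, AnalyticAt ℝ (H F) 0 := by
    intro F
    have h1 : AnalyticAt ℝ (fun z : (ℝ × E') × ℝ => (z.1.1, L (z.1.2, z.2))) 0 := by
      let T : (ℝ × E') × ℝ →L[ℝ] ℝ × E :=
        ((ContinuousLinearMap.fst ℝ ℝ E').comp (ContinuousLinearMap.fst ℝ (ℝ × E') ℝ)).prod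
          ((L : E' × ℝ →L[ℝ] E).comp (((ContinuousLinearMap.snd ℝ ℝ E').comp
            (ContinuousLinearMap.fst ℝ (ℝ × E') ℝ)).prod (ContinuousLinearMap.snd ℝ (ℝ × E') ℝ)))
      exact T.analyticAt 0
    refine AnalyticAt.fun_comp_of_eq (hG F) h1 ?_
    simp
  have hHne : ∀ F ∈ S, ¬ ∀ᶠ t in 𝓝 (0:ℝ), H F (0, t) = 0 := by
    intro F hF h
    refine hcG _ (Finset.mem_image.2 ⟨F, hF, rfl⟩) ?_
    filter_upwards [h] with t ht
    have h2 : G F (0, t • c) = H F (0, t) := by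
      rw [← hL, ← map_smul]; simp [H]
    exact h2.trans ht
  have hp : ∀ F : An (ℝ × E), ∃ p : (An (ℝ × E'))[X], p.Monic ∧ ∃ s : SignType, F ∈ S →
      ∀ᶠ z in 𝓝 (0 : (ℝ × E') × ℝ), SignType.sign (H F z) = s * SignType.sign (pe p z.1 z.2) := by
    intro F
    by_cases hF : F ∈ S
    · obtain ⟨p, hp, s, h⟩ := wpts (H F) (hH F) (hHne F hF)
      exact ⟨p, hp, s, fun _ => h⟩
    · exact ⟨1, monic_one, 0, fun h => absurd h hF⟩
  choose p hpm s' hp using hp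
  -- the good neighbourhood
  have t1 : Tendsto (fun z : ℝ × (E' × ℝ) => (z.1, L z.2)) (𝓝 0) (𝓝 0) := by
    have : Continuous (fun z : ℝ × (E' × ℝ) => (z.1, L z.2)) := by fun_prop
    exact this.tendsto' _ _ (by simp)
  have t2 : Tendsto (fun z : ℝ × (E' × ℝ) => ((z.1, z.2.1), z.2.2)) (𝓝 0) (𝓝 0) := by
    have : Continuous (fun z : ℝ × (E' × ℝ) => ((z.1, z.2.1), z.2.2)) := by fun_prop
    exact this.tendsto' _ _ (by simp)
  have hU' : ∀ᶠ z in 𝓝 (0 : ℝ × (E' × ℝ)), (z.1, L z.2) ∈ U ∧ ∀ F ∈ S, 0 < z.1 →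
      SignType.sign ((F : ℝ × E → ℝ) (z.1, L z.2)) =
        s F * (s' F * SignType.sign (pe (p F) (z.1, z.2.1) z.2.2)) := by
    refine (t1.eventually hU).and ((Finset.eventually_all _).2 fun F hF => ?_)
    filter_upwards [t1.eventually (hGs F), t2.eventually (hp F hF)] with z h1 h2 h3
    rw [h1 h3, ← h2]
  obtain ⟨δ, hδ, 𝒞, hf, h𝒞, V, hV, hcov⟩ := stepPoly hTT (S.image p) (by
    intro q hq
    obtain ⟨F, -, rfl⟩ := Finset.mem_image.1 hq
    exact hpm F) _ hU'
  refine ⟨δ, hδ, (fun C => {z : ℝ × E | (z.1, L.symm z.2) ∈ C}) '' 𝒞, hf.image _, ?_, ?_⟩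
  · rintro _ ⟨C, hC, rfl⟩
    obtain ⟨h1, h2, h3⟩ := h𝒞 C hC
    refine ⟨h1.map L, ?_, ?_⟩
    · intro z hz
      have := (h2 hz).1
      simpa using this
    · have key : ∀ F ∈ S, ∀ z : ℝ × E, (z.1, L.symm z.2) ∈ C → SignType.sign ((F : ℝ × E → ℝ) z) =
          s F * (s' F * SignType.sign (pe (p F) (z.1, (L.symm z.2).1) (L.symm z.2).2)) := by
        intro F hF z hz
        have := (h2 hz).2 F hF (h1.P0 _ hz).1
        simpa using this
      intro F hF z hz w hw
      rw [key F hF z hz, key F hF w hw]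
      have := h3 (p F) (Finset.mem_image_of_mem _ hF) _ hz _ hw
      simp only at this
      rw [this]
  · refine ⟨{z | (z.1, L.symm z.2) ∈ V}, ?_, ?_⟩
    · have t3 : Tendsto (fun z : ℝ × E => (z.1, L.symm z.2)) (𝓝 0) (𝓝 0) := by
        have : Continuous (fun z : ℝ × E => (z.1, L.symm z.2)) := by fun_prop
        exact this.tendsto' _ _ (by simp)
      exact t3.eventually hV
    · intro z hz hz1
      obtain ⟨C, hC, hzC⟩ := hcov _ hz hz1
      exact ⟨_, ⟨C, hC, rfl⟩, hzC⟩

theorem TT_all (n : ℕ) : ∀ (E : Type) [NormedAddCommGroup E] [NormedSpace ℝ E] [FiniteDimensional ℝ E],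
    Module.finrank ℝ E = n → TT E := by
  induction n with
  | zero =>
    intro E _ _ _ h
    haveI : Subsingleton E := Module.finrank_zero_iff.1 h
    exact TT_zero E
  | succ n ih =>
    intro E _ _ _ h
    exact TT_succ (Fin n → ℝ) E (by simp [h]) (ih _ (by simp))

end Cell

end

section
open Filter Topology
set_option linter.unusedSectionVars false
set_option linter.style.haveILetI false
namespace Geo
open Cell Pu

variable {E : Type} [NormedAddCommGroup E] [InnerProductSpace ℝ E] [FiniteDimensional ℝ E]

theorem cells {ι : Type} [Finite ι] (F : ι → ℝ × E → ℝ) (hF : ∀ i, AnalyticAt ℝ (F i) 0)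
    (U : Set (ℝ × E)) (hU : U ∈ 𝓝 (0 : ℝ × E)) :
    ∃ δ > (0:ℝ), ∃ 𝒞 : Set (Set (ℝ × E)), 𝒞.Finite ∧
      (∀ C ∈ 𝒞, Good δ C ∧ C ⊆ U ∧ ∀ i, ∀ z ∈ C, ∀ w ∈ C,
        SignType.sign (F i z) = SignType.sign (F i w)) ∧
      ∃ V ∈ 𝓝 (0 : ℝ × E), ∀ z ∈ V, z.1 ∈ Set.Ioo 0 δ → ∃ C ∈ 𝒞, z ∈ C := by
  classical
  haveI := Fintype.ofFinite ι
  obtain ⟨δ, hδ, 𝒞, hfin, h1, h2⟩ := TT_all (Module.finrank ℝ E) E rfl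
    (Finset.univ.image fun i : ι => (⟨F i, hF i⟩ : An (ℝ × E))) U hU
  refine ⟨δ, hδ, 𝒞, hfin, fun C hC => ⟨(h1 C hC).1, (h1 C hC).2.1, fun i z hz w hw => ?_⟩, h2⟩
  exact (h1 C hC).2.2 ⟨F i, hF i⟩ (Finset.mem_image.2 ⟨i, Finset.mem_univ _, rfl⟩) z hz w hw

theorem grad_an {f : E → ℝ} {x : E} (hf : AnalyticAt ℝ f x) : AnalyticAt ℝ (gradient f) x := by
  have h := hf.fderiv
  let T : StrongDual ℝ E →ₗ[ℝ] E :=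
    { toFun := fun v => (InnerProductSpace.toDual ℝ E).symm v
      map_add' := fun a b => map_add _ a b
      map_smul' := fun c a => by simp }
  exact ((LinearMap.toContinuousLinearMap T).analyticAt _).comp h

theorem inner_grad (f : E → ℝ) (x v : E) : inner ℝ (gradient f x) v = fderiv ℝ f x v := by
  simp [gradient]

theorem an_inner {X : Type} [NormedAddCommGroup X] [NormedSpace ℝ X] {f g : X → E} {x : X}
    (hf : AnalyticAt ℝ f x) (hg : AnalyticAt ℝ g x) :
    AnalyticAt ℝ (fun x => inner ℝ (f x) (g x)) x := by
  exact ((innerSL ℝ (E := E)).analyticAt_bilinear (f x, g x)).comp₂ hf hg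

theorem deriv_along {f : E → ℝ} {σ : ℝ → E} {t : ℝ} {v : E} (hf : DifferentiableAt ℝ f (σ t))
    (hσ : HasDerivAt σ v t) : HasDerivAt (fun t => f (σ t)) (inner ℝ (gradient f (σ t)) v) t := by
  rw [inner_grad]
  exact hf.hasFDerivAt.comp_hasDerivAt t hσ

/-- Gram determinant of the gradient and the position vector. -/
noncomputable def gm (f : E → ℝ) (x : E) : ℝ :=
  inner ℝ (gradient f x) (gradient f x) * inner ℝ x x -
    inner ℝ (gradient f x) x * inner ℝ (gradient f x) x

/-- `|x|²` times the tangential part of the gradient. -/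
noncomputable def pt (f : E → ℝ) (x : E) : E :=
  (inner ℝ x x : ℝ) • gradient f x - (inner ℝ (gradient f x) x : ℝ) • x

theorem pt_sq (f : E → ℝ) (x : E) : inner ℝ (pt f x) (pt f x) = inner ℝ x x * gm f x := by
  simp only [pt, gm, inner_sub_left, inner_sub_right, inner_smul_left, inner_smul_right,
    RCLike.conj_to_real, real_inner_comm x (gradient f x)]
  ring

theorem pt_x (f : E → ℝ) (x : E) : inner ℝ (pt f x) x = 0 := by
  simp only [pt, inner_sub_left, inner_smul_left, RCLike.conj_to_real]
  ring

theorem pt_g (f : E → ℝ) (x : E) : inner ℝ (gradient f x) (pt f x) = gm f x := by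
  simp only [pt, gm, inner_sub_right, inner_smul_right]
  ring

theorem gm_nonneg (f : E → ℝ) (x : E) : 0 ≤ gm f x := by
  have := real_inner_mul_inner_self_le (gradient f x) x
  unfold gm; linarith

theorem gm_zero {f : E → ℝ} {x : E} (h : gm f x = 0) :
    (inner ℝ x x : ℝ) • gradient f x = (inner ℝ (gradient f x) x : ℝ) • x := by
  have := pt_sq f x
  rw [h, mul_zero, inner_self_eq_zero] at this
  exact sub_eq_zero.1 this

theorem gm_an {f : E → ℝ} {x : E} (hf : AnalyticAt ℝ f x) : AnalyticAt ℝ (gm f) x := by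
  have hg := grad_an hf
  exact ((an_inner hg hg).mul (an_inner analyticAt_id analyticAt_id)).sub
    ((an_inner hg analyticAt_id).mul (an_inner hg analyticAt_id))

/-- along a path on which the gradient is parallel to the position -/
theorem gm_along {f : E → ℝ} {x v : E} (h : gm f x = 0) :
    inner ℝ x x * inner ℝ (gradient f x) v = inner ℝ (gradient f x) x * inner ℝ x v := by
  have := congrArg (fun z => inner ℝ z v) (gm_zero h)
  simpa [inner_smul_left] using this

theorem inner_deriv {σ : ℝ → E} {t : ℝ} {v : E} {φ : ℝ → ℝ} {φ' : ℝ} (hσ : HasDerivAt σ v t)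
    (hφ : HasDerivAt φ φ' t) (h : ∀ᶠ s in 𝓝 t, inner ℝ (σ s) (σ s) = φ s) :
    2 * inner ℝ (σ t) v = φ' := by
  have h1 := hσ.inner ℝ hσ
  have h2 := (hφ.congr_of_eventuallyEq h).unique h1
  rw [h2, real_inner_comm v]; ring

theorem Good.sec {δ : ℝ} {C : Set (ℝ × E)} (h : Good δ C) : ∃ γ : ℝ → E, Pui γ ∧
    ∀ r ∈ Set.Ioo 0 δ, HasDerivAt γ (deriv γ r) r ∧ (r, γ r) ∈ C := by
  obtain ⟨γ, h1, h2⟩ := h.P1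
  exact ⟨γ, h1, fun r hr => ⟨((h2 r hr).1.differentiableAt one_ne_zero).hasDerivAt, (h2 r hr).2⟩⟩

theorem snd_an {f : E → ℝ} (hf : AnalyticAt ℝ f 0) :
    AnalyticAt ℝ (fun z : ℝ × E => f z.2) 0 :=
  AnalyticAt.fun_comp_of_eq hf analyticAt_snd rfl

theorem fst_an {f : ℝ → ℝ} (hf : AnalyticAt ℝ f 0) :
    AnalyticAt ℝ (fun z : ℝ × E => f z.1) 0 :=
  AnalyticAt.fun_comp_of_eq hf analyticAt_fst rfl

theorem partA {f : E → ℝ} (hf : AnalyticAt ℝ f 0) (hf0 : f 0 = 0) :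
    ∃ η > (0:ℝ), ∀ x : E, x ≠ 0 → ‖x‖ < η → f x < 0 → gm f x = 0 →
      inner ℝ (gradient f x) x < 0 := by
  have hxx : AnalyticAt ℝ (fun x : E => (inner ℝ x x : ℝ)) 0 :=
    an_inner analyticAt_id analyticAt_id
  obtain ⟨δ, hδ, 𝒞, hfin, h1, V, hV, h2⟩ := cells (E := E)
    ![fun z => inner ℝ z.2 z.2 - z.1 ^ 2, fun z => f z.2, fun z => gm f z.2,
      fun z => inner ℝ (gradient f z.2) z.2] (by
      intro i
      fin_cases i
      · exact (snd_an hxx).sub (fst_an (analyticAt_id.pow 2))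
      · exact snd_an hf
      · exact snd_an (gm_an hf)
      · exact snd_an (f := fun x => inner ℝ (gradient f x) x) (an_inner (grad_an hf) analyticAt_id))
    {z | AnalyticAt ℝ f z.2} (by
      have : ∀ᶠ z in 𝓝 (0:E), AnalyticAt ℝ f z := hf.eventually_analyticAt
      exact (continuous_snd.tendsto (0 : ℝ × E)).eventually this)
  obtain ⟨η, hη, hb⟩ := Metric.nhds_basis_ball.mem_iff.1 hV
  refine ⟨min η δ, lt_min hη hδ, fun x hx hxn hfx hgm => ?_⟩
  by_contra! hneg
  have hx0 : 0 < ‖x‖ := norm_pos_iff.2 hx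
  obtain ⟨C, hC, hxC⟩ := h2 (‖x‖, x) (hb (by
    rw [mem_ball_zero_iff]
    refine max_lt ?_ ?_
    · simpa using lt_of_lt_of_le hxn (min_le_left _ _)
    · exact lt_of_lt_of_le hxn (min_le_left _ _))) ⟨hx0, lt_of_lt_of_le hxn (min_le_right _ _)⟩
  obtain ⟨hG, hCU, hsign⟩ := h1 C hC
  obtain ⟨γ, -, hγ⟩ := Good.sec hG
  have e1 : ∀ r ∈ Set.Ioo 0 δ, inner ℝ (γ r) (γ r) = r ^ 2 := by
    intro r hr
    have h := hsign 0 _ hxC _ (hγ r hr).2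
    simp only [Matrix.cons_val_zero, real_inner_self_eq_norm_sq, sub_self, sign_zero] at h
    have := sign_eq_zero_iff.1 h.symm
    rw [real_inner_self_eq_norm_sq]; linarith
  have e2 : ∀ r ∈ Set.Ioo 0 δ, f (γ r) < 0 := by
    intro r hr
    have h := hsign 1 _ hxC _ (hγ r hr).2
    simp only [Matrix.cons_val_one, Matrix.cons_val_zero, sign_neg hfx] at h
    exact sign_eq_neg_one_iff.1 h.symm
  have e3 : ∀ r ∈ Set.Ioo 0 δ, gm f (γ r) = 0 := by
    intro r hr
    have h := hsign 2 _ hxC _ (hγ r hr).2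
    simp only [Matrix.cons_val, hgm, sign_zero] at h
    exact sign_eq_zero_iff.1 h.symm
  have e4 : ∀ r ∈ Set.Ioo 0 δ, 0 ≤ inner ℝ (gradient f (γ r)) (γ r) := by
    intro r hr
    have h := hsign 3 _ hxC _ (hγ r hr).2
    simp only [Matrix.cons_val] at h
    by_contra! h'
    rw [sign_neg h'] at h
    exact absurd (sign_eq_neg_one_iff.1 h) (not_lt.2 hneg)
  have hd : ∀ r ∈ Set.Ioo 0 δ, HasDerivAt (fun r => f (γ r))
      (inner ℝ (gradient f (γ r)) (deriv γ r)) r := fun r hr =>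
    deriv_along (hCU (hγ r hr).2).differentiableAt (hγ r hr).1
  have hd0 : ∀ r ∈ Set.Ioo 0 δ, 0 ≤ inner ℝ (gradient f (γ r)) (deriv γ r) := by
    intro r hr
    have k1 := gm_along (v := deriv γ r) (e3 r hr)
    have k2 := inner_deriv (hγ r hr).1 (hasDerivAt_pow 2 r) (by
      filter_upwards [Ioo_mem_nhds hr.1 hr.2] with s hs using e1 s hs)
    rw [e1 r hr] at k1
    have k3 : inner ℝ (γ r) (deriv γ r) = r := by push_cast at k2; linarith
    rw [k3] at k1
    have := mul_nonneg (e4 r hr) hr.1.le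
    rw [← k1] at this
    exact nonneg_of_mul_nonneg_right this (pow_pos hr.1 2)
  have hmono : MonotoneOn (fun r => f (γ r)) (Set.Ioo 0 δ) := by
    refine monotoneOn_of_deriv_nonneg (convex_Ioo _ _)
      (fun r hr => (hd r hr).continuousAt.continuousWithinAt) ?_ ?_
    · intro r hr
      rw [interior_Ioo] at hr
      exact (hd r hr).differentiableAt.differentiableWithinAt
    · intro r hr
      rw [interior_Ioo] at hr
      rw [(hd r hr).deriv]; exact hd0 r hr
  have hlim : Tendsto (fun r => f (γ r)) (𝓝[>] 0) (𝓝 0) := by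
    have hc := hf.continuousAt.tendsto
    rw [hf0] at hc
    refine hc.comp ?_
    rw [tendsto_zero_iff_norm_tendsto_zero]
    refine (tendsto_nhdsWithin_of_tendsto_nhds (tendsto_id (α := ℝ))).congr' ?_
    filter_upwards [Ioo_mem_nhdsGT hδ] with r hr
    have := e1 r hr
    rw [real_inner_self_eq_norm_sq] at this
    exact ((sq_eq_sq₀ (norm_nonneg _) hr.1.le).1 this).symm
  have hm : δ / 2 ∈ Set.Ioo 0 δ := ⟨by linarith, by linarith⟩
  have : 0 ≤ f (γ (δ / 2)) := by
    refine le_of_tendsto hlim ?_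
    filter_upwards [Ioo_mem_nhdsGT hm.1] with r hr
    exact hmono ⟨hr.1, hr.2.trans hm.2⟩ hm hr.2.le
  exact absurd (e2 _ hm) (not_lt.2 this)

end Geo

end

section
open Filter Topology
set_option linter.unusedSectionVars false
set_option linter.style.haveILetI false
namespace Geo
open Cell Pu

variable {E : Type} [NormedAddCommGroup E] [InnerProductSpace ℝ E] [FiniteDimensional ℝ E]

/-- path with zero derivative of `f` -/
theorem const_along {f : E → ℝ} {σ : ℝ → E} (hσ : ContDiff ℝ 1 σ)
    (hf : ∀ t, DifferentiableAt ℝ f (σ t))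
    (h : ∀ t, inner ℝ (gradient f (σ t)) (deriv σ t) = 0) (s t : ℝ) : f (σ s) = f (σ t) := by
  have hd : ∀ t, HasDerivAt (fun t => f (σ t)) 0 t := by
    intro t
    have := deriv_along (hf t) ((hσ.differentiable one_ne_zero).differentiableAt (x := t)).hasDerivAt
    rwa [h t] at this
  exact is_const_of_deriv_eq_zero (fun t => (hd t).differentiableAt) (fun t => (hd t).deriv) s t

theorem partC {f : E → ℝ} (hf : AnalyticAt ℝ f 0) (a : ℝ) (ℓ : ℚ) (hℓ : 0 < ℓ) :
    ∃ η > (0:ℝ), ∀ ρ > (0:ℝ), ∀ r < η, ∃ ε > (0:ℝ), ∀ x : E, ρ ≤ ‖x‖ → ‖x‖ ≤ r → gm f x = 0 →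
      f x ≤ (a + ε) * ‖x‖ ^ (ℓ : ℝ) → f x ≤ a * ‖x‖ ^ (ℓ : ℝ) := by
  obtain ⟨p, hp⟩ : ∃ p : ℕ, ℓ.num = p := ⟨ℓ.num.toNat, by
    have := Rat.num_pos.2 hℓ; omega⟩
  set q := ℓ.den with hq
  have hq0 : q ≠ 0 := ℓ.den_nz
  have hq' : (0:ℝ) < q := by exact_mod_cast Nat.pos_of_ne_zero hq0
  have hpq : (ℓ : ℝ) = p / q := by
    rw [Rat.cast_def, hp]; simp [hq]
  have hxx : AnalyticAt ℝ (fun x : E => (inner ℝ x x : ℝ)) 0 :=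
    an_inner analyticAt_id analyticAt_id
  obtain ⟨δ, hδ, 𝒞, hfin, h1, V, hV, h2⟩ := cells (E := E)
    ![fun z => inner ℝ z.2 z.2 - z.1 ^ (2 * q), fun z => f z.2 - a * z.1 ^ p,
      fun z => gm f z.2] (by
      intro i
      fin_cases i
      · exact (snd_an hxx).sub (fst_an (analyticAt_id.pow _))
      · exact (snd_an hf).sub (fst_an (analyticAt_const.mul (analyticAt_id.pow p)))
      · exact snd_an (gm_an hf))
    {z | AnalyticAt ℝ f z.2} (by
      have : ∀ᶠ z in 𝓝 (0:E), AnalyticAt ℝ f z := hf.eventually_analyticAt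
      exact (continuous_snd.tendsto (0 : ℝ × E)).eventually this)
  obtain ⟨η, hη, hb⟩ := Metric.nhds_basis_ball.mem_iff.1 hV
  have hm : 0 < min η δ := lt_min hη hδ
  refine ⟨min η ((min η δ) ^ q), lt_min hη (pow_pos hm q), fun ρ hρ r hr => ?_⟩
  -- the parameter
  have hs : ∀ x : E, ρ ≤ ‖x‖ → ‖x‖ ≤ r → ∃ s, s ∈ Set.Icc (ρ ^ (1 / (q:ℝ))) (r ^ (1 / (q:ℝ))) ∧
      s ∈ Set.Ioo 0 δ ∧ s < η ∧ ‖x‖ = s ^ q ∧ ‖x‖ ^ (ℓ : ℝ) = s ^ p := by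
    intro x hx hxr
    have hx0 : 0 < ‖x‖ := hρ.trans_le hx
    have hsq : (‖x‖ ^ (1 / (q:ℝ))) ^ q = ‖x‖ := by
      rw [one_div]; exact Real.rpow_inv_natCast_pow hx0.le hq0
    have hlt : ‖x‖ ^ (1 / (q:ℝ)) < min η δ := by
      refine lt_of_pow_lt_pow_left₀ q hm.le ?_
      rw [hsq]; exact (hxr.trans_lt hr).trans_le (min_le_right _ _)
    refine ⟨‖x‖ ^ (1 / (q:ℝ)), ⟨?_, ?_⟩, ⟨Real.rpow_pos_of_pos hx0 _, hlt.trans_le (min_le_right _ _)⟩,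
      hlt.trans_le (min_le_left _ _), hsq.symm, ?_⟩
    · gcongr
    · gcongr
    · rw [hpq, ← Real.rpow_natCast, ← Real.rpow_mul hx0.le]
      congr 1; field_simp
  have key : ∀ C ∈ 𝒞, ∃ ε > (0:ℝ), ∀ x : E, ∀ s, (s, x) ∈ C → ρ ≤ ‖x‖ → ‖x‖ ≤ r → ‖x‖ = s ^ q →
      ‖x‖ ^ (ℓ : ℝ) = s ^ p → s ∈ Set.Icc (ρ ^ (1 / (q:ℝ))) (r ^ (1 / (q:ℝ))) → gm f x = 0 →
      a * ‖x‖ ^ (ℓ : ℝ) < f x → a * ‖x‖ ^ (ℓ : ℝ) + ε < f x := by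
    intro C hC
    obtain ⟨hG, hCU, hsign⟩ := h1 C hC
    by_cases hex : ∃ x s, (s, x) ∈ C ∧ ρ ≤ ‖x‖ ∧ ‖x‖ ≤ r ∧ ‖x‖ = s ^ q ∧ ‖x‖ ^ (ℓ : ℝ) = s ^ p ∧
        gm f x = 0 ∧ a * ‖x‖ ^ (ℓ : ℝ) < f x
    swap
    · refine ⟨1, one_pos, fun x s k1 k2 k3 k4 k5 _ k6 k7 => ?_⟩
      exact absurd ⟨x, s, k1, k2, k3, k4, k5, k6, k7⟩ hex
    obtain ⟨x, s0, hxC, k2, k3, k4, k5, k6, k7⟩ := hex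
    have e1 : ∀ z ∈ C, inner ℝ z.2 z.2 = z.1 ^ (2 * q) := by
      intro z hz
      have h := hsign 0 _ hxC _ hz
      simp only [Matrix.cons_val_zero, real_inner_self_eq_norm_sq] at h
      have h0 : ‖x‖ ^ 2 - s0 ^ (2 * q) = 0 := by rw [k4]; ring
      rw [h0, sign_zero] at h
      have := sign_eq_zero_iff.1 h.symm
      rw [real_inner_self_eq_norm_sq]; linarith
    have e2 : ∀ z ∈ C, 0 < f z.2 - a * z.1 ^ p := by
      intro z hz
      have h := hsign 1 _ hxC _ hz
      simp only [Matrix.cons_val_one, Matrix.cons_val_zero] at h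
      rw [sign_pos (a := f x - a * s0 ^ p) (by rw [← k5]; linarith)] at h
      exact sign_eq_one_iff.1 h.symm
    have e3 : ∀ z ∈ C, gm f z.2 = 0 := by
      intro z hz
      have h := hsign 2 _ hxC _ hz
      simp only [Matrix.cons_val, k6, sign_zero] at h
      exact sign_eq_zero_iff.1 h.symm
    obtain ⟨γ, -, hγ⟩ := Good.sec hG
    have hfib : ∀ s x y, (s, x) ∈ C → (s, y) ∈ C → f x = f y := by
      intro s x y hx hy
      obtain ⟨σ, hσ, rfl, rfl, hσC⟩ := hG.P2 s x y hx hy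
      refine const_along hσ (fun t => (hCU (hσC t)).differentiableAt) (fun t => ?_) 0 1
      have j1 := gm_along (v := deriv σ t) (e3 _ (hσC t))
      have j2 := inner_deriv ((hσ.differentiable one_ne_zero).differentiableAt (x := t)).hasDerivAt
        (hasDerivAt_const t (s ^ (2 * q))) (Eventually.of_forall fun t' => e1 _ (hσC t'))
      have j3 : inner ℝ (σ t) (deriv σ t) = 0 := by linarith
      have j4 : inner ℝ (σ t) (σ t) = s ^ (2 * q) := e1 _ (hσC t)
      have j5 : 0 < s := (hG.P0 _ hx).1
      simp only [j3, mul_zero, j4, mul_eq_zero] at j1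
      exact j1.resolve_left (pow_pos j5 _).ne'
    have hcont : ContinuousOn (fun s => f (γ s) - a * s ^ p) (Set.Ioo 0 δ) := by
      intro s hs
      refine ContinuousAt.continuousWithinAt ?_
      refine ContinuousAt.sub ?_ (by fun_prop)
      exact ContinuousAt.comp (f := γ) (g := f) (hCU (hγ s hs).2).continuousAt (hγ s hs).1.continuousAt
    have hr0 : 0 < r := hρ.trans_le (k2.trans k3)
    have hsub : Set.Icc (ρ ^ (1 / (q:ℝ))) (r ^ (1 / (q:ℝ))) ⊆ Set.Ioo 0 δ := by
      intro s hs
      refine ⟨(Real.rpow_pos_of_pos hρ _).trans_le hs.1, hs.2.trans_lt ?_⟩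
      refine lt_of_pow_lt_pow_left₀ q hδ.le ?_
      rw [one_div, Real.rpow_inv_natCast_pow hr0.le hq0]
      exact (hr.trans_le (min_le_right _ _)).trans_le
        (pow_le_pow_left₀ hm.le (min_le_right _ _) q)
    by_cases hne : (Set.Icc (ρ ^ (1 / (q:ℝ))) (r ^ (1 / (q:ℝ)))).Nonempty
    swap
    · exact ⟨1, one_pos, fun x s _ _ _ _ _ hs => absurd ⟨s, hs⟩ hne⟩
    obtain ⟨t, ht, hmin⟩ := isCompact_Icc.exists_isMinOn hne (hcont.mono hsub)
    have hpos := e2 _ (hγ t (hsub ht)).2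
    simp only at hpos
    refine ⟨(f (γ t) - a * t ^ p) / 2, by linarith, ?_⟩
    intro x s l1 l2 l3 l4 l5 l6 l7 l8
    have m1 := hmin l6
    simp only [Set.mem_ofPred_eq] at m1
    rw [hfib s x (γ s) l1 (hγ s (hsub l6)).2, l5]
    linarith
  choose! ε hε hεk using key
  -- minimum
  obtain ⟨ε0, hε0, hmin⟩ : ∃ ε0 > (0:ℝ), ∀ C ∈ 𝒞, ε0 ≤ ε C := by
    have : ∀ᶠ e in 𝓝[>] (0:ℝ), ∀ C ∈ 𝒞, e ≤ ε C := by
      rw [hfin.eventually_all]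
      intro C hC
      exact nhdsWithin_le_nhds (Iic_mem_nhds (hε C hC))
    obtain ⟨e, he, he'⟩ := (this.and self_mem_nhdsWithin).exists
    exact ⟨e, he', he⟩
  refine ⟨ε0 / (|r| ^ (ℓ : ℝ) + 1), by positivity, fun x hx hxr hgm hle => ?_⟩
  by_contra! hlt
  obtain ⟨s, s1, s2, s3, s4, s5⟩ := hs x hx hxr
  obtain ⟨C, hC, hxC⟩ := h2 (s, x) (hb (by
    rw [mem_ball_zero_iff]
    refine max_lt ?_ ?_
    · simpa [abs_of_pos s2.1] using s3
    · exact (hxr.trans_lt hr).trans_le (min_le_left _ _))) s2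
  have := hεk C hC x s hxC hx hxr s4 s5 s1 hgm hlt
  have hb1 : ‖x‖ ^ (ℓ : ℝ) ≤ |r| ^ (ℓ : ℝ) :=
    Real.rpow_le_rpow (norm_nonneg _) (hxr.trans (le_abs_self r)) (by exact_mod_cast hℓ.le)
  have hb2 : ε0 / (|r| ^ (ℓ : ℝ) + 1) * ‖x‖ ^ (ℓ : ℝ) ≤ ε0 := by
    rw [div_mul_eq_mul_div, div_le_iff₀ (by positivity)]
    gcongr; linarith
  have := hmin C hC
  linarith

end Geo

end

section
open Filter Topology
set_option linter.unusedSectionVars false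
set_option linter.style.haveILetI false
namespace Geo
open Cell Pu

variable {E : Type} [NormedAddCommGroup E] [InnerProductSpace ℝ E] [FiniteDimensional ℝ E]

/-- Scaled residual of `k` after projection off the span of `g` and `x`. -/
noncomputable def rs (k g x : E) : E :=
  (inner ℝ g g * inner ℝ x x - inner ℝ g x * inner ℝ g x : ℝ) • k
    - (inner ℝ x x * inner ℝ k g - inner ℝ g x * inner ℝ k x : ℝ) • g
    - (inner ℝ g g * inner ℝ k x - inner ℝ g x * inner ℝ k g : ℝ) • x

theorem rs_inner (k g x v : E) : inner ℝ (rs k g x) v =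
    (inner ℝ g g * inner ℝ x x - inner ℝ g x * inner ℝ g x : ℝ) * inner ℝ k v
    - (inner ℝ x x * inner ℝ k g - inner ℝ g x * inner ℝ k x : ℝ) * inner ℝ g v
    - (inner ℝ g g * inner ℝ k x - inner ℝ g x * inner ℝ k g : ℝ) * inner ℝ x v := by
  simp only [rs, inner_sub_left, inner_smul_left, RCLike.conj_to_real]

theorem rs_g (k g x : E) : inner ℝ (rs k g x) g = 0 := by
  simp only [rs, inner_sub_left, inner_smul_left, RCLike.conj_to_real, real_inner_comm g x]
  ring

theorem rs_x (k g x : E) : inner ℝ (rs k g x) x = 0 := by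
  simp only [rs, inner_sub_left, inner_smul_left, RCLike.conj_to_real]
  ring

/-- The residual for `k = ∇ gm`. -/
noncomputable def rf (f : E → ℝ) (x : E) : E := rs (gradient (gm f) x) (gradient f x) x

theorem rf_an {f : E → ℝ} {x : E} (hf : AnalyticAt ℝ f x) : AnalyticAt ℝ (rf f) x := by
  have hg := grad_an hf
  have hk := grad_an (gm_an hf)
  have hx : AnalyticAt ℝ (fun x : E => x) x := analyticAt_id
  exact (((((an_inner hg hg).mul (an_inner hx hx)).sub
    ((an_inner hg hx).mul (an_inner hg hx))).smul hk).sub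
    ((((an_inner hx hx).mul (an_inner hk hg)).sub
    ((an_inner hg hx).mul (an_inner hk hx))).smul hg)).sub
    ((((an_inner hg hg).mul (an_inner hk hx)).sub
    ((an_inner hg hx).mul (an_inner hk hg))).smul hx)

theorem gm_crit {f : E → ℝ} {x : E} (h : gm f x = 0) : gradient (gm f) x = 0 := by
  have : IsLocalMin (gm f) x := Eventually.of_forall fun y => by
    rw [h]; exact gm_nonneg f y
  simp [gradient, this.fderiv_eq_zero]

theorem rf_along {f : E → ℝ} {x v : E} (h : rf f x = 0) (hg : inner ℝ (gradient f x) v = 0)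
    (hx : inner ℝ x v = 0) : inner ℝ (gradient (gm f) x) v = 0 := by
  by_cases h0 : gm f x = 0
  · simp [gm_crit h0]
  have := congrArg (fun z => inner ℝ z v) h
  simp only [rf, rs, inner_sub_left, inner_smul_left, RCLike.conj_to_real, hg, hx, inner_zero_left,
    mul_zero, sub_zero] at this
  exact (mul_eq_zero.1 this).resolve_left h0

theorem lagr {f : E → ℝ} {x : E} (hf : AnalyticAt ℝ f x)
    (h : ∀ y, ‖y‖ = ‖x‖ → f y = f x → gm f x ≤ gm f y) : rf f x = 0 := by
  by_cases h0 : gm f x = 0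
  · simp [rf, rs, gm_crit h0]
  have hpos : 0 < gm f x := lt_of_le_of_ne (gm_nonneg f x) (Ne.symm h0)
  have hxx : AnalyticAt ℝ (fun x : E => (inner ℝ x x : ℝ)) x :=
    an_inner analyticAt_id analyticAt_id
  have hd : ∀ v, fderiv ℝ (fun x : E => (inner ℝ x x : ℝ)) x v = 2 * inner ℝ x v := by
    intro v
    have := (hasFDerivAt_id (𝕜 := ℝ) x).inner ℝ (hasFDerivAt_id x)
    have h2 := this.fderiv
    simp only [id] at h2
    rw [h2]
    simp [fderivInnerCLM_apply, real_inner_comm v x]; ring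
  have hext : IsLocalExtrOn (gm f) {y | (fun y => ((inner ℝ y y : ℝ), f y)) y =
      (fun y => ((inner ℝ y y : ℝ), f y)) x} x := by
    left
    filter_upwards [self_mem_nhdsWithin] with y hy
    simp only [Prod.mk.injEq, real_inner_self_eq_norm_sq] at hy
    exact h y ((sq_eq_sq₀ (norm_nonneg _) (norm_nonneg _)).1 hy.1) hy.2
  obtain ⟨Λ, Λ0, hne, hL⟩ := hext.exists_linear_map_of_hasStrictFDerivAt
    (hxx.hasStrictFDerivAt.prodMk hf.hasStrictFDerivAt) (gm_an hf).hasStrictFDerivAt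
  have hL' : ∀ v, Λ (1, 0) * (2 * inner ℝ x v) + Λ (0, 1) * inner ℝ (gradient f x) v
      + Λ0 * inner ℝ (gradient (gm f) x) v = 0 := by
    intro v
    have hv := hL v
    have : ∀ a b : ℝ, Λ (a, b) = Λ (1, 0) * a + Λ (0, 1) * b := by
      intro a b
      have : ((a, b) : ℝ × ℝ) = a • (1, 0) + b • (0, 1) := by simp
      rw [this, map_add, map_smul, map_smul]; simp; ring
    rw [ContinuousLinearMap.prod_apply, this, hd, smul_eq_mul] at hv
    rw [inner_grad, inner_grad]; exact hv
  have hxpos : 0 < inner ℝ x x := by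
    rw [real_inner_self_pos]
    rintro rfl
    simp [gm] at h0
  by_cases hΛ : Λ0 = 0
  · exfalso
    have a1 := hL' (pt f x)
    rw [real_inner_comm, pt_x, pt_g, hΛ] at a1
    simp only [mul_zero, zero_add, zero_mul, add_zero] at a1
    have a2 := (mul_eq_zero.1 a1).resolve_right h0
    have a3 := hL' x
    rw [a2, hΛ] at a3
    simp only [zero_mul, add_zero] at a3
    have a4 : Λ (1, 0) = 0 := (mul_eq_zero.1 a3).resolve_right (by positivity)
    apply hne
    rw [hΛ]
    refine Prod.ext ?_ rfl
    ext
    · simpa using a4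
    · simpa using a2
  · have b1 := hL' (rf f x)
    have b2 : inner ℝ (rf f x) (gradient f x) = 0 := rs_g _ _ _
    have b3 : inner ℝ (rf f x) x = 0 := rs_x _ _ _
    rw [real_inner_comm, b3, real_inner_comm, b2] at b1
    simp only [mul_zero, zero_add] at b1
    have b4 := (mul_eq_zero.1 b1).resolve_left hΛ
    have b5 : inner ℝ (rf f x) (rf f x) = 0 := by
      have b6 : ∀ v, inner ℝ (rf f x) v = _ := fun v => rs_inner _ _ _ v
      rw [b6, b4, real_inner_comm (rf f x) (gradient f x), b2, real_inner_comm (rf f x) x, b3]; ring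
    exact inner_self_eq_zero.1 b5

theorem pui_deriv {γ : ℝ → E} (h : Pui γ) : ∃ θ, 0 ≤ θ ∧ θ < 1 ∧ ∃ K > (0:ℝ), ∃ t0 > (0:ℝ),
    ∀ t ∈ Set.Ioo 0 t0, HasDerivAt γ (deriv γ t) t → ‖deriv γ t‖ * t ^ (θ : ℝ) ≤ K := by
  obtain ⟨Q, hQ, A, hA, hγ⟩ := h
  have hQ' : (0:ℝ) < Q := by exact_mod_cast hQ
  have h1 : ∀ᶠ s in 𝓝 (0:ℝ), AnalyticAt ℝ A s ∧ ‖deriv A s‖ < ‖deriv A 0‖ + 1 :=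
    hA.eventually_analyticAt.and
      (hA.deriv.continuousAt.norm.eventually (gt_mem_nhds (lt_add_one _)))
  obtain ⟨s0, hs0, hs⟩ := mem_nhdsGT_iff_exists_Ioo_subset.1 (hγ.and (nhdsWithin_le_nhds h1))
  have hs0' : (0:ℝ) < s0 := hs0
  refine ⟨1 - 1 / Q, ?_, by simp; omega, ‖deriv A 0‖ + 1, by positivity, s0 ^ Q, by positivity, ?_⟩
  · rw [sub_nonneg, div_le_one hQ']; exact_mod_cast hQ
  intro t ht hd
  set s := t ^ (1 / (Q:ℝ)) with hsdef
  have hst : s ^ Q = t := by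
    rw [hsdef, one_div]; exact Real.rpow_inv_natCast_pow ht.1.le (by omega)
  have hspos : 0 < s := Real.rpow_pos_of_pos ht.1 _
  have hss : s ∈ Set.Ioo 0 s0 := ⟨hspos, lt_of_pow_lt_pow_left₀ Q hs0'.le (by rw [hst]; exact ht.2)⟩
  have hθ : t ^ (1 - 1 / (Q:ℝ)) = s ^ (Q - 1) := by
    rw [hsdef, ← Real.rpow_natCast, ← Real.rpow_mul ht.1.le]
    congr 1
    rw [Nat.cast_sub hQ]; field_simp; simp
  have hd1 : HasDerivAt (fun s => γ (s ^ Q)) ((Q * s ^ (Q - 1)) • deriv γ t) s := by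
    rw [← hst] at hd ⊢
    exact hd.scomp s (hasDerivAt_pow Q s)
  have hd2 : HasDerivAt A (deriv A s) s := (hs hss).2.1.differentiableAt.hasDerivAt
  have hd3 := hd1.unique (hd2.congr_of_eventuallyEq (by
    filter_upwards [Ioo_mem_nhds hss.1 hss.2] with u hu using (hs hu).1))
  have hd4 := (hs hss).2.2
  rw [← hd3, norm_smul, Real.norm_of_nonneg (by positivity)] at hd4
  rw [hθ]
  have : (1:ℝ) ≤ Q := by exact_mod_cast hQ
  calc ‖deriv γ t‖ * s ^ (Q - 1) = 1 * s ^ (Q - 1) * ‖deriv γ t‖ := by ring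
    _ ≤ Q * s ^ (Q - 1) * ‖deriv γ t‖ := by gcongr
    _ ≤ _ := hd4.le

end Geo

end

section
open Filter Topology
set_option linter.unusedSectionVars false
set_option linter.style.haveILetI false
namespace Geo
open Cell Pu

variable {E : Type} [NormedAddCommGroup E] [InnerProductSpace ℝ E] [FiniteDimensional ℝ E]

/-- The Łojasiewicz estimate on a set. -/
def LJ (f : E → ℝ) (r c : ℝ) (s : Set E) : Prop :=
  ∃ κ > (0:ℝ), ∃ θ, 0 ≤ θ ∧ θ < 1 ∧ ∃ δ > (0:ℝ), ∀ x ∈ s, ‖x‖ = r → c < f x → f x < c + δ →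
    rf f x = 0 → κ * ((f x - c) ^ (θ:ℝ)) ^ 2 ≤ gm f x

theorem LJ.mono {f : E → ℝ} {r c : ℝ} {s t : Set E} (hst : s ⊆ t) (h : LJ f r c t) :
    LJ f r c s := by
  obtain ⟨κ, h1, θ, h2, h3, δ, h4, h5⟩ := h
  exact ⟨κ, h1, θ, h2, h3, δ, h4, fun x hx => h5 x (hst hx)⟩

theorem LJ.union {f : E → ℝ} {r c : ℝ} {s t : Set E} (h : LJ f r c s) (h' : LJ f r c t) :
    LJ f r c (s ∪ t) := by
  obtain ⟨κ, h1, θ, h2, h3, δ, h4, h5⟩ := h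
  obtain ⟨κ', h1', θ', h2', h3', δ', h4', h5'⟩ := h'
  refine ⟨min κ κ', lt_min h1 h1', max θ θ', le_max_of_le_left h2, max_lt h3 h3',
    min (min δ δ') 1, lt_min (lt_min h4 h4') one_pos, ?_⟩
  intro x hx hxr hc hcd hR
  have l0 : 0 < f x - c := by linarith
  have l1 : f x - c < min (min δ δ') 1 := by linarith
  have l2 : f x - c ≤ 1 := l1.le.trans (min_le_right _ _)
  have l3 : f x - c < δ := (l1.trans_le (min_le_left _ _)).trans_le (min_le_left _ _)
  have l4 : f x - c < δ' := (l1.trans_le (min_le_left _ _)).trans_le (min_le_right _ _)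
  rcases hx with hx | hx
  · refine le_trans ?_ (h5 x hx hxr hc (by linarith) hR)
    gcongr ?_ * ?_ ^ 2
    · exact min_le_left _ _
    · exact Real.rpow_le_rpow_of_exponent_ge l0 l2 (le_max_left _ _)
  · refine le_trans ?_ (h5' x hx hxr hc (by linarith) hR)
    gcongr ?_ * ?_ ^ 2
    · exact min_le_right _ _
    · exact Real.rpow_le_rpow_of_exponent_ge l0 l2 (le_max_right _ _)

theorem tr_an {F : Type} [NormedAddCommGroup F] [NormedSpace ℝ F] {f : E → F} {x : E}
    (hf : AnalyticAt ℝ f x) : AnalyticAt ℝ (fun z : ℝ × E => f (x + z.2)) 0 :=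
  AnalyticAt.fun_comp_of_eq hf (analyticAt_const.add analyticAt_snd) (by simp)

set_option maxHeartbeats 1000000 in
theorem locL {f : E → ℝ} {r : ℝ} (hr : 0 < r) {x0 : E} (hf : AnalyticAt ℝ f x0) :
    ∃ V ∈ 𝓝 x0, LJ f r (f x0) V := by
  set c := f x0 with hc
  have hxx : AnalyticAt ℝ (fun x : E => (inner ℝ x x : ℝ)) x0 :=
    an_inner analyticAt_id analyticAt_id
  have hrr : AnalyticAt ℝ (fun x : E => (inner ℝ (rf f x) (rf f x) : ℝ)) x0 :=
    an_inner (rf_an hf) (rf_an hf)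
  obtain ⟨δ, hδ, 𝒞, hfin, h1, V, hV, h2⟩ := cells (E := E)
    ![fun z => f (x0 + z.2) - c - z.1, fun z => inner ℝ (x0 + z.2) (x0 + z.2) - r ^ 2,
      fun z => inner ℝ (rf f (x0 + z.2)) (rf f (x0 + z.2))] (by
      intro i
      fin_cases i
      · exact ((tr_an hf).sub analyticAt_const).sub analyticAt_fst
      · exact (tr_an hxx).sub analyticAt_const
      · exact tr_an hrr)
    {z | AnalyticAt ℝ f (x0 + z.2)} (by
      have h : ∀ᶠ z in 𝓝 x0, AnalyticAt ℝ f z := hf.eventually_analyticAt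
      have h' : Tendsto (fun z : ℝ × E => x0 + z.2) (𝓝 0) (𝓝 x0) := by
        have : Continuous (fun z : ℝ × E => x0 + z.2) := by fun_prop
        simpa using this.tendsto 0
      exact h'.eventually h)
  -- each cell
  have key : ∀ C ∈ 𝒞, LJ f r c {x | (f x - c, x - x0) ∈ C} := by
    intro C hC
    obtain ⟨hG, hCU, hsign⟩ := h1 C hC
    by_cases hex : ∃ x, (f x - c, x - x0) ∈ C ∧ ‖x‖ = r ∧ rf f x = 0
    swap
    · refine ⟨1, one_pos, 0, le_rfl, one_pos, 1, one_pos, fun x k1 k2 _ _ k3 => ?_⟩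
      exact absurd ⟨x, k1, k2, k3⟩ hex
    obtain ⟨x, hxC, k1, k2⟩ := hex
    have e1 : ∀ z ∈ C, f (x0 + z.2) = c + z.1 := by
      intro z hz
      have h := hsign 0 _ hxC _ hz
      simp only [Matrix.cons_val_zero, add_sub_cancel, sub_self, sign_zero] at h
      have := sign_eq_zero_iff.1 h.symm
      linarith
    have e2 : ∀ z ∈ C, inner ℝ (x0 + z.2) (x0 + z.2) = r ^ 2 := by
      intro z hz
      have h := hsign 1 _ hxC _ hz
      simp only [Matrix.cons_val_one, Matrix.cons_val_zero, add_sub_cancel,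
        real_inner_self_eq_norm_sq, k1, sub_self, sign_zero] at h
      have := sign_eq_zero_iff.1 h.symm
      rw [real_inner_self_eq_norm_sq]
      linarith
    have e3 : ∀ z ∈ C, rf f (x0 + z.2) = 0 := by
      intro z hz
      have h := hsign 2 _ hxC _ hz
      simp only [Matrix.cons_val, add_sub_cancel, k2, inner_zero_left, sign_zero] at h
      exact inner_self_eq_zero.1 (sign_eq_zero_iff.1 h.symm)
    have eA : ∀ z ∈ C, AnalyticAt ℝ f (x0 + z.2) := fun z hz => hCU hz
    obtain ⟨γ, hP, hγ⟩ := Good.sec hG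
    have hfib : ∀ s x y, (s, x) ∈ C → (s, y) ∈ C → gm f (x0 + x) = gm f (x0 + y) := by
      intro s x y hx hy
      obtain ⟨σ, hσ, rfl, rfl, hσC⟩ := hG.P2 s x y hx hy
      have hσd : ∀ t, HasDerivAt (fun t => x0 + σ t) (deriv σ t) t := fun t =>
        ((hσ.differentiable one_ne_zero).differentiableAt (x := t)).hasDerivAt.const_add x0
      refine const_along (f := gm f) (σ := fun t => x0 + σ t) (contDiff_const.add hσ)
        (fun t => (gm_an (eA (s, σ t) (hσC t))).differentiableAt) (fun t => ?_) 0 1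
      rw [(hσd t).deriv]
      refine rf_along (x := x0 + σ t) (e3 (s, σ t) (hσC t)) ?_ ?_
      · have j1 := deriv_along (σ := fun t => x0 + σ t) (eA (s, σ t) (hσC t)).differentiableAt (hσd t)
        have j2 : (fun t => f (x0 + σ t)) = fun _ => c + s := funext fun t => e1 (s, σ t) (hσC t)
        rw [j2] at j1
        exact j1.unique (hasDerivAt_const t _)
      · have := inner_deriv (hσd t)
          (hasDerivAt_const t (r ^ 2)) (Eventually.of_forall fun t' => e2 (s, σ t') (hσC t'))
        linarith
    obtain ⟨θ, hθ0, hθ1, K, hK, t0, ht0, hKb⟩ := pui_deriv hP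
    refine ⟨r ^ 2 / K ^ 2, by positivity, θ, hθ0, hθ1, min t0 δ, lt_min ht0 hδ, ?_⟩
    intro x' l1 l2 l3 l4 _
    set t := f x' - c with ht
    have htp : 0 < t := by linarith
    have htt : t ∈ Set.Ioo 0 t0 := ⟨htp, by have := min_le_left t0 δ; linarith⟩
    have htd : t ∈ Set.Ioo 0 δ := ⟨htp, by have := min_le_right t0 δ; linarith⟩
    have m1 := hfib t _ _ l1 (hγ t htd).2
    rw [add_sub_cancel] at m1
    rw [m1]
    have m2 := hKb t htt (hγ t htd).1
    set y := x0 + γ t with hy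
    have hyd : ∀ t ∈ Set.Ioo 0 δ, HasDerivAt (fun t => x0 + γ t) (deriv γ t) t := fun t ht =>
      (hγ t ht).1.const_add x0
    have m3 : inner ℝ (gradient f y) (deriv γ t) = 1 := by
      have j1 := deriv_along (σ := fun t => x0 + γ t) (eA (t, γ t) (hγ t htd).2).differentiableAt (hyd t htd)
      have j2 : HasDerivAt (fun t => f (x0 + γ t)) 1 t := by
        refine ((hasDerivAt_id t).const_add c).congr_of_eventuallyEq ?_
        filter_upwards [Ioo_mem_nhds htd.1 htd.2] with u hu using e1 (u, γ u) (hγ u hu).2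
      exact j1.unique j2
    have m4 : inner ℝ y (deriv γ t) = 0 := by
      have := inner_deriv (hyd t htd) (hasDerivAt_const t (r ^ 2)) (by
        filter_upwards [Ioo_mem_nhds htd.1 htd.2] with u hu using e2 (u, γ u) (hγ u hu).2)
      linarith
    have m5 : inner ℝ y y = r ^ 2 := e2 (t, γ t) (hγ t htd).2
    have m6 : inner ℝ (pt f y) (deriv γ t) = r ^ 2 := by
      simp only [pt, inner_sub_left, inner_smul_left, RCLike.conj_to_real, m3, m4, m5]; ring
    have m7 := real_inner_mul_inner_self_le (pt f y) (deriv γ t)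
    rw [m6, pt_sq, m5, real_inner_self_eq_norm_sq] at m7
    have m8 : r ^ 2 ≤ gm f y * ‖deriv γ t‖ ^ 2 := by
      have : 0 < r ^ 2 := by positivity
      nlinarith
    have hg0 := gm_nonneg f y
    have ht' : 0 ≤ t ^ (θ:ℝ) := Real.rpow_nonneg htp.le _
    rw [div_mul_eq_mul_div, div_le_iff₀ (by positivity)]
    calc r ^ 2 * (t ^ (θ:ℝ)) ^ 2 ≤ (gm f y * ‖deriv γ t‖ ^ 2) * (t ^ (θ:ℝ)) ^ 2 := by gcongr
      _ = gm f y * (‖deriv γ t‖ * t ^ (θ:ℝ)) ^ 2 := by ring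
      _ ≤ gm f y * K ^ 2 := by gcongr
  have hU : LJ f r c (⋃ C ∈ 𝒞, {x | (f x - c, x - x0) ∈ C}) := by
    clear h2 h1
    induction 𝒞, hfin using Set.Finite.induction_on with
    | empty =>
      simp only [Set.mem_empty_iff_false, Set.iUnion_of_empty, Set.iUnion_empty]
      exact ⟨1, one_pos, 0, le_rfl, one_pos, 1, one_pos, fun x hx => hx.elim⟩
    | insert _ _ ih =>
      rw [Set.biUnion_insert]
      exact (key _ (Set.mem_insert _ _)).union (ih fun C hC => key C (Set.mem_insert_of_mem _ hC))
  obtain ⟨κ, u1, θ, u2, u3, δ', u4, u5⟩ := hU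
  refine ⟨{x | (f x - c, x - x0) ∈ V}, ?_, κ, u1, θ, u2, u3, min δ' δ, lt_min u4 hδ, ?_⟩
  · have h' : Tendsto (fun x : E => (f x - c, x - x0)) (𝓝 x0) (𝓝 0) := by
      have : ContinuousAt (fun x : E => (f x - c, x - x0)) x0 := by
        have := hf.continuousAt
        fun_prop
      have h3 : (f x0 - c, x0 - x0) = (0 : ℝ × E) := by simp [hc]
      have h4 := this.tendsto
      rwa [h3] at h4
    exact h' hV
  · intro x hx hxr hcx hcd hR
    obtain ⟨C, hC, hxC⟩ := h2 _ hx ⟨by simpa using hcx, by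
      have := min_le_right δ' δ; simp only; linarith⟩
    exact u5 x (Set.mem_biUnion hC hxC) hxr hcx (by have := min_le_left δ' δ; linarith) hR

theorem partL {f : E → ℝ} {r : ℝ} (hr : 0 < r) (hf : ∀ x, ‖x‖ = r → AnalyticAt ℝ f x) (c : ℝ) :
    ∃ κ > (0:ℝ), ∃ θ, 0 ≤ θ ∧ θ < 1 ∧ ∃ δ > (0:ℝ), ∀ x, ‖x‖ = r → c < f x → f x < c + δ →
      κ * ((f x - c) ^ (θ:ℝ)) ^ 2 ≤ gm f x := by
  have hS : IsCompact (Metric.sphere (0:E) r) := isCompact_sphere 0 r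
  have hLJ : LJ f r c (Metric.sphere (0:E) r) := by
    refine hS.induction_on (p := LJ f r c) ?_ (fun s t h h' => h'.mono h) (fun s t h h' => h.union h') ?_
    · exact ⟨1, one_pos, 0, le_rfl, one_pos, 1, one_pos, fun x hx => hx.elim⟩
    · intro x hx
      rw [mem_sphere_zero_iff_norm] at hx
      by_cases h : f x = c
      · obtain ⟨V, hV, hVL⟩ := locL hr (hf x hx)
        rw [h] at hVL
        exact ⟨V, mem_nhdsWithin_of_mem_nhds hV, hVL⟩
      · have hpos : 0 < |f x - c| := abs_pos.2 (sub_ne_zero.2 h)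
        refine ⟨{y | |f x - c| / 2 < |f y - c|}, mem_nhdsWithin_of_mem_nhds ?_, 1, one_pos, 0,
          le_rfl, one_pos, |f x - c| / 2, by positivity, ?_⟩
        · have : ContinuousAt (fun y => |f y - c|) x := by
            have := (hf x hx).continuousAt
            fun_prop
          exact this.eventually (lt_mem_nhds (by linarith))
        · intro y hy _ h1 h2 _
          have hy' : |f x - c| / 2 < |f y - c| := hy
          rw [abs_of_pos (a := f y - c) (by linarith)] at hy'
          linarith
  obtain ⟨κ, u1, θ, u2, u3, δ, u4, u5⟩ := hLJ
  refine ⟨κ, u1, θ, u2, u3, δ, u4, fun x hxr hcx hcd => ?_⟩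
  have hfc : ContinuousOn f (Metric.sphere (0:E) r) := fun y hy =>
    (hf y (mem_sphere_zero_iff_norm.1 hy)).continuousAt.continuousWithinAt
  have hN : IsCompact (Metric.sphere (0:E) r ∩ f ⁻¹' {f x}) :=
    hS.of_isClosed_subset (hfc.preimage_isClosed_of_isClosed Metric.isClosed_sphere
      isClosed_singleton) Set.inter_subset_left
  obtain ⟨y, hy, hmin⟩ := hN.exists_isMinOn ⟨x, mem_sphere_zero_iff_norm.2 hxr, rfl⟩
    (f := gm f) (fun y hy => (gm_an (hf y (mem_sphere_zero_iff_norm.1 hy.1))).continuousAt.continuousWithinAt)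
  have hyr := mem_sphere_zero_iff_norm.1 hy.1
  have hyf : f y = f x := hy.2
  have hR : rf f y = 0 := lagr (hf y hyr) fun z hz hzf =>
    hmin ⟨mem_sphere_zero_iff_norm.2 (hz.trans hyr), hzf.trans hyf⟩
  have := u5 y hy.1 hyr (by rw [hyf]; exact hcx) (by rw [hyf]; exact hcd) hR
  rw [hyf] at this
  exact this.trans (hmin ⟨mem_sphere_zero_iff_norm.2 hxr, rfl⟩)

end Geo

end

section
open Filter Topology
set_option linter.unusedSectionVars false
set_option linter.style.haveILetI false
namespace Hom

/-- clamp functions -/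
noncomputable def cl (k : ℕ) (s : unitInterval) : unitInterval :=
  Set.projIcc 0 1 zero_le_one (((k:ℝ) + 1) * (k + 2) * s - k * (k + 2))

theorem cl_cont (k : ℕ) : Continuous (cl k) := by
  unfold cl
  exact continuous_projIcc.comp (by fun_prop)

theorem cl_zero {k : ℕ} {s : unitInterval} (h : ((k:ℝ) + 1) * s ≤ k) : cl k s = 0 := by
  refine Set.projIcc_of_le_left _ ?_
  have : (0:ℝ) ≤ k + 2 := by positivity
  nlinarith

theorem cl_one {k : ℕ} {s : unitInterval} (h : (k:ℝ) + 1 ≤ (k + 2) * s) : cl k s = 1 := by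
  refine Set.projIcc_of_right_le _ ?_
  have : (0:ℝ) ≤ k + 1 := by positivity
  nlinarith

/-- stages -/
noncomputable def stg {X : Type} (Φ : unitInterval × X → X) : ℕ → unitInterval × X → X
  | 0, z => z.2
  | k + 1, z => Φ (cl k z.1, stg Φ k z)

theorem stg_cont {X : Type} [TopologicalSpace X] {Φ : unitInterval × X → X} (hΦ : Continuous Φ)
    (k : ℕ) : Continuous (stg Φ k) := by
  induction k with
  | zero => exact continuous_snd
  | succ k ih => exact hΦ.comp (((cl_cont k).comp continuous_fst).prodMk ih)

theorem caristi {X : Type} [MetricSpace X] [CompactSpace X] (Φ : unitInterval × X → X)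
    (hΦ : Continuous Φ) (h0 : ∀ x, Φ (0, x) = x) (w : X → ℝ) (hw : Continuous w)
    (hw0 : ∀ x, 0 ≤ w x) (hd : ∀ l x, dist x (Φ (l, x)) ≤ w x - w (Φ (l, x)))
    (h1 : ∀ x, 0 < w x → w (Φ (1, x)) < w x) :
    Nonempty (ContinuousMap.HomotopyEquiv {x // w x = 0} X) := by
  have hmono : ∀ l x, w (Φ (l, x)) ≤ w x := fun l x => by
    have := hd l x; have := dist_nonneg (x := x) (y := Φ (l, x)); linarith
  set g : X → X := fun x => Φ (1, x) with hg
  have hgc : Continuous g := hΦ.comp (by fun_prop)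
  have hit : ∀ k x, w (g^[k + 1] x) ≤ w (g^[k] x) := fun k x => by
    rw [Function.iterate_succ_apply']; exact hmono 1 _
  have hanti : ∀ x, Antitone fun k => w (g^[k] x) := fun x => antitone_nat_of_succ_le (hit · x)
  -- uniform convergence
  have huni : ∀ ε > 0, ∃ N, ∀ k ≥ N, ∀ x, w (g^[k] x) < ε := by
    intro ε hε
    obtain ⟨M, hM⟩ : ∃ M, ∀ x, w x ≤ M := by
      obtain ⟨M, hM⟩ := (isCompact_range hw).bddAbove
      exact ⟨M, fun x => hM ⟨x, rfl⟩⟩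
    obtain ⟨m, hm, hmb⟩ : ∃ m > 0, ∀ x, ε ≤ w x → m ≤ w x - w (g x) := by
      have hc : IsCompact {x | ε ≤ w x} := (isClosed_le continuous_const hw).isCompact
      by_cases hne : {x | ε ≤ w x}.Nonempty
      · obtain ⟨y, hy, hmin⟩ := hc.exists_isMinOn hne (f := fun x => w x - w (g x))
          (hw.sub (hw.comp hgc)).continuousOn
        exact ⟨w y - w (g y), sub_pos.2 (h1 y (hε.trans_le hy)), fun x hx => hmin hx⟩
      · exact ⟨1, one_pos, fun x hx => absurd ⟨x, hx⟩ hne⟩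
    obtain ⟨N, hN⟩ := exists_nat_gt (M / m)
    refine ⟨N, fun k hk x => lt_of_le_of_lt (hanti x hk) ?_⟩
    by_contra! hcon
    have : ∀ j ≤ N, w (g^[j] x) ≤ M - j * m := by
      intro j
      induction j with
      | zero => intro _; simpa using hM x
      | succ j ih =>
        intro hj
        have a1 := ih (by omega)
        have a2 := hmb (g^[j] x) (hcon.trans (hanti x (by omega)))
        rw [← Function.iterate_succ_apply' g] at a2
        push_cast; linarith
    have := this N le_rfl
    rw [div_lt_iff₀ hm] at hN
    have := hw0 (g^[N] x)
    linarith
  have hF := stg_cont hΦ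
  have hstep : ∀ k z, dist (stg Φ k z) (stg Φ (k + 1) z) ≤ w (stg Φ k z) - w (stg Φ (k + 1) z) :=
    fun k z => hd _ _
  have htel : ∀ z k j, dist (stg Φ k z) (stg Φ (k + j) z) ≤
      w (stg Φ k z) - w (stg Φ (k + j) z) := by
    intro z k j
    induction j with
    | zero => simp
    | succ j ih =>
      have := hstep (k + j) z
      have := dist_triangle (stg Φ k z) (stg Φ (k + j) z) (stg Φ (k + (j + 1)) z)
      rw [← add_assoc] at this ⊢
      linarith
  have hfull : ∀ (s : unitInterval) (k : ℕ) x, (k:ℝ) ≤ (k + 1) * s → stg Φ k (s, x) = g^[k] x := by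
    intro s k x
    induction k with
    | zero => intro _; rfl
    | succ k ih =>
      intro hk
      push_cast at hk
      have hs1 : (s:ℝ) ≤ 1 := s.2.2
      rw [Function.iterate_succ_apply', ← ih (by nlinarith [s.2.1]), stg]
      rw [cl_one (by linarith)]
  have hzero : ∀ (s : unitInterval) (k : ℕ) x, ((k:ℝ) + 1) * (s:ℝ) ≤ k → ∀ j : ℕ,
      stg Φ (k + j) (s, x) = stg Φ k (s, x) := by
    intro s k x hk j
    induction j with
    | zero => rfl
    | succ j ih =>
      rw [← add_assoc, stg, cl_zero, h0, ih]
      push_cast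
      have : (s:ℝ) ≤ 1 := s.2.2
      nlinarith
  have hunif : ∀ ε > 0, ∃ N, ∀ k ≥ N, ∀ j z, dist (stg Φ k z) (stg Φ (k + j) z) < ε := by
    intro ε hε
    obtain ⟨N, hN⟩ := huni ε hε
    refine ⟨N, fun k hk j z => ?_⟩
    obtain ⟨s, x⟩ := z
    rcases le_total (((k:ℝ) + 1) * (s:ℝ)) k with h | h
    · rw [hzero s k x h j, dist_self]; exact hε
    · refine lt_of_le_of_lt (htel (s, x) k j) ?_
      have := hw0 (stg Φ (k + j) (s, x))
      rw [hfull s k x h]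
      have := hN k hk x
      linarith
  have hcau : ∀ z, CauchySeq fun k => stg Φ k z := by
    intro z
    rw [Metric.cauchySeq_iff']
    intro ε hε
    obtain ⟨N, hN⟩ := hunif ε hε
    refine ⟨N, fun k hk => ?_⟩
    obtain ⟨j, rfl⟩ := Nat.exists_eq_add_of_le hk
    rw [dist_comm]; exact hN N le_rfl j z
  choose L hL using fun z => cauchySeq_tendsto_of_complete (hcau z)
  have hLc : Continuous L := by
    refine TendstoUniformly.continuous (F := fun k z => stg Φ k z) (p := atTop) ?_
      (Eventually.of_forall hF).frequently
    rw [Metric.tendstoUniformly_iff]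
    intro ε hε
    obtain ⟨N, hN⟩ := hunif (ε / 2) (half_pos hε)
    filter_upwards [eventually_ge_atTop N] with k hk z
    have : dist (stg Φ k z) (L z) ≤ ε / 2 := by
      refine le_of_tendsto (tendsto_const_nhds.dist ((hL z).comp (tendsto_add_atTop_nat k))) ?_
      refine Eventually.of_forall fun j => ?_
      simp only [Function.comp_apply]
      rw [add_comm]; exact (hN k hk j z).le
    rw [dist_comm]; linarith
  have hL0 : ∀ x, L (0, x) = x := by
    intro x
    refine tendsto_nhds_unique (hL (0, x)) ?_
    refine tendsto_const_nhds.congr fun k => ?_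
    have := hzero 0 0 x (by simp) k
    rw [zero_add] at this
    exact this.symm
  have hL1 : ∀ x, w (L (1, x)) = 0 := by
    intro x
    refine tendsto_nhds_unique ((hw.tendsto _).comp (hL (1, x))) ?_
    rw [Metric.tendsto_atTop]
    intro ε hε
    obtain ⟨N, hN⟩ := huni ε hε
    refine ⟨N, fun k hk => ?_⟩
    simp only [Function.comp_apply]
    rw [hfull 1 k x (by simp), Real.dist_eq, sub_zero, abs_of_nonneg (hw0 _)]
    exact hN k hk x
  have hLfix : ∀ s x, w x = 0 → L (s, x) = x := by
    intro s x hx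
    have hfix : ∀ l, Φ (l, x) = x := by
      intro l
      have a1 := hd l x
      have a2 := hw0 (Φ (l, x))
      rw [hx] at a1
      exact (dist_le_zero.1 (by linarith)).symm
    refine tendsto_nhds_unique (hL (s, x)) ?_
    refine tendsto_const_nhds.congr fun k => ?_
    induction k with
    | zero => rfl
    | succ k ih => rw [stg, ← ih, hfix]
  let inc : C({x // w x = 0}, X) := ⟨Subtype.val, continuous_subtype_val⟩
  let ret : C(X, {x // w x = 0}) := ⟨fun x => ⟨L (1, x), hL1 x⟩, by fun_prop⟩
  have hri : ret.comp inc = ContinuousMap.id _ :=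
    ContinuousMap.ext fun x => Subtype.ext (hLfix 1 x.1 x.2)
  refine ⟨⟨inc, ret, ?_, ?_⟩⟩
  · rw [hri]
  · refine ContinuousMap.Homotopic.symm ⟨⟨⟨L, hLc⟩, ?_, ?_⟩⟩
    · intro x; exact hL0 x
    · intro x; rfl

/-- Set version. -/
theorem caristi_set {E : Type} [NormedAddCommGroup E] (K Z : Set E) (hK : IsCompact K)
    (Φ : ℝ × E → E) (hΦ : ContinuousOn Φ (Set.Icc 0 1 ×ˢ K))
    (hmap : ∀ l ∈ Set.Icc (0:ℝ) 1, ∀ x ∈ K, Φ (l, x) ∈ K) (h0 : ∀ x ∈ K, Φ (0, x) = x)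
    (w : E → ℝ) (hw : ContinuousOn w K) (hw0 : ∀ x ∈ K, 0 ≤ w x)
    (hd : ∀ l ∈ Set.Icc (0:ℝ) 1, ∀ x ∈ K, ‖Φ (l, x) - x‖ ≤ w x - w (Φ (l, x)))
    (h1 : ∀ x ∈ K, 0 < w x → w (Φ (1, x)) < w x) (hZ : ∀ x, x ∈ Z ↔ x ∈ K ∧ w x = 0) :
    Nonempty (ContinuousMap.HomotopyEquiv Z K) := by
  haveI : CompactSpace K := isCompact_iff_compactSpace.1 hK
  obtain ⟨e⟩ := caristi (X := K) (fun z => ⟨Φ (z.1, z.2), hmap z.1 z.1.2 z.2 z.2.2⟩)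
    (by
      refine Continuous.subtype_mk ?_ _
      exact hΦ.comp_continuous (f := fun z : unitInterval × K => ((z.1 : ℝ), (z.2 : E)))
        (by fun_prop) (fun z => ⟨z.1.2, z.2.2⟩))
    (fun x => Subtype.ext (h0 x x.2)) (fun x => w x) hw.domRestrict (fun x => hw0 x x.2)
    (fun l x => by
      rw [dist_comm, Subtype.dist_eq, dist_eq_norm]
      exact hd l l.2 x x.2) (fun x hx => h1 x x.2 hx)
  refine ⟨(Homeomorph.toHomotopyEquiv ?_).trans e⟩
  exact
    { toFun := fun z => ⟨⟨z, ((hZ z).1 z.2).1⟩, ((hZ z).1 z.2).2⟩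
      invFun := fun z => ⟨z.1.1, (hZ _).2 ⟨z.1.2, z.2⟩⟩
      left_inv := fun z => rfl
      right_inv := fun z => rfl
      continuous_toFun := by fun_prop
      continuous_invFun := by fun_prop }

end Hom

end

section
open Filter Topology
set_option linter.unusedSectionVars false
set_option linter.style.haveILetI false
namespace Hom

variable {E : Type} [NormedAddCommGroup E] [InnerProductSpace ℝ E] [FiniteDimensional ℝ E]

theorem strictAlong {φ : E → ℝ} {φ' : E →L[ℝ] ℝ} {x0 : E} (h : HasStrictFDerivAt φ φ' x0)
    {v : E → E} {W : Set E} (hv : ContinuousWithinAt v W x0) {ε : ℝ} (hε : 0 < ε) :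
    ∀ᶠ z : ℝ × E in 𝓝[≥] 0 ×ˢ 𝓝[W] x0,
      |φ (z.2 + z.1 • v z.2) - φ z.2 - z.1 * φ' (v x0)| ≤ ε * z.1 := by
  set N := ‖v x0‖ + 1 with hN
  have hNp : 0 < N := by positivity
  have h1 := h.isLittleO.def (c := ε / (2 * N)) (by positivity)
  have hvt : Tendsto (fun z : ℝ × E => v z.2) (𝓝[≥] 0 ×ˢ 𝓝[W] x0) (𝓝 (v x0)) :=
    hv.tendsto.comp tendsto_snd
  have hst : Tendsto (fun z : ℝ × E => z.1) (𝓝[≥] 0 ×ˢ 𝓝[W] x0) (𝓝 0) :=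
    (tendsto_nhdsWithin_of_tendsto_nhds tendsto_id).comp tendsto_fst
  have hxt : Tendsto (fun z : ℝ × E => z.2) (𝓝[≥] 0 ×ˢ 𝓝[W] x0) (𝓝 x0) :=
    (tendsto_nhdsWithin_of_tendsto_nhds tendsto_id).comp tendsto_snd
  have hp : Tendsto (fun z : ℝ × E => (z.2 + z.1 • v z.2, z.2)) (𝓝[≥] 0 ×ˢ 𝓝[W] x0)
      (𝓝 (x0, x0)) := by
    refine Tendsto.prodMk_nhds ?_ hxt
    simpa using hxt.add (hst.smul hvt)
  have h2 := hp.eventually h1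
  have h3 : ∀ᶠ z : ℝ × E in 𝓝[≥] 0 ×ˢ 𝓝[W] x0, ‖v z.2‖ < N :=
    hvt.norm.eventually (gt_mem_nhds (lt_add_one _))
  have h4 : ∀ᶠ z : ℝ × E in 𝓝[≥] 0 ×ˢ 𝓝[W] x0, |φ' (v z.2) - φ' (v x0)| < ε / 2 := by
    have : Tendsto (fun z : ℝ × E => |φ' (v z.2) - φ' (v x0)|) (𝓝[≥] 0 ×ˢ 𝓝[W] x0) (𝓝 0) := by
      have := ((φ'.continuous.tendsto _).comp hvt).sub_const (φ' (v x0))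
      simpa using this.abs
    exact this.eventually (gt_mem_nhds (by positivity))
  have h5 : ∀ᶠ z : ℝ × E in 𝓝[≥] 0 ×ˢ 𝓝[W] x0, 0 ≤ z.1 :=
    tendsto_fst.eventually self_mem_nhdsWithin
  filter_upwards [h2, h3, h4, h5] with z k2 k3 k4 k5
  simp only [add_sub_cancel_left, map_smul, smul_eq_mul, norm_smul, Real.norm_eq_abs,
    abs_of_nonneg k5] at k2
  have e1 : φ (z.2 + z.1 • v z.2) - φ z.2 - z.1 * φ' (v x0) =
    (φ (z.2 + z.1 • v z.2) - φ z.2 - z.1 * φ' (v z.2)) + z.1 * (φ' (v z.2) - φ' (v x0)) := by ring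
  rw [e1]
  refine (abs_add_le _ _).trans ?_
  rw [abs_mul, abs_of_nonneg k5]
  have e2 : ε / (2 * N) * (z.1 * ‖v z.2‖) ≤ ε / (2 * N) * (z.1 * N) := by gcongr
  have e3 : ε / (2 * N) * (z.1 * N) = ε / 2 * z.1 := by field_simp
  have e4 : z.1 * |φ' (v z.2) - φ' (v x0)| ≤ z.1 * (ε / 2) := by gcongr
  linarith

theorem betaAlong {φ : E → ℝ} {φ' : E →L[ℝ] ℝ} {x0 : E} (h : HasStrictFDerivAt φ φ' x0)
    {v : E → E} {W : Set E} (hv : ContinuousWithinAt v W x0) (hW : ∀ x ∈ W, φ x ≤ 0)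
    (h0 : φ x0 ≤ 0) (hb : φ x0 = 0 → φ' (v x0) < 0) :
    ∀ᶠ z : ℝ × E in 𝓝[≥] 0 ×ˢ 𝓝[W] x0, φ (z.2 + z.1 • v z.2) ≤ 0 := by
  have hvt : Tendsto (fun z : ℝ × E => v z.2) (𝓝[≥] 0 ×ˢ 𝓝[W] x0) (𝓝 (v x0)) :=
    hv.tendsto.comp tendsto_snd
  have hst : Tendsto (fun z : ℝ × E => z.1) (𝓝[≥] 0 ×ˢ 𝓝[W] x0) (𝓝 0) :=
    (tendsto_nhdsWithin_of_tendsto_nhds tendsto_id).comp tendsto_fst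
  have hxt : Tendsto (fun z : ℝ × E => z.2) (𝓝[≥] 0 ×ˢ 𝓝[W] x0) (𝓝 x0) :=
    (tendsto_nhdsWithin_of_tendsto_nhds tendsto_id).comp tendsto_snd
  rcases h0.lt_or_eq with h0 | h0
  · have : Tendsto (fun z : ℝ × E => φ (z.2 + z.1 • v z.2)) (𝓝[≥] 0 ×ˢ 𝓝[W] x0) (𝓝 (φ x0)) := by
      refine h.continuousAt.tendsto.comp ?_
      simpa using hxt.add (hst.smul hvt)
    filter_upwards [this.eventually (gt_mem_nhds h0)] with z hz using hz.le
  · have hneg := hb h0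
    have h5 : ∀ᶠ z : ℝ × E in 𝓝[≥] 0 ×ˢ 𝓝[W] x0, 0 ≤ z.1 :=
      tendsto_fst.eventually self_mem_nhdsWithin
    have h6 : ∀ᶠ z : ℝ × E in 𝓝[≥] 0 ×ˢ 𝓝[W] x0, z.2 ∈ W :=
      tendsto_snd.eventually self_mem_nhdsWithin
    filter_upwards [strictAlong h hv (ε := -φ' (v x0)) (by linarith), h5, h6] with z k1 k2 k3
    have := (abs_le.1 k1).2
    have := hW _ k3
    linarith

/-- The good region for the flow lemma. -/
def FP (W : Set E) (α β₁ β₂ : E → ℝ) (v : E → E) (t : Set E) : Prop :=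
  ∃ m > (0:ℝ), ∃ C > (0:ℝ), ∃ s1 > (0:ℝ), ∀ x ∈ t, x ∈ W → ∀ s, 0 ≤ s → s ≤ s1 →
    m * s ≤ α (x + s • v x) - α x ∧ α (x + s • v x) - α x ≤ C * s ∧ ‖v x‖ ≤ C ∧
    β₁ (x + s • v x) ≤ 0 ∧ β₂ (x + s • v x) ≤ 0

theorem flow (W Z : Set E) (hWc : IsCompact W) (α β₁ β₂ : E → ℝ)
    (hW : ∀ x, x ∈ W ↔ α x ≤ 0 ∧ β₁ x ≤ 0 ∧ β₂ x ≤ 0) (hZ : ∀ x, x ∈ Z ↔ x ∈ W ∧ α x = 0)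
    (α' β₁' β₂' : E → E →L[ℝ] ℝ) (hα : ∀ x ∈ W, HasStrictFDerivAt α (α' x) x)
    (hβ₁ : ∀ x ∈ W, HasStrictFDerivAt β₁ (β₁' x) x)
    (hβ₂ : ∀ x ∈ W, HasStrictFDerivAt β₂ (β₂' x) x)
    (v : E → E) (hv : ContinuousOn v W) (hαv : ∀ x ∈ W, 0 < α' x (v x))
    (hβ₁v : ∀ x ∈ W, β₁ x = 0 → β₁' x (v x) < 0) (hβ₂v : ∀ x ∈ W, β₂ x = 0 → β₂' x (v x) < 0) :
    Nonempty (ContinuousMap.HomotopyEquiv Z W) := by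
  have hFP : FP W α β₁ β₂ v W := by
    refine hWc.induction_on (p := FP W α β₁ β₂ v) ?_ ?_ ?_ ?_
    · exact ⟨1, one_pos, 1, one_pos, 1, one_pos, fun x hx => hx.elim⟩
    · rintro s t hst ⟨m, hm, C, hC, s1, hs1, h⟩
      exact ⟨m, hm, C, hC, s1, hs1, fun x hx => h x (hst hx)⟩
    · rintro s t ⟨m, hm, C, hC, s1, hs1, h⟩ ⟨m', hm', C', hC', s1', hs1', h'⟩
      refine ⟨min m m', lt_min hm hm', max C C', lt_max_of_lt_left hC, min s1 s1',
        lt_min hs1 hs1', ?_⟩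
      rintro x (hx | hx) hxW u hu hu1
      · obtain ⟨k1, k2, k3, k4⟩ := h x hx hxW u hu (hu1.trans (min_le_left _ _))
        refine ⟨le_trans (by gcongr; exact min_le_left _ _) k1,
          k2.trans (by gcongr; exact le_max_left _ _), k3.trans (le_max_left _ _), k4⟩
      · obtain ⟨k1, k2, k3, k4⟩ := h' x hx hxW u hu (hu1.trans (min_le_right _ _))
        refine ⟨le_trans (by gcongr; exact min_le_right _ _) k1,
          k2.trans (by gcongr; exact le_max_right _ _), k3.trans (le_max_right _ _), k4⟩
    · intro x0 hx0
      set d := α' x0 (v x0) with hd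
      have hdp : 0 < d := hαv x0 hx0
      have hvt : Tendsto (fun z : ℝ × E => v z.2) (𝓝[≥] 0 ×ˢ 𝓝[W] x0) (𝓝 (v x0)) :=
        (hv x0 hx0).tendsto.comp tendsto_snd
      have hev := (((strictAlong (hα x0 hx0) (hv x0 hx0) (half_pos hdp)).and
        (hvt.norm.eventually (gt_mem_nhds (lt_add_one _)))).and
        (betaAlong (hβ₁ x0 hx0) (hv x0 hx0) (fun x hx => ((hW x).1 hx).2.1)
          ((hW x0).1 hx0).2.1 (hβ₁v x0 hx0))).and
        (betaAlong (hβ₂ x0 hx0) (hv x0 hx0) (fun x hx => ((hW x).1 hx).2.2)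
          ((hW x0).1 hx0).2.2 (hβ₂v x0 hx0))
      obtain ⟨pa, hpa, pb, hpb, hab⟩ := eventually_prod_iff.1 hev
      obtain ⟨s1, hs1, hs⟩ := mem_nhdsGE_iff_exists_Icc_subset.1 hpa
      refine ⟨{x | pb x}, hpb, d / 2, half_pos hdp, max (2 * d) (‖v x0‖ + 1),
        lt_max_of_lt_left (by positivity), s1, hs1, ?_⟩
      intro x hx hxW u hu hu1
      obtain ⟨⟨⟨k1, k2⟩, k3⟩, k4⟩ := hab (hs ⟨hu, hu1⟩) hx
      have k1' := abs_le.1 k1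
      simp only at k1' k2 k3 k4
      refine ⟨by linarith [k1'.1], ?_, k2.le.trans (le_max_right _ _), k3, k4⟩
      have : 2 * d * u ≤ max (2 * d) (‖v x0‖ + 1) * u := by gcongr; exact le_max_left _ _
      have := mul_nonneg hdp.le hu
      linarith [k1'.2]
  obtain ⟨m, hm, C, hC, s1, hs1, h⟩ := hFP
  have hαc : ContinuousOn α W := fun x hx => (hα x hx).continuousAt.continuousWithinAt
  let τ : E → ℝ := fun x => min s1 (-α x / C)
  have hτc : ContinuousOn τ W := continuousOn_const.inf (hαc.neg.div_const C)
  have hτ0 : ∀ x ∈ W, 0 ≤ τ x := fun x hx =>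
    le_min hs1.le (div_nonneg (by linarith [((hW x).1 hx).1]) hC.le)
  have hu : ∀ l ∈ Set.Icc (0:ℝ) 1, ∀ x ∈ W, 0 ≤ l * τ x ∧ l * τ x ≤ s1 ∧ C * (l * τ x) ≤ -α x := by
    intro l hl x hx
    have h1 : l * τ x ≤ τ x := mul_le_of_le_one_left (hτ0 x hx) hl.2
    refine ⟨mul_nonneg hl.1 (hτ0 x hx), h1.trans (min_le_left _ _), ?_⟩
    have h2 : l * τ x ≤ -α x / C := h1.trans (min_le_right _ _)
    rw [le_div_iff₀ hC] at h2
    linarith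
  refine caristi_set W Z hWc (fun z => z.2 + (z.1 * τ z.2) • v z.2) ?_ ?_ ?_
    (fun x => C / m * (-α x)) (continuousOn_const.mul hαc.neg) ?_ ?_ ?_ ?_
  · have hsnd : Set.MapsTo Prod.snd (Set.Icc (0:ℝ) 1 ×ˢ W) W := fun z hz => hz.2
    exact continuousOn_snd.add ((continuousOn_fst.mul (hτc.comp continuousOn_snd hsnd)).smul
      (hv.comp continuousOn_snd hsnd))
  · intro l hl x hx
    obtain ⟨u0, u1, u2⟩ := hu l hl x hx
    obtain ⟨k1, k2, k3, k4, k5⟩ := h x hx hx _ u0 u1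
    rw [hW]
    exact ⟨by simp only; linarith, k4, k5⟩
  · intro x hx; simp
  · intro x hx
    have := ((hW x).1 hx).1
    exact mul_nonneg (by positivity) (by linarith)
  · intro l hl x hx
    obtain ⟨u0, u1, u2⟩ := hu l hl x hx
    obtain ⟨k1, k2, k3, k4, k5⟩ := h x hx hx _ u0 u1
    simp only [add_sub_cancel_left, norm_smul, Real.norm_eq_abs, abs_of_nonneg u0]
    have e1 : l * τ x * ‖v x‖ ≤ l * τ x * C := by gcongr
    have e2 : C / m * (m * (l * τ x)) ≤ C / m * (α (x + (l * τ x) • v x) - α x) := by gcongr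
    have e3 : C / m * (m * (l * τ x)) = l * τ x * C := by field_simp
    linarith
  · intro x hx hpos
    have hp : 0 < -α x := by
      by_contra! hcon
      have : C / m * (-α x) ≤ 0 := mul_nonpos_of_nonneg_of_nonpos (by positivity) hcon
      linarith
    obtain ⟨u0, u1, u2⟩ := hu 1 ⟨zero_le_one, le_rfl⟩ x hx
    obtain ⟨k1, -⟩ := h x hx hx _ u0 u1
    have hτp : 0 < τ x := lt_min hs1 (div_pos hp hC)
    have : 0 < m * (1 * τ x) := by positivity
    have hCm : 0 < C / m := by positivity
    exact mul_lt_mul_of_pos_left (by simp only; linarith) hCm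
  · intro x
    rw [hZ]
    refine and_congr_right fun _ => ?_
    have hCm : C / m ≠ 0 := by positivity
    simp [hCm]

end Hom

end

section
open Filter Topology Geo
set_option linter.unusedSectionVars false
set_option linter.style.haveILetI false
namespace Hom

variable {E : Type} [NormedAddCommGroup E] [InnerProductSpace ℝ E] [FiniteDimensional ℝ E]

theorem grad_pos {f : E → ℝ} {x : E} (hx : x ≠ 0)
    (hA : gm f x = 0 → inner ℝ (gradient f x) x < 0) :
    0 < inner ℝ x (‖gradient f x‖ • x - ‖x‖ • gradient f x) ∧
    inner ℝ (gradient f x) (‖gradient f x‖ • x - ‖x‖ • gradient f x) < 0 := by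
  have hm : 0 < ‖x‖ := norm_pos_iff.2 hx
  have hp : inner ℝ (gradient f x) x ≤ ‖gradient f x‖ * ‖x‖ := real_inner_le_norm _ _
  have hgm : gm f x = ‖gradient f x‖ ^ 2 * ‖x‖ ^ 2 - (inner ℝ (gradient f x) x) ^ 2 := by
    unfold gm
    rw [real_inner_self_eq_norm_sq, real_inner_self_eq_norm_sq]; ring
  have hn : 0 < ‖gradient f x‖ := by
    rcases (norm_nonneg (gradient f x)).eq_or_lt with h | h
    · have h0 : gradient f x = 0 := norm_eq_zero.1 h.symm
      have := hA (by rw [hgm, h0]; simp)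
      rw [h0] at this; simp at this
    · exact h
  have hlt : inner ℝ (gradient f x) x < ‖gradient f x‖ * ‖x‖ := by
    refine lt_of_le_of_ne hp fun h => ?_
    have h2 := hA (by rw [hgm, h]; ring)
    rw [h] at h2
    have := mul_pos hn hm
    linarith
  simp only [inner_sub_right, inner_smul_right, real_inner_self_eq_norm_sq,
    real_inner_comm (gradient f x) x]
  constructor
  · nlinarith [mul_pos hm (sub_pos.2 hlt)]
  · nlinarith [mul_pos hn (sub_pos.2 hlt)]

theorem compact_le {K : Set E} (hK : IsCompact K) {g : E → ℝ} (hg : ContinuousOn g K) :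
    IsCompact {x | x ∈ K ∧ g x ≤ 0} := by
  have h1 : IsClosed (K ∩ g ⁻¹' Set.Iic 0) :=
    hg.preimage_isClosed_of_isClosed hK.isClosed isClosed_Iic
  exact hK.of_isClosed_subset h1 Set.inter_subset_left

theorem H4 {f : E → ℝ} {ρ y : ℝ} (hρ : 0 < ρ) (hf : ∀ x, ‖x‖ ≤ ρ → AnalyticAt ℝ f x)
    (hf0 : f 0 = 0) (hy : y < 0)
    (hA : ∀ x, x ≠ 0 → ‖x‖ ≤ ρ → f x < 0 → gm f x = 0 → inner ℝ (gradient f x) x < 0) :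
    Nonempty (ContinuousMap.HomotopyEquiv {x : E | ‖x‖ = ρ ∧ f x ≤ y}
      {x : E | ‖x‖ ≤ ρ ∧ f x = y}) := by
  set W : Set E := {x | x ∈ Metric.closedBall (0:E) ρ ∧ f x - y ≤ 0} with hWdef
  have hmem : ∀ x, x ∈ W ↔ ‖x‖ ≤ ρ ∧ f x - y ≤ 0 := fun x => by
    rw [hWdef, Set.mem_ofPred_eq, mem_closedBall_zero_iff]
  have hWc : IsCompact W := compact_le (isCompact_closedBall 0 ρ) (fun x hx =>
    ((hf x (mem_closedBall_zero_iff.1 hx)).continuousAt.sub continuousAt_const).continuousWithinAt)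
  have hsq : ∀ x : E, ‖x‖ ^ 2 - ρ ^ 2 ≤ 0 ↔ ‖x‖ ≤ ρ := fun x => by
    rw [sub_nonpos, sq_le_sq₀ (norm_nonneg x) hρ.le]
  have hsq2 : ∀ x : E, ‖x‖ ^ 2 - ρ ^ 2 = 0 ↔ ‖x‖ = ρ := fun x => by
    rw [sub_eq_zero, sq_eq_sq₀ (norm_nonneg x) hρ.le]
  have hα : ∀ x ∈ W, HasStrictFDerivAt (fun x : E => ‖x‖ ^ 2 - ρ ^ 2) (2 • innerSL ℝ x) x :=
    fun x _ => (hasStrictFDerivAt_norm_sq x).sub_const _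
  have hβ : ∀ x ∈ W, HasStrictFDerivAt (fun x : E => f x - y) (fderiv ℝ f x) x :=
    fun x hx => (hf x ((hmem x).1 hx).1).hasStrictFDerivAt.sub_const _
  set v : E → E := fun x => ‖gradient f x‖ • x - ‖x‖ • gradient f x with hvdef
  have hv : ContinuousOn v W := fun x hx => by
    have hg : ContinuousAt (gradient f) x := (grad_an (hf x ((hmem x).1 hx).1)).continuousAt
    have : ContinuousAt v x := (hg.norm.smul continuousAt_id).sub (continuousAt_id.norm.smul hg)
    exact this.continuousWithinAt
  have key : ∀ x ∈ W, 0 < inner ℝ x (v x) ∧ fderiv ℝ f x (v x) < 0 := fun x hx => by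
    obtain ⟨h1, h2⟩ := (hmem x).1 hx
    have hx0 : x ≠ 0 := by rintro rfl; rw [hf0] at h2; linarith
    rw [← inner_grad]
    exact grad_pos hx0 (hA x hx0 h1 (by linarith))
  obtain ⟨e1⟩ := flow W {x : E | ‖x‖ = ρ ∧ f x ≤ y} hWc (fun x => ‖x‖ ^ 2 - ρ ^ 2)
    (fun x => f x - y) (fun x => f x - y) (fun x => by rw [hmem, hsq]; tauto)
    (fun x => by
      rw [hmem, hsq2, Set.mem_ofPred_eq, sub_nonpos]
      constructor
      · rintro ⟨h1, h2⟩; exact ⟨⟨h1.le, h2⟩, h1⟩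
      · rintro ⟨⟨_, h2⟩, h1⟩; exact ⟨h1, h2⟩)
    (fun x => 2 • innerSL ℝ x) (fun x => fderiv ℝ f x) (fun x => fderiv ℝ f x) hα hβ hβ v hv
    (fun x hx => by simpa using (key x hx).1) (fun x hx _ => (key x hx).2)
    (fun x hx _ => (key x hx).2)
  obtain ⟨e2⟩ := flow W {x : E | ‖x‖ ≤ ρ ∧ f x = y} hWc (fun x => f x - y)
    (fun x => ‖x‖ ^ 2 - ρ ^ 2) (fun x => ‖x‖ ^ 2 - ρ ^ 2) (fun x => by rw [hmem, hsq]; tauto)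
    (fun x => by
      rw [hmem, sub_eq_zero, Set.mem_ofPred_eq, sub_nonpos]
      constructor
      · rintro ⟨h1, h2⟩; exact ⟨⟨h1, h2.le⟩, h2⟩
      · rintro ⟨⟨h1, _⟩, h2⟩; exact ⟨h1, h2⟩)
    (fun x => fderiv ℝ f x) (fun x => 2 • innerSL ℝ x) (fun x => 2 • innerSL ℝ x) hβ hα hα
    (fun x => - v x) hv.neg
    (fun x hx => by simpa using (key x hx).2) (fun x hx _ => by simpa using (key x hx).1)
    (fun x hx _ => by simpa using (key x hx).1)
  exact ⟨e1.trans e2.symm⟩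

theorem rpow_strict {x : E} (hx : x ≠ 0) (l : ℝ) :
    HasStrictFDerivAt (fun x : E => ‖x‖ ^ l)
      ((l / 2 * (‖x‖ ^ 2) ^ (l / 2 - 1)) • (2 • innerSL ℝ x)) x := by
  have h := (hasStrictFDerivAt_norm_sq x).rpow_const (p := l / 2)
    (Or.inl (by have := norm_pos_iff.2 hx; positivity))
  refine h.congr_of_eventuallyEq (Eventually.of_forall fun z => ?_)
  simp only
  rw [← Real.rpow_natCast, ← Real.rpow_mul (norm_nonneg z)]
  congr 1; push_cast; ring

theorem H2 {f : E → ℝ} {W Z : Set E} (hWc : IsCompact W) {R R' s b l : ℝ} (hs : s ≠ 0)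
    (hW : ∀ x, x ∈ W ↔ s * (‖x‖ ^ 2 - R ^ 2) ≤ 0 ∧ f x - b * ‖x‖ ^ l ≤ 0 ∧
      s * (R' ^ 2 - ‖x‖ ^ 2) ≤ 0)
    (hZ : ∀ x, x ∈ Z ↔ x ∈ W ∧ s * (‖x‖ ^ 2 - R ^ 2) = 0)
    (h0 : ∀ x ∈ W, x ≠ 0) (hf : ∀ x ∈ W, AnalyticAt ℝ f x)
    (hg : ∀ x ∈ W, f x - b * ‖x‖ ^ l = 0 → gm f x ≠ 0) :
    Nonempty (ContinuousMap.HomotopyEquiv Z W) := by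
  have hβ : ∀ x ∈ W, HasStrictFDerivAt (fun x : E => f x - b * ‖x‖ ^ l)
      (fderiv ℝ f x - b • ((l / 2 * (‖x‖ ^ 2) ^ (l / 2 - 1)) • (2 • innerSL ℝ x))) x :=
    fun x hx => (hf x hx).hasStrictFDerivAt.sub ((rpow_strict (h0 x hx) l).const_mul b)
  set h : E → ℝ := fun x => inner ℝ (gradient f x) x -
    b * (l / 2 * (‖x‖ ^ 2) ^ (l / 2 - 1) * (2 * ‖x‖ ^ 2)) with hh
  have hgr : ∀ x ∈ W, ContinuousAt (gradient f) x := fun x hx => (grad_an (hf x hx)).continuousAt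
  have hhc : ∀ x ∈ W, ContinuousAt h x := fun x hx => by
    have h1 : ContinuousAt (fun x : E => inner ℝ (gradient f x) x) x :=
      (hgr x hx).inner (𝕜 := ℝ) continuousAt_id
    have h2 : ContinuousAt (fun x : E => (‖x‖ ^ 2) ^ (l / 2 - 1)) x := by
      refine ContinuousAt.rpow_const (by fun_prop) (Or.inl ?_)
      have := norm_pos_iff.2 (h0 x hx); positivity
    refine h1.sub (continuousAt_const.mul ((continuousAt_const.mul h2).mul ?_))
    fun_prop
  have hZ0 : IsCompact {x | x ∈ W ∧ -(f x - b * ‖x‖ ^ l) ≤ 0} := compact_le hWc fun x hx =>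
    (hβ x hx).continuousAt.neg.continuousWithinAt
  have hz : ∀ x, (x ∈ W ∧ -(f x - b * ‖x‖ ^ l) ≤ 0) → gm f x ≠ 0 := fun x hx =>
    hg x hx.1 (le_antisymm ((hW x).1 hx.1).2.1 (by linarith [hx.2]))
  obtain ⟨B, hB⟩ := hZ0.bddAbove_image (f := fun x => s * h x / gm f x) (fun x hx =>
    ((continuousAt_const.mul (hhc x hx.1)).div (gm_an (hf x hx.1)).continuousAt
      (hz x hx)).continuousWithinAt)
  have hpx : ∀ x : E, inner ℝ x (pt f x) = 0 := fun x => by rw [real_inner_comm, pt_x]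
  refine flow W Z hWc (fun x => s * (‖x‖ ^ 2 - R ^ 2)) (fun x => f x - b * ‖x‖ ^ l)
    (fun x => s * (R' ^ 2 - ‖x‖ ^ 2)) hW hZ
    (fun x => s • (2 • innerSL ℝ x))
    (fun x => fderiv ℝ f x - b • ((l / 2 * (‖x‖ ^ 2) ^ (l / 2 - 1)) • (2 • innerSL ℝ x)))
    (fun x => s • (-(2 • innerSL ℝ x)))
    (fun x _ => ((hasStrictFDerivAt_norm_sq x).sub_const _).const_mul s) hβ
    (fun x _ => ((hasStrictFDerivAt_norm_sq x).const_sub _).const_mul s)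
    (fun x => s • x - (B + 1) • pt f x) ?_ ?_ ?_ ?_
  · intro x hx
    have h1 := hgr x hx
    have : ContinuousAt (fun x => s • x - (B + 1) • pt f x) x := by
      unfold pt
      fun_prop
    exact this.continuousWithinAt
  · intro x hx
    have h1 := norm_pos_iff.2 (h0 x hx)
    have h2 : 0 < s ^ 2 := by positivity
    simp only [_root_.smul_apply, innerSL_apply_apply, inner_sub_right,
      inner_smul_right, hpx, real_inner_self_eq_norm_sq, smul_eq_mul, nsmul_eq_mul]
    have : 0 < s ^ 2 * ‖x‖ ^ 2 := by positivity
    push_cast; nlinarith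
  · intro x hx hx0
    have hxm : x ∈ W ∧ -(f x - b * ‖x‖ ^ l) ≤ 0 := ⟨hx, by linarith⟩
    have hgp : 0 < gm f x := lt_of_le_of_ne (gm_nonneg f x) (Ne.symm (hz x hxm))
    have h1 : s * h x / gm f x ≤ B := hB ⟨x, hxm, rfl⟩
    rw [div_le_iff₀ hgp] at h1
    simp only [_root_.smul_apply, _root_.sub_apply, innerSL_apply_apply,
      inner_sub_right, ← inner_grad, pt_g,
      inner_smul_right, hpx, real_inner_self_eq_norm_sq, smul_eq_mul, nsmul_eq_mul]
    rw [hh] at h1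
    push_cast
    simp only at h1
    linarith
  · intro x hx _
    have h1 := norm_pos_iff.2 (h0 x hx)
    have h2 : 0 < s ^ 2 := by positivity
    simp only [_root_.smul_apply, _root_.neg_apply, innerSL_apply_apply,
      inner_sub_right,
      inner_smul_right, hpx, real_inner_self_eq_norm_sq, smul_eq_mul, nsmul_eq_mul]
    have : 0 < s ^ 2 * ‖x‖ ^ 2 := by positivity
    push_cast; nlinarith

/-- sphere at `ρ` versus sphere at `r` -/
theorem H2' {f : E → ℝ} {ρ r b l : ℝ} (hρ : 0 < ρ) (hr : ρ ≤ r)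
    (hf : ∀ x, ‖x‖ ≤ r → AnalyticAt ℝ f x)
    (hg : ∀ x, ρ ≤ ‖x‖ → ‖x‖ ≤ r → f x = b * ‖x‖ ^ l → gm f x ≠ 0) :
    Nonempty (ContinuousMap.HomotopyEquiv {x : E | ‖x‖ = r ∧ f x ≤ b * r ^ l}
      {x : E | ‖x‖ = ρ ∧ f x ≤ b * ρ ^ l}) := by
  set K : Set E := {x | x ∈ Metric.closedBall (0:E) r ∧ ρ - ‖x‖ ≤ 0} with hKdef
  have hKc : IsCompact K := compact_le (isCompact_closedBall 0 r) (by fun_prop)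
  have hKm : ∀ x, x ∈ K ↔ ‖x‖ ≤ r ∧ ρ ≤ ‖x‖ := fun x => by
    rw [hKdef, Set.mem_ofPred_eq, mem_closedBall_zero_iff, sub_nonpos]
  have hK0 : ∀ x ∈ K, x ≠ 0 := fun x hx h => by
    have := ((hKm x).1 hx).2
    rw [h, norm_zero] at this; linarith
  set W : Set E := {x | x ∈ K ∧ f x - b * ‖x‖ ^ l ≤ 0} with hWdef
  have hWc : IsCompact W := compact_le hKc fun x hx => by
    refine ((hf x ((hKm x).1 hx).1).continuousAt.sub
      (continuousAt_const.mul (rpow_strict (hK0 x hx) l).continuousAt)).continuousWithinAt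
  have hWm : ∀ x, x ∈ W ↔ (‖x‖ ≤ r ∧ ρ ≤ ‖x‖) ∧ f x - b * ‖x‖ ^ l ≤ 0 := fun x => by
    rw [hWdef, Set.mem_ofPred_eq, hKm]
  have hr0 : 0 < r := hρ.trans_le hr
  have s1 : ∀ x : E, ‖x‖ ^ 2 ≤ r ^ 2 ↔ ‖x‖ ≤ r := fun x => sq_le_sq₀ (norm_nonneg x) hr0.le
  have s2 : ∀ x : E, ρ ^ 2 ≤ ‖x‖ ^ 2 ↔ ρ ≤ ‖x‖ := fun x => sq_le_sq₀ hρ.le (norm_nonneg x)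
  have s3 : ∀ x : E, ‖x‖ ^ 2 = r ^ 2 ↔ ‖x‖ = r := fun x => sq_eq_sq₀ (norm_nonneg x) hr0.le
  have s4 : ∀ x : E, ‖x‖ ^ 2 = ρ ^ 2 ↔ ‖x‖ = ρ := fun x => sq_eq_sq₀ (norm_nonneg x) hρ.le
  have hW0 : ∀ x ∈ W, x ≠ 0 := fun x hx => hK0 x hx.1
  have hWf : ∀ x ∈ W, AnalyticAt ℝ f x := fun x hx => hf x ((hWm x).1 hx).1.1
  have hWg : ∀ x ∈ W, f x - b * ‖x‖ ^ l = 0 → gm f x ≠ 0 := fun x hx h =>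
    hg x ((hWm x).1 hx).1.2 ((hWm x).1 hx).1.1 (by linarith)
  obtain ⟨e1⟩ := H2 (Z := {x : E | ‖x‖ = r ∧ f x ≤ b * r ^ l}) hWc (R := r) (R' := ρ) (s := 1)
    one_ne_zero
    (fun x => by 
      rw [hWm, ← s1, ← s2]
      constructor
      · rintro ⟨⟨h1, h2⟩, h3⟩; exact ⟨by linarith, h3, by linarith⟩
      · rintro ⟨h1, h3, h2⟩; exact ⟨⟨by linarith, by linarith⟩, h3⟩)
    (fun x => by
      rw [hWm, one_mul, sub_eq_zero, s3, Set.mem_ofPred_eq, sub_nonpos]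
      constructor
      · rintro ⟨h1, h2⟩; rw [h1]; exact ⟨⟨⟨le_rfl, hr⟩, h2⟩, rfl⟩
      · rintro ⟨⟨_, h2⟩, h1⟩; rw [h1] at h2; exact ⟨h1, h2⟩) hW0 hWf hWg
  obtain ⟨e2⟩ := H2 (Z := {x : E | ‖x‖ = ρ ∧ f x ≤ b * ρ ^ l}) hWc (R := ρ) (R' := r) (s := -1)
    (by norm_num)
    (fun x => by
      rw [hWm, ← s1, ← s2]
      constructor
      · rintro ⟨⟨h1, h2⟩, h3⟩; exact ⟨by linarith, h3, by linarith⟩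
      · rintro ⟨h1, h3, h2⟩; exact ⟨⟨by linarith, by linarith⟩, h3⟩)
    (fun x => by
      rw [hWm, neg_one_mul, neg_eq_zero, sub_eq_zero, s4, Set.mem_ofPred_eq, sub_nonpos]
      constructor
      · rintro ⟨h1, h2⟩; rw [h1]; exact ⟨⟨⟨hr, le_rfl⟩, h2⟩, rfl⟩
      · rintro ⟨⟨_, h2⟩, h1⟩; rw [h1] at h2; exact ⟨h1, h2⟩) hW0 hWf hWg
  exact ⟨e1.trans e2.symm⟩

end Hom

end

section
open Filter Topology Geo
set_option linter.unusedSectionVars false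
set_option linter.style.haveILetI false
namespace Hom

variable {E : Type} [NormedAddCommGroup E] [InnerProductSpace ℝ E] [FiniteDimensional ℝ E]

theorem taylor2_loc {f : E → ℝ} {x0 : E} (hf : AnalyticAt ℝ f x0) :
    ∃ C ≥ (0:ℝ), ∃ d > (0:ℝ), ∀ x, ‖x - x0‖ < d → ∀ y, ‖y - x‖ ≤ d →
      |f y - f x - fderiv ℝ f x (y - x)| ≤ C * ‖y - x‖ ^ 2 := by
  obtain ⟨K, t, ht, hK⟩ := (hf.fderiv.contDiffAt (n := 1)).exists_lipschitzOnWith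
  obtain ⟨d, hd, hsub⟩ := Metric.mem_nhds_iff.1 (Filter.inter_mem ht hf.eventually_analyticAt)
  refine ⟨K, K.2, d / 2, by positivity, fun x hx y hy => ?_⟩
  have hin : ∀ z ∈ Metric.closedBall x ‖y - x‖, z ∈ t ∧ AnalyticAt ℝ f z := fun z hz => by
    refine hsub ?_
    rw [Metric.mem_ball, dist_eq_norm]
    rw [mem_closedBall_iff_norm] at hz
    calc ‖z - x0‖ = ‖(z - x) + (x - x0)‖ := by congr 1; abel
      _ ≤ ‖z - x‖ + ‖x - x0‖ := norm_add_le _ _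
      _ < d := by linarith
  have hxx : x ∈ Metric.closedBall x ‖y - x‖ := Metric.mem_closedBall_self (norm_nonneg _)
  have h := (convex_closedBall x ‖y - x‖).norm_image_sub_le_of_norm_hasFDerivWithin_le'
    (f := f) (f' := fun z => fderiv ℝ f z) (φ := fderiv ℝ f x) (C := K * ‖y - x‖) (x := x) (y := y)
    (fun z hz => (hin z hz).2.differentiableAt.hasFDerivAt.hasFDerivWithinAt)
    (fun z hz => by
      have h1 := hK.dist_le_mul z (hin z hz).1 x (hin x hxx).1
      rw [dist_eq_norm, dist_eq_norm] at h1
      refine h1.trans ?_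
      rw [mem_closedBall_iff_norm] at hz
      gcongr) hxx (by rw [mem_closedBall_iff_norm])
  rw [Real.norm_eq_abs] at h
  exact h.trans_eq (by ring)

theorem taylor2 {f : E → ℝ} {S : Set E} (hS : IsCompact S) (hf : ∀ x ∈ S, AnalyticAt ℝ f x) :
    ∃ C ≥ (0:ℝ), ∃ d > (0:ℝ), ∀ x ∈ S, ∀ y, ‖y - x‖ ≤ d →
      |f y - f x - fderiv ℝ f x (y - x)| ≤ C * ‖y - x‖ ^ 2 := by
  refine hS.induction_on (p := fun S => ∃ C ≥ (0:ℝ), ∃ d > (0:ℝ), ∀ x ∈ S, ∀ y, ‖y - x‖ ≤ d →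
      |f y - f x - fderiv ℝ f x (y - x)| ≤ C * ‖y - x‖ ^ 2) ?_ ?_ ?_ ?_
  · exact ⟨0, le_rfl, 1, one_pos, fun x hx => hx.elim⟩
  · rintro s t hst ⟨C, hC, d, hd, h⟩
    exact ⟨C, hC, d, hd, fun x hx => h x (hst hx)⟩
  · rintro s t ⟨C, hC, d, hd, h⟩ ⟨C', hC', d', hd', h'⟩
    refine ⟨max C C', le_max_of_le_left hC, min d d', lt_min hd hd', ?_⟩
    rintro x (hx | hx) y hy
    · exact (h x hx y (hy.trans (min_le_left _ _))).trans (by gcongr; exact le_max_left _ _)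
    · exact (h' x hx y (hy.trans (min_le_right _ _))).trans (by gcongr; exact le_max_right _ _)
  · intro x hx
    obtain ⟨C, hC, d, hd, h⟩ := taylor2_loc (hf x hx)
    refine ⟨Metric.ball x d, mem_nhdsWithin_of_mem_nhds (Metric.ball_mem_nhds x hd), C, hC, d, hd,
      fun z hz y hy => h z (by rwa [Metric.mem_ball, dist_eq_norm] at hz) y hy⟩

/-- Bernoulli -/
theorem bern {t t' θ : ℝ} (ht : 0 < t) (ht' : 0 ≤ t') (hθ : 0 ≤ θ) (hθ1 : θ < 1) :
    (1 - θ) * (t - t') ≤ t ^ θ * (t ^ (1 - θ) - t' ^ (1 - θ)) := by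
  have h := rpow_one_add_le_one_add_mul_self (s := t' / t - 1)
    (by have : 0 ≤ t' / t := by positivity
        linarith) (p := 1 - θ) (by linarith) (by linarith)
  rw [show 1 + (t' / t - 1) = t' / t by ring, Real.div_rpow ht' ht.le,
    div_le_iff₀ (Real.rpow_pos_of_pos ht _)] at h
  have h1 : t ^ θ * t ^ (1 - θ) = t := by
    rw [← Real.rpow_add ht]; simp
  have h2 : t ^ θ * t' ^ (1 - θ) ≤ (1 + (1 - θ) * (t' / t - 1)) * t := by
    calc t ^ θ * t' ^ (1 - θ) ≤ t ^ θ * ((1 + (1 - θ) * (t' / t - 1)) * t ^ (1 - θ)) := by gcongr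
      _ = (1 + (1 - θ) * (t' / t - 1)) * (t ^ θ * t ^ (1 - θ)) := by ring
      _ = _ := by rw [h1]
  have h3 : (1 + (1 - θ) * (t' / t - 1)) * t = t + (1 - θ) * (t' - t) := by
    field_simp
  rw [mul_sub (t ^ θ), h1]; linarith

/-- projected gradient step -/
noncomputable def stp (f : E → ℝ) (r s : ℝ) (x : E) : E :=
  (r / ‖x - s • pt f x‖) • (x - s • pt f x)

theorem stp_norm2 (f : E → ℝ) {r s : ℝ} {x : E} (hx : ‖x‖ = r) :
    ‖x - s • pt f x‖ ^ 2 = r ^ 2 + (s * ‖pt f x‖) ^ 2 := by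
  rw [← real_inner_self_eq_norm_sq]
  simp only [inner_sub_left, inner_sub_right, inner_smul_left, inner_smul_right, pt_x,
    real_inner_comm (pt f x) x, real_inner_self_eq_norm_sq, RCLike.conj_to_real, hx]
  ring

theorem stp_facts (f : E → ℝ) {r s : ℝ} {x : E} (hr : 0 < r) (hs : 0 ≤ s) (hx : ‖x‖ = r) :
    r ≤ ‖x - s • pt f x‖ ∧ ‖stp f r s x‖ = r ∧ ‖stp f r s x - x‖ ≤ 2 * (s * ‖pt f x‖) ∧
    ‖stp f r s x - (x - s • pt f x)‖ * (2 * r) ≤ (s * ‖pt f x‖) ^ 2 := by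
  have h2 := stp_norm2 f (s := s) hx
  set z := x - s • pt f x with hz
  have hσ : 0 ≤ s * ‖pt f x‖ := by positivity
  have h1 : r ≤ ‖z‖ := by
    rw [← sq_le_sq₀ hr.le (norm_nonneg _), h2]; nlinarith
  have hzp : 0 < ‖z‖ := hr.trans_le h1
  have h3 : ‖stp f r s x - z‖ = ‖z‖ - r := by
    have : stp f r s x - z = (r / ‖z‖ - 1) • z := by
      rw [sub_smul, one_smul]; rfl
    rw [this, norm_smul, Real.norm_eq_abs, abs_of_nonpos]
    · field_simp; ring
    · rw [sub_nonpos, div_le_one hzp]; exact h1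
  have h4 : ‖z‖ ≤ r + s * ‖pt f x‖ := by
    rw [← sq_le_sq₀ (norm_nonneg _) (by positivity), h2]; nlinarith
  refine ⟨h1, ?_, ?_, ?_⟩
  · unfold stp
    rw [← hz, norm_smul, Real.norm_eq_abs, abs_of_pos (by positivity)]
    field_simp
  · have h5 : ‖z - x‖ = s * ‖pt f x‖ := by
      rw [hz, sub_sub_cancel_left, norm_neg, norm_smul, Real.norm_eq_abs, abs_of_nonneg hs]
    calc ‖stp f r s x - x‖ = ‖(stp f r s x - z) + (z - x)‖ := by congr 1; abel
      _ ≤ _ := norm_add_le _ _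
      _ ≤ _ := by rw [h3, h5]; linarith
  · rw [h3]; nlinarith

theorem stp_dec {f : E → ℝ} {r s C d G : ℝ} {x : E} (hr : 0 < r) (hs : 0 ≤ s) (hx : ‖x‖ = r)
    (hC : 0 ≤ C) (hT : ∀ y, ‖y - x‖ ≤ d → |f y - f x - fderiv ℝ f x (y - x)| ≤ C * ‖y - x‖ ^ 2)
    (hd : 2 * (s * ‖pt f x‖) ≤ d) (hG : ‖gradient f x‖ ≤ G)
    (hs2 : s * (G * r / 2 + 4 * C * r ^ 2) ≤ 1 / 2) :
    f (stp f r s x) ≤ f x - s * gm f x / 2 := by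
  obtain ⟨h1, h2, h3, h4⟩ := stp_facts f hr hs hx
  have h5 := (abs_le.1 (hT _ (h3.trans hd))).2
  set y := stp f r s x with hy
  have hp : ‖pt f x‖ ^ 2 = r ^ 2 * gm f x := by
    rw [← real_inner_self_eq_norm_sq, pt_sq, real_inner_self_eq_norm_sq, hx]
  have h6 : fderiv ℝ f x (y - x) =
      - (s * gm f x) + inner ℝ (gradient f x) (y - (x - s • pt f x)) := by
    rw [← inner_grad, show y - x = -(s • pt f x) + (y - (x - s • pt f x)) by abel, inner_add_right,
      inner_neg_right, inner_smul_right, pt_g]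
  have h7 : inner ℝ (gradient f x) (y - (x - s • pt f x)) ≤ G * ((s * ‖pt f x‖) ^ 2 / (2 * r)) := by
    refine (real_inner_le_norm _ _).trans ?_
    have : ‖y - (x - s • pt f x)‖ ≤ (s * ‖pt f x‖) ^ 2 / (2 * r) := by
      rw [le_div_iff₀ (by positivity)]; exact h4
    have hG0 : 0 ≤ G := (norm_nonneg _).trans hG
    gcongr
  have h8 : ‖y - x‖ ^ 2 ≤ (2 * (s * ‖pt f x‖)) ^ 2 := by gcongr
  have h9 : (s * ‖pt f x‖) ^ 2 = s ^ 2 * (r ^ 2 * gm f x) := by rw [mul_pow, hp]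
  have h10 : G * ((s * ‖pt f x‖) ^ 2 / (2 * r)) = s ^ 2 * gm f x * (G * r / 2) := by
    rw [h9]; field_simp
  have h11 : C * ‖y - x‖ ^ 2 ≤ s ^ 2 * gm f x * (4 * C * r ^ 2) := by
    calc C * ‖y - x‖ ^ 2 ≤ C * (2 * (s * ‖pt f x‖)) ^ 2 := by gcongr
      _ = C * (4 * (s * ‖pt f x‖) ^ 2) := by ring
      _ = _ := by rw [h9]; ring
  have h12 : s * gm f x * (s * (G * r / 2 + 4 * C * r ^ 2)) ≤ s * gm f x * (1 / 2) :=
    mul_le_mul_of_nonneg_left hs2 (mul_nonneg hs (gm_nonneg f x))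
  rw [h10] at h7
  nlinarith

theorem H1 {f : E → ℝ} {r : ℝ} (hr : 0 < r) (hf : ∀ x, ‖x‖ = r → AnalyticAt ℝ f x) (c : ℝ) :
    ∃ ε₀ > (0:ℝ), ∀ ε, 0 < ε → ε ≤ ε₀ → Nonempty (ContinuousMap.HomotopyEquiv
      {x : E | ‖x‖ = r ∧ f x ≤ c} {x : E | ‖x‖ = r ∧ f x ≤ c + ε}) := by
  obtain ⟨κ, hκ, θ, hθ, hθ1, δ, hδ, hL⟩ := partL hr hf c
  have hS : IsCompact (Metric.sphere (0:E) r) := isCompact_sphere 0 r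
  have hSm : ∀ x, x ∈ Metric.sphere (0:E) r ↔ ‖x‖ = r := fun x => mem_sphere_zero_iff_norm
  have hfS : ∀ x ∈ Metric.sphere (0:E) r, AnalyticAt ℝ f x := fun x hx => hf x ((hSm x).1 hx)
  obtain ⟨C, hC, d, hd, hT⟩ := taylor2 hS hfS
  have hgc : ∀ x, ‖x‖ = r → ContinuousAt (gradient f) x := fun x hx =>
    (grad_an (hf x hx)).continuousAt
  have hptc : ∀ x, ‖x‖ = r → ContinuousAt (pt f) x := fun x hx => by
    have := hgc x hx
    unfold pt; fun_prop
  obtain ⟨G, hG⟩ := hS.exists_bound_of_continuousOn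
    (f := gradient f) (fun x hx => (hgc x ((hSm x).1 hx)).continuousWithinAt)
  obtain ⟨P0, hP0⟩ := hS.exists_bound_of_continuousOn
    (f := pt f) (fun x hx => (hptc x ((hSm x).1 hx)).continuousWithinAt)
  set P := max P0 1 with hPdef
  have hP1 : 0 < P := lt_max_of_lt_right one_pos
  have hP : ∀ x, ‖x‖ = r → ‖pt f x‖ ≤ P := fun x hx =>
    (hP0 x ((hSm x).2 hx)).trans (le_max_left _ _)
  set G' := max G 0 with hG'def
  have hG'0 : 0 ≤ G' := le_max_right _ _
  have hG' : ∀ x, ‖x‖ = r → ‖gradient f x‖ ≤ G' := fun x hx =>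
    (hG x ((hSm x).2 hx)).trans (le_max_left _ _)
  set Q := G' * r / 2 + 4 * C * r ^ 2 with hQ
  have hQ0 : 0 ≤ Q := by positivity
  obtain ⟨s0, hs0, hs1, hs2⟩ : ∃ s0 > (0:ℝ), 2 * (s0 * P) ≤ d ∧ s0 * Q ≤ 1 / 2 := by
    refine ⟨min (d / (2 * P)) (1 / (2 * (Q + 1))), by positivity, ?_, ?_⟩
    · calc _ ≤ 2 * (d / (2 * P) * P) := by gcongr; exact min_le_left _ _
        _ = d := by field_simp
    · calc _ ≤ (1 / (2 * (Q + 1))) * (Q + 1) := by gcongr; · exact min_le_right _ _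
                                                   · linarith
        _ = 1 / 2 := by field_simp
  set β := 1 - θ with hβ
  have hβ0 : 0 < β := by linarith
  have hβ1 : β ≤ 1 := by linarith
  have hsκ : 0 < √κ := Real.sqrt_pos.2 hκ
  set K1 := 2 * s0 * P + 4 * r / (β * √κ) with hK1
  have hK1a : 2 * s0 * P ≤ K1 := by
    have : 0 ≤ 4 * r / (β * √κ) := by positivity
    linarith
  have hK1b : 4 * r / (β * √κ) ≤ K1 := by
    have : 0 ≤ 2 * s0 * P := by positivity
    linarith
  have hK1p : 0 < K1 := lt_of_lt_of_le (by positivity) hK1a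
  refine ⟨min 1 (δ / 2), by positivity, fun ε hε hε0 => ?_⟩
  have hε1 : ε ≤ 1 := hε0.trans (min_le_left _ _)
  have hε2 : ε ≤ δ / 2 := hε0.trans (min_le_right _ _)
  set K : Set E := {x : E | ‖x‖ = r ∧ f x ≤ c + ε} with hK
  have hKc : IsCompact K := by
    have := compact_le hS (g := fun x => f x - (c + ε)) (fun x hx =>
      ((hfS x hx).continuousAt.sub continuousAt_const).continuousWithinAt)
    convert this using 1
    ext x
    rw [hK, Set.mem_ofPred_eq, Set.mem_ofPred_eq, hSm, sub_nonpos]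
  set t : E → ℝ := fun x => max (f x - c) 0 with ht
  have ht0 : ∀ x, 0 ≤ t x := fun x => le_max_right _ _
  have htε : ∀ x ∈ K, t x ≤ ε := fun x hx => max_le (by linarith [hx.2]) hε.le
  have htc : ∀ x, ‖x‖ = r → ContinuousAt t x := fun x hx =>
    ((hf x hx).continuousAt.sub continuousAt_const).max continuousAt_const
  have dec : ∀ l ∈ Set.Icc (0:ℝ) 1, ∀ x ∈ K,
      f (stp f r (l * (s0 * t x)) x) ≤ f x - (l * (s0 * t x)) * gm f x / 2 := by
    intro l hl x hx
    have hs : 0 ≤ l * (s0 * t x) := mul_nonneg hl.1 (mul_nonneg hs0.le (ht0 x))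
    have hs' : l * (s0 * t x) ≤ s0 := by
      have h1 : s0 * t x ≤ s0 * 1 := by gcongr; exact (htε x hx).trans hε1
      have h2 : l * (s0 * t x) ≤ 1 * (s0 * t x) := by
        gcongr
        exact hl.2
      linarith
    refine stp_dec hr hs hx.1 hC (hT x ((hSm x).2 hx.1)) ?_ (hG' x hx.1) ?_
    · refine le_trans ?_ hs1
      have := hP x hx.1
      gcongr
    · refine le_trans ?_ hs2
      rw [← hQ]
      gcongr
  have low : ∀ x ∈ K, 0 < t x → f x = c + t x ∧ κ * (t x ^ θ) ^ 2 ≤ gm f x := by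
    intro x hx h
    have h1 : t x = f x - c := by
      rcases max_choice (f x - c) 0 with h' | h'
      · exact h'
      · rw [ht] at h; simp only at h; rw [h'] at h; exact absurd h (lt_irrefl _)
    have h2 := htε x hx
    refine ⟨by linarith, ?_⟩
    have := hL x hx.1 (by linarith) (by linarith)
    rwa [← h1] at this
  refine caristi_set K _ hKc (fun z => stp f r (z.1 * (s0 * t z.2)) z.2) ?_ ?_ ?_
    (fun x => K1 * t x ^ β) ?_ ?_ ?_ ?_ ?_
  · rintro ⟨l, x⟩ ⟨hl, hx⟩
    have h1 : ContinuousAt (fun z : ℝ × E => t z.2) (l, x) :=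
      ContinuousAt.comp (g := t) (f := Prod.snd) (htc x hx.1) continuousAt_snd
    have h2 : ContinuousAt (fun z : ℝ × E => pt f z.2) (l, x) :=
      ContinuousAt.comp (g := pt f) (f := Prod.snd) (hptc x hx.1) continuousAt_snd
    have h3 : ContinuousAt (fun z : ℝ × E => z.2 - (z.1 * (s0 * t z.2)) • pt f z.2) (l, x) :=
      continuousAt_snd.sub ((continuousAt_fst.mul (continuousAt_const.mul h1)).smul h2)
    have h4 := (stp_facts f hr (mul_nonneg hl.1 (mul_nonneg hs0.le (ht0 x))) hx.1).1
    have h5 : ContinuousAt (fun z : ℝ × E => stp f r (z.1 * (s0 * t z.2)) z.2) (l, x) := by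
      unfold stp
      refine ContinuousAt.smul (ContinuousAt.div continuousAt_const h3.norm ?_) h3
      exact (hr.trans_le h4).ne'
    exact h5.continuousWithinAt
  · intro l hl x hx
    have hs : 0 ≤ l * (s0 * t x) := mul_nonneg hl.1 (mul_nonneg hs0.le (ht0 x))
    refine ⟨(stp_facts f hr hs hx.1).2.1, ?_⟩
    have h1 := dec l hl x hx
    have h2 := mul_nonneg hs (gm_nonneg f x)
    simp only at h1 ⊢
    linarith [hx.2]
  · intro x hx
    simp only [stp, zero_mul, zero_smul, sub_zero, hx.1]
    rw [div_self hr.ne', one_smul]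
  · intro x hx
    exact (continuousAt_const.mul ((htc x hx.1).rpow_const (Or.inr hβ0.le))).continuousWithinAt
  · intro x hx
    exact mul_nonneg hK1p.le (Real.rpow_nonneg (ht0 x) _)
  · intro l hl x hx
    have hs : 0 ≤ l * (s0 * t x) := mul_nonneg hl.1 (mul_nonneg hs0.le (ht0 x))
    have h1 := dec l hl x hx
    obtain ⟨-, -, h3, -⟩ := stp_facts f hr hs hx.1
    simp only
    rcases (ht0 x).eq_or_lt with h0 | h0
    · have : stp f r (l * (s0 * t x)) x = x := by
        simp only [stp, ← h0, mul_zero, zero_smul, sub_zero, hx.1]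
        rw [div_self hr.ne', one_smul]
      rw [this]; simp
    obtain ⟨h4, h5⟩ := low x hx h0
    have htx1 : t x ≤ 1 := (htε x hx).trans hε1
    set y := stp f r (l * (s0 * t x)) x with hy
    rcases (ht0 y).eq_or_lt with h6 | h6
    · rw [← h6, Real.zero_rpow hβ0.ne', mul_zero, sub_zero]
      refine h3.trans ?_
      have h7 : t x ≤ t x ^ β := by
        calc t x = t x ^ (1:ℝ) := (Real.rpow_one _).symm
          _ ≤ t x ^ β := Real.rpow_le_rpow_of_exponent_ge h0 htx1 hβ1
      have h8 : l * (s0 * t x) ≤ 1 * (s0 * t x) := by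
        gcongr
        exact hl.2
      calc 2 * (l * (s0 * t x) * ‖pt f x‖) ≤ 2 * (1 * (s0 * t x) * P) := by
            have := hP x hx.1
            gcongr
        _ = 2 * s0 * P * t x := by ring
        _ ≤ K1 * t x ^ β := by gcongr
    · have h7 : f y = c + t y := by
        have : t y = f y - c := by
          rcases max_choice (f y - c) 0 with h' | h'
          · exact h'
          · rw [ht] at h6; simp only at h6; rw [h'] at h6; exact absurd h6 (lt_irrefl _)
        linarith
      have hb := bern h0 (ht0 y) hθ hθ1
      rw [← hβ] at hb
      set s := l * (s0 * t x) with hsdef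
      have h8 : s * gm f x / 2 ≤ t x - t y := by linarith
      have hgs : √(gm f x) * √(gm f x) = gm f x := Real.mul_self_sqrt (gm_nonneg f x)
      have hT0 : 0 < t x ^ θ := Real.rpow_pos_of_pos h0 _
      have h9 : √κ * t x ^ θ ≤ √(gm f x) := by
        refine Real.le_sqrt_of_sq_le ?_
        rw [mul_pow, Real.sq_sqrt hκ.le]; exact h5
      have hp : ‖pt f x‖ = r * √(gm f x) := by
        have : ‖pt f x‖ ^ 2 = (r * √(gm f x)) ^ 2 := by
          rw [← real_inner_self_eq_norm_sq, pt_sq, real_inner_self_eq_norm_sq, hx.1, mul_pow,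
            Real.sq_sqrt (gm_nonneg f x)]
        exact (sq_eq_sq₀ (norm_nonneg _) (by positivity)).1 this
      have h10 : t x ^ θ * (β * √κ * s * √(gm f x) / 2) ≤ t x ^ θ * (t x ^ β - t y ^ β) := by
        calc t x ^ θ * (β * √κ * s * √(gm f x) / 2)
            = β * (s * (√κ * t x ^ θ * √(gm f x)) / 2) := by ring
          _ ≤ β * (s * (√(gm f x) * √(gm f x)) / 2) := by gcongr
          _ = β * (s * gm f x / 2) := by rw [hgs]
          _ ≤ β * (t x - t y) := by gcongr
          _ ≤ _ := hb
      have h11 := le_of_mul_le_mul_left h10 hT0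
      have h12 : 0 ≤ β * √κ * s * √(gm f x) / 2 := by positivity
      calc ‖y - x‖ ≤ 2 * (s * ‖pt f x‖) := h3
        _ = 4 * r / (β * √κ) * (β * √κ * s * √(gm f x) / 2) := by
            rw [hp]; field_simp; ring
        _ ≤ K1 * (β * √κ * s * √(gm f x) / 2) := by gcongr
        _ ≤ K1 * (t x ^ β - t y ^ β) := by gcongr
        _ = _ := by ring
  · intro x hx hwx
    have h0 : 0 < t x := by
      rcases (ht0 x).eq_or_lt with h0 | h0
      · rw [← h0, Real.zero_rpow hβ0.ne', mul_zero] at hwx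
        exact absurd hwx (lt_irrefl _)
      · exact h0
    obtain ⟨h4, h5⟩ := low x hx h0
    have h1 := dec 1 (by simp) x hx
    have hgp : 0 < gm f x := lt_of_lt_of_le (by positivity) h5
    simp only
    set y := stp f r (1 * (s0 * t x)) x with hy
    have h6 : 0 < 1 * (s0 * t x) * gm f x / 2 := by positivity
    have h7 : t y < t x := max_lt (by linarith) h0
    have := Real.rpow_lt_rpow (ht0 y) h7 hβ0
    gcongr
  · intro x
    have h1 : K1 * t x ^ β = 0 ↔ f x ≤ c := by
      rw [mul_eq_zero, Real.rpow_eq_zero (ht0 x) hβ0.ne', ht]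
      simp only [hK1p.ne', false_or]
      rw [max_eq_right_iff, sub_nonpos]
    simp only [h1, hK, Set.mem_ofPred_eq]
    constructor
    · rintro ⟨a1, a2⟩; exact ⟨⟨a1, by linarith⟩, a2⟩
    · rintro ⟨⟨a1, _⟩, a2⟩; exact ⟨a1, a2⟩

end Hom

end

open Metric Set

/-- For `f` analytic near the origin with `f 0 = 0`, `ℓ` a positive
rational and `a < 0`, with `V^{ℓ,a} = {x ≠ 0 : f x ≤ a‖x‖^ℓ}`, there is `r₀ > 0` with
`closedBall 0 r₀ ⊆ U` such that for every `r ∈ (0, r₀]` there is `y₀ < 0` such that for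
every `y ∈ [y₀, 0)` the sets `S_r^{ℓ,a}` and `F^{ℓ,a}(y)` are homotopy equivalent. -/
theorem statement0 (n : ℕ) (f : EuclideanSpace ℝ (Fin n) → ℝ)
    (U : Set (EuclideanSpace ℝ (Fin n))) (hU : IsOpen U)
    (h0U : (0 : EuclideanSpace ℝ (Fin n)) ∈ U)
    (hf : AnalyticOnNhd ℝ f U) (hf0 : f 0 = 0)
    (ℓ : ℚ) (hℓ : 0 < ℓ) (a : ℝ) (ha : a < 0) :
    ∃ r₀ > (0 : ℝ), closedBall (0 : EuclideanSpace ℝ (Fin n)) r₀ ⊆ U ∧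
      ∀ r ∈ Ioc (0 : ℝ) r₀, ∃ y₀ < (0 : ℝ), ∀ y ∈ Ico y₀ (0 : ℝ),
        Nonempty (ContinuousMap.HomotopyEquiv
          ↥{x : EuclideanSpace ℝ (Fin n) | ‖x‖ = r ∧ x ≠ 0 ∧ f x ≤ a * ‖x‖ ^ (ℓ : ℝ)}
          ↥{x : EuclideanSpace ℝ (Fin n) |
              (‖x‖ ≤ r₀ ∧ f x = y) ∧ x ≠ 0 ∧ f x ≤ a * ‖x‖ ^ (ℓ : ℝ)}) := by
  have hfa := hf 0 h0U
  obtain ⟨η1, hη1, hA⟩ := Geo.partA hfa hf0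
  obtain ⟨η2, hη2, hC⟩ := Geo.partC hfa a ℓ hℓ
  obtain ⟨η3, hη3, hball⟩ := Metric.isOpen_iff.1 hU 0 h0U
  have hm : 0 < min η1 (min η2 η3) := lt_min hη1 (lt_min hη2 hη3)
  set r0 := min η1 (min η2 η3) / 2 with hr0def
  have hr0 : 0 < r0 := by positivity
  have hr1 : r0 < η1 := lt_of_lt_of_le (half_lt_self hm) (min_le_left _ _)
  have hr2 : r0 < η2 := lt_of_lt_of_le (half_lt_self hm)
    ((min_le_right _ _).trans (min_le_left _ _))
  have hr3 : r0 < η3 := lt_of_lt_of_le (half_lt_self hm)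
    ((min_le_right _ _).trans (min_le_right _ _))
  have hsub : closedBall (0 : EuclideanSpace ℝ (Fin n)) r0 ⊆ U :=
    (closedBall_subset_ball hr3).trans hball
  have hl : (0:ℝ) < (ℓ:ℝ) := by exact_mod_cast hℓ
  have han : ∀ x : EuclideanSpace ℝ (Fin n), ‖x‖ ≤ r0 → AnalyticAt ℝ f x := fun x hx =>
    hf x (hsub (mem_closedBall_zero_iff.2 hx))
  refine ⟨r0, hr0, hsub, fun r hr => ?_⟩
  have hrp : 0 < r ^ (ℓ:ℝ) := Real.rpow_pos_of_pos hr.1 _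
  refine ⟨a * r ^ (ℓ:ℝ), mul_neg_of_neg_of_pos ha hrp, fun y hy => ?_⟩
  -- the radius attached to y
  obtain ⟨ρ, hρ, hρy⟩ : ∃ ρ > (0:ℝ), a * ρ ^ (ℓ:ℝ) = y := by
    have hya : 0 < y / a := div_pos_of_neg_of_neg hy.2 ha
    refine ⟨(y / a) ^ ((ℓ:ℝ)⁻¹), Real.rpow_pos_of_pos hya _, ?_⟩
    rw [Real.rpow_inv_rpow hya.le hl.ne']
    exact mul_div_cancel_of_imp' (fun h => absurd h ha.ne)
  have hρp : 0 < ρ ^ (ℓ:ℝ) := Real.rpow_pos_of_pos hρ _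
  have hρr : ρ ≤ r := by
    have h1 : a * r ^ (ℓ:ℝ) ≤ a * ρ ^ (ℓ:ℝ) := by rw [hρy]; exact hy.1
    have h2 : ρ ^ (ℓ:ℝ) ≤ r ^ (ℓ:ℝ) := (mul_le_mul_left_of_neg ha).1 h1
    exact (Real.rpow_le_rpow_iff hρ.le hr.1.le hl).1 h2
  have hrr : ρ ≤ r0 := hρr.trans hr.2
  obtain ⟨ε1, hε1, hC⟩ := hC ρ hρ r (hr.2.trans_lt hr2)
  obtain ⟨ε2, hε2, h2⟩ := Hom.H1 hr.1 (fun x hx => han x (hx.le.trans hr.2)) (a * r ^ (ℓ:ℝ))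
  obtain ⟨ε3, hε3, h3⟩ := Hom.H1 hρ (fun x hx => han x (hx.le.trans hrr)) (a * ρ ^ (ℓ:ℝ))
  obtain ⟨ε, hε, he1, he2, he3⟩ : ∃ ε > (0:ℝ), ε ≤ ε1 ∧ ε * r ^ (ℓ:ℝ) ≤ ε2 ∧
      ε * ρ ^ (ℓ:ℝ) ≤ ε3 := by
    refine ⟨min ε1 (min (ε2 / r ^ (ℓ:ℝ)) (ε3 / ρ ^ (ℓ:ℝ))), by positivity, min_le_left _ _, ?_, ?_⟩
    · rw [← le_div_iff₀ hrp]; exact (min_le_right _ _).trans (min_le_left _ _)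
    · rw [← le_div_iff₀ hρp]; exact (min_le_right _ _).trans (min_le_right _ _)
  obtain ⟨e1⟩ := h2 (ε * r ^ (ℓ:ℝ)) (by positivity) he2
  obtain ⟨e3⟩ := h3 (ε * ρ ^ (ℓ:ℝ)) (by positivity) he3
  rw [← add_mul] at e1 e3
  obtain ⟨e2⟩ := Hom.H2' (f := f) (b := a + ε) (l := (ℓ:ℝ)) hρ hρr
    (fun x hx => han x (hx.trans hr.2)) (fun x h1 h2 h3 h4 => by
      have hxp : 0 < ‖x‖ ^ (ℓ:ℝ) := Real.rpow_pos_of_pos (hρ.trans_le h1) _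
      have h5 : f x ≤ (a + ε1) * ‖x‖ ^ (ℓ:ℝ) := by rw [h3]; gcongr
      have h6 := hC x h1 h2 h4 h5
      rw [h3, add_mul] at h6
      have := mul_pos hε hxp
      linarith)
  obtain ⟨e4⟩ := Hom.H4 (f := f) (y := y) hρ (fun x hx => han x (hx.trans hrr)) hf0 hy.2
    (fun x h1 h2 h3 h4 => hA x h1 (by linarith) h3 h4)
  rw [hρy] at e3
  have E := ((e1.trans e2).trans e3.symm).trans e4
  have hS : {x : EuclideanSpace ℝ (Fin n) | ‖x‖ = r ∧ x ≠ 0 ∧ f x ≤ a * ‖x‖ ^ (ℓ : ℝ)} =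
      {x | ‖x‖ = r ∧ f x ≤ a * r ^ (ℓ:ℝ)} := by
    ext x
    simp only [Set.mem_ofPred_eq]
    constructor
    · rintro ⟨k1, -, k2⟩; rw [k1] at k2; exact ⟨k1, k2⟩
    · rintro ⟨k1, k2⟩
      refine ⟨k1, norm_pos_iff.1 (k1 ▸ hr.1), by rw [k1]; exact k2⟩
  have hF : {x : EuclideanSpace ℝ (Fin n) |
      (‖x‖ ≤ r0 ∧ f x = y) ∧ x ≠ 0 ∧ f x ≤ a * ‖x‖ ^ (ℓ : ℝ)} =
      {x | ‖x‖ ≤ ρ ∧ f x = y} := by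
    ext x
    simp only [Set.mem_ofPred_eq]
    constructor
    · rintro ⟨⟨k1, k2⟩, -, k4⟩
      refine ⟨?_, k2⟩
      rw [k2, ← hρy] at k4
      exact (Real.rpow_le_rpow_iff (norm_nonneg x) hρ.le hl).1 ((mul_le_mul_left_of_neg ha).1 k4)
    · rintro ⟨k1, k2⟩
      refine ⟨⟨k1.trans hrr, k2⟩, ?_, ?_⟩
      · rintro rfl; rw [hf0] at k2; linarith [hy.2]
      · rw [k2, ← hρy]
        exact (mul_le_mul_left_of_neg ha).2 (Real.rpow_le_rpow (norm_nonneg x) k1 hl.le)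
  rw [hS, hF]
  exact ⟨E⟩
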